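/- arXiv:math/0506288 — 2 statements merged into one kernel-verified Lean document; each statement's English description precedes it below -/
import Mathlib

section
/- Let t ≥ 1 be a fixed integer and let l = l(n) be a sequence of positive integers with l(n) → ∞, l(n)^t ≤ n, and n / l(n)^{t+1} → 0 as n → ∞. Then D^tree(n, l(n)) / l(n) → (t+1)/2 as n → ∞. Moreover, the lower bound is achieved by uncolored trees: for every ε > 0 and all sufficiently large n there is an (uncolored) tree T with at most n vertices and maximum degree at most l(n) such that D(T) ≥ ((t+1)/2 − ε) · l(n). -/
namespace FODef

/-- A graph colored with `K` unary predicates. -/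
structure CGraph (K : ℕ) (V : Type) where
  graph : SimpleGraph V
  color : Fin K → V → Prop

/-- First-order formulas in the language of graphs with `K` unary color predicates,
with free variables among `x_0, …, x_{n-1}`. -/
inductive CForm (K : ℕ) : ℕ → Type
  | adj {n : ℕ} (i j : Fin n) : CForm K n
  | eq {n : ℕ} (i j : Fin n) : CForm K n
  | col {n : ℕ} (c : Fin K) (i : Fin n) : CForm K n
  | neg {n : ℕ} : CForm K n → CForm K n
  | conj {n : ℕ} : CForm K n → CForm K n → CForm K n
  | disj {n : ℕ} : CForm K n → CForm K n → CForm K n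
  | ex {n : ℕ} : CForm K (n + 1) → CForm K n
  | fa {n : ℕ} : CForm K (n + 1) → CForm K n

/-- Realization of a formula in a colored graph, under a valuation of the free variables. -/
def CForm.Realize {K : ℕ} {V : Type} (C : CGraph K V) :
    ∀ {n : ℕ}, CForm K n → (Fin n → V) → Prop
  | _, .adj i j, f => C.graph.Adj (f i) (f j)
  | _, .eq i j, f => f i = f j
  | _, .col c i, f => C.color c (f i)
  | _, .neg φ, f => ¬ CForm.Realize C φ f
  | _, .conj φ ψ, f => CForm.Realize C φ f ∧ CForm.Realize C ψ f
  | _, .disj φ ψ, f => CForm.Realize C φ f ∨ CForm.Realize C ψ f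
  | _, .ex φ, f => ∃ v : V, CForm.Realize C φ (Fin.snoc f v)
  | _, .fa φ, f => ∀ v : V, CForm.Realize C φ (Fin.snoc f v)

/-- Quantifier depth: the maximum number of nested quantifiers. -/
def CForm.depth {K : ℕ} : ∀ {n : ℕ}, CForm K n → ℕ
  | _, .adj _ _ => 0
  | _, .eq _ _ => 0
  | _, .col _ _ => 0
  | _, .neg φ => φ.depth
  | _, .conj φ ψ => max φ.depth ψ.depth
  | _, .disj φ ψ => max φ.depth ψ.depth
  | _, .ex φ => φ.depth + 1
  | _, .fa φ => φ.depth + 1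

/-- Isomorphism of colored graphs: a graph isomorphism preserving all colors. -/
def CIso {K : ℕ} {V W : Type} (C : CGraph K V) (C' : CGraph K W) : Prop :=
  ∃ e : V ≃ W, (∀ v w : V, C.graph.Adj v w ↔ C'.graph.Adj (e v) (e w)) ∧
    ∀ (c : Fin K) (v : V), C.color c v ↔ C'.color c (e v)

/-- A sentence (formula with no free variables) holds in a colored graph. -/
def CSat {K : ℕ} {V : Type} (C : CGraph K V) (φ : CForm K 0) : Prop :=
  φ.Realize C ![]

/-- A sentence defines a colored graph `C` if `C` satisfies it and every finite colored
graph (in the same language) satisfying it is isomorphic to `C`. -/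
def CDefines {K : ℕ} {V : Type} (C : CGraph K V) (φ : CForm K 0) : Prop :=
  CSat C φ ∧ ∀ (m : ℕ) (C' : CGraph K (Fin m)), CSat C' φ → CIso C C'

/-- Minimum quantifier depth of a first-order sentence defining a colored graph. -/
noncomputable def Dcol {K : ℕ} {V : Type} (C : CGraph K V) : ℕ :=
  sInf {d | ∃ φ : CForm K 0, φ.depth = d ∧ CDefines C φ}

/-- A colored tree: the underlying graph is connected and acyclic. -/
def IsColTree {K : ℕ} {V : Type} (C : CGraph K V) : Prop :=
  C.graph.Connected ∧ C.graph.IsAcyclic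

/-- Degree of a vertex. -/
noncomputable def deg {V : Type} (G : SimpleGraph V) (v : V) : ℕ :=
  Nat.card {w // G.Adj v w}

/-- `Dtree n l`: the maximum of `Dcol T` over all colored trees `T` with at most `n`
vertices and maximum degree at most `l` (with any finite number of colors). -/
noncomputable def Dtree (n l : ℕ) : ℕ :=
  sSup {d | ∃ (K m : ℕ) (C : CGraph K (Fin m)), IsColTree C ∧ m ≤ n ∧
    (∀ v, deg C.graph v ≤ l) ∧ d = Dcol C}

/-- An uncolored graph, viewed as a colored graph with no colors.  A sentence of the
pure graph language defines it iff it `CDefines` it, and `CIso` for such graphs is plain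
graph isomorphism, so `Dcol (plain G)` is the minimum quantifier depth `D(G)` of a
first-order sentence defining the (uncolored) graph `G`. -/
def plain {V : Type} (G : SimpleGraph V) : CGraph 0 V :=
  ⟨G, fun c _ => c.elim0⟩

end FODef

open Filter FODef

namespace FODef

section Game
variable {K : ℕ} {V V' : Type}

/-- A set of pairs is a partial isomorphism between two colored graphs. -/
def PartialIso (C : CGraph K V) (C' : CGraph K V') (P : Set (V × V')) : Prop :=
  ∀ p ∈ P, ∀ q ∈ P, (p.1 = q.1 ↔ p.2 = q.2) ∧
    (C.graph.Adj p.1 q.1 ↔ C'.graph.Adj p.2 q.2) ∧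
    ∀ c, (C.color c p.1 ↔ C'.color c p.2)

/-- Duplicator survives `r` further rounds of the Ehrenfeucht game from the position `P`,
a set of pairs of pebbled vertices. -/
def Eqv (C : CGraph K V) (C' : CGraph K V') : ℕ → Set (V × V') → Prop
  | 0, P => PartialIso C C' P
  | r + 1, P => PartialIso C C' P ∧ (∀ v, ∃ v', Eqv C C' r (insert (v, v') P)) ∧
      ∀ v', ∃ v, Eqv C C' r (insert (v, v') P)

variable {C : CGraph K V} {C' : CGraph K V'}

theorem Eqv.partialIso {r : ℕ} {P : Set (V × V')} (h : Eqv C C' r P) : PartialIso C C' P := by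
  cases r with
  | zero => exact h
  | succ r => exact h.1

theorem PartialIso.mono {P Q : Set (V × V')} (h : PartialIso C C' P) (hQ : Q ⊆ P) :
    PartialIso C C' Q :=
  fun p hp q hq => h p (hQ hp) q (hQ hq)

theorem Eqv.mono {r : ℕ} : ∀ {P Q : Set (V × V')}, Eqv C C' r P → Q ⊆ P → Eqv C C' r Q := by
  induction r with
  | zero => exact fun h hQ => PartialIso.mono h hQ
  | succ r ih =>
    intro P Q h hQ
    refine ⟨h.1.mono hQ, fun v => ?_, fun v' => ?_⟩
    · obtain ⟨v', hv⟩ := h.2.1 v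
      exact ⟨v', ih hv (Set.insert_subset_insert hQ)⟩
    · obtain ⟨v, hv⟩ := h.2.2 v'
      exact ⟨v, ih hv (Set.insert_subset_insert hQ)⟩

theorem Eqv.of_succ {r : ℕ} : ∀ {P : Set (V × V')}, Eqv C C' (r + 1) P → Eqv C C' r P := by
  induction r with
  | zero => exact fun h => h.1
  | succ r ih =>
    intro P h
    refine ⟨h.1, fun v => ?_, fun v' => ?_⟩
    · obtain ⟨v', hv⟩ := h.2.1 v
      exact ⟨v', ih hv⟩
    · obtain ⟨v, hv⟩ := h.2.2 v'
      exact ⟨v, ih hv⟩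

theorem Eqv.of_le {r s : ℕ} {P : Set (V × V')} (h : Eqv C C' s P) (hrs : r ≤ s) :
    Eqv C C' r P := by
  induction s, hrs using Nat.le_induction with
  | base => exact h
  | succ s _ ih => exact ih h.of_succ

theorem PartialIso.swap {P : Set (V × V')} (h : PartialIso C C' P) :
    PartialIso C' C (Prod.swap ⁻¹' P) :=
  fun _ hp _ hq => ⟨(h _ hp _ hq).1.symm, (h _ hp _ hq).2.1.symm,
    fun c => ((h _ hp _ hq).2.2 c).symm⟩

theorem Eqv.swap {r : ℕ} : ∀ {P : Set (V × V')}, Eqv C C' r P →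
    Eqv C' C r (Prod.swap ⁻¹' P) := by
  have key : ∀ (P : Set (V × V')) v v', Prod.swap ⁻¹' (insert (v, v') P) =
      insert (v', v) (Prod.swap ⁻¹' P) := by
    intro P v v'
    ext ⟨a, b⟩
    simp [and_comm]
  induction r with
  | zero => exact fun h => PartialIso.swap h
  | succ r ih =>
    intro P h
    refine ⟨h.1.swap, fun v => ?_, fun v' => ?_⟩
    · obtain ⟨v', hv⟩ := h.2.2 v
      exact ⟨v', key P v' v ▸ ih hv⟩
    · obtain ⟨v, hv⟩ := h.2.1 v'
      exact ⟨v, key P v' v ▸ ih hv⟩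

/-- Spoiler may pebble a whole finite set of vertices. -/
theorem Eqv.exists_image [Nonempty V'] {r : ℕ} (Y : Finset V) : ∀ {P : Set (V × V')},
    Eqv C C' (Y.card + r) P → ∃ φ : V → V', Eqv C C' r (P ∪ (fun y => (y, φ y)) '' ↑Y) := by
  classical
  induction Y using Finset.induction_on with
  | empty => exact fun h => ⟨fun _ => Classical.arbitrary V', by simpa using h⟩
  | insert a Y ha ih =>
    intro P h
    rw [Finset.card_insert_of_notMem ha, Nat.add_right_comm] at h
    obtain ⟨a', h'⟩ := h.2.1 a
    obtain ⟨φ, hφ⟩ := ih h'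
    refine ⟨Function.update φ a a', hφ.mono ?_⟩
    rintro p (hp | ⟨y, hy, rfl⟩)
    · exact Or.inl (Or.inr hp)
    · by_cases hya : y = a
      · subst hya
        simp
      · refine Or.inr ⟨y, ?_, by simp [hya]⟩
        simpa [hya] using hy

theorem range_snoc {n : ℕ} (f : Fin n → V) (g : Fin n → V') (v : V) (v' : V') :
    Set.range (fun i => ((Fin.snoc f v : Fin (n + 1) → V) i,
      (Fin.snoc g v' : Fin (n + 1) → V') i)) =
      insert (v, v') (Set.range fun i => (f i, g i)) := by
  ext p
  constructor
  · rintro ⟨i, rfl⟩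
    induction i using Fin.lastCases with
    | last => left; simp
    | cast i => right; exact ⟨i, by simp⟩
  · rintro (rfl | ⟨i, rfl⟩)
    · exact ⟨Fin.last n, by simp⟩
    · exact ⟨i.castSucc, by simp⟩

theorem Eqv.realize_iff {n : ℕ} (φ : CForm K n) : ∀ {r : ℕ} {f : Fin n → V} {g : Fin n → V'},
    φ.depth ≤ r → Eqv C C' r (Set.range fun i => (f i, g i)) →
    (φ.Realize C f ↔ φ.Realize C' g) := by
  induction φ with
  | adj i j => exact fun _ h => (h.partialIso _ ⟨i, rfl⟩ _ ⟨j, rfl⟩).2.1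
  | eq i j => exact fun _ h => (h.partialIso _ ⟨i, rfl⟩ _ ⟨j, rfl⟩).1
  | col c i => exact fun _ h => (h.partialIso _ ⟨i, rfl⟩ _ ⟨i, rfl⟩).2.2 c
  | neg φ ih => exact fun hr h => not_congr (ih hr h)
  | conj φ ψ ih₁ ih₂ =>
    exact fun hr h => and_congr (ih₁ ((le_max_left _ _).trans hr) h)
      (ih₂ ((le_max_right _ _).trans hr) h)
  | disj φ ψ ih₁ ih₂ =>
    exact fun hr h => or_congr (ih₁ ((le_max_left _ _).trans hr) h)
      (ih₂ ((le_max_right _ _).trans hr) h)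
  | ex φ ih =>
    intro r f g hr h
    obtain ⟨r, rfl⟩ : ∃ s, r = s + 1 := ⟨r - 1, by simp only [CForm.depth] at hr; omega⟩
    have hr' : φ.depth ≤ r := Nat.le_of_succ_le_succ hr
    constructor
    · rintro ⟨v, hv⟩
      obtain ⟨v', hv'⟩ := h.2.1 v
      exact ⟨v', (ih hr' (range_snoc f g v v' ▸ hv')).1 hv⟩
    · rintro ⟨v', hv⟩
      obtain ⟨v, hv'⟩ := h.2.2 v'
      exact ⟨v, (ih hr' (range_snoc f g v v' ▸ hv')).2 hv⟩
  | fa φ ih =>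
    intro r f g hr h
    obtain ⟨r, rfl⟩ : ∃ s, r = s + 1 := ⟨r - 1, by simp only [CForm.depth] at hr; omega⟩
    have hr' : φ.depth ≤ r := Nat.le_of_succ_le_succ hr
    constructor
    · intro H v'
      obtain ⟨v, hv'⟩ := h.2.2 v'
      exact (ih hr' (range_snoc f g v v' ▸ hv')).1 (H v)
    · intro H v
      obtain ⟨v', hv'⟩ := h.2.1 v
      exact (ih hr' (range_snoc f g v v' ▸ hv')).2 (H v')

theorem Eqv.csat_iff {r : ℕ} {φ : CForm K 0} (hr : φ.depth ≤ r) (h : Eqv C C' r ∅) :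
    CSat C φ ↔ CSat C' φ :=
  h.mono (Set.range_eq_empty _).subset |>.realize_iff φ hr

theorem CIso.symm (h : CIso C C') : CIso C' C := by
  obtain ⟨e, h₁, h₂⟩ := h
  exact ⟨e.symm, fun v w => by rw [h₁]; simp, fun c v => by rw [h₂]; simp⟩

theorem CIso.trans {V'' : Type} {C'' : CGraph K V''} (h : CIso C C') (h' : CIso C' C'') :
    CIso C C'' := by
  obtain ⟨e, h₁, h₂⟩ := h
  obtain ⟨e', h₁', h₂'⟩ := h'
  exact ⟨e.trans e', fun v w => by rw [h₁, h₁']; simp, fun c v => by rw [h₂, h₂']; simp⟩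

theorem CIso.eqv (h : CIso C C') (r : ℕ) : Eqv C C' r ∅ := by
  obtain ⟨e, h₁, h₂⟩ := h
  suffices ∀ r, Eqv C C' r {p | p.2 = e p.1} from (this r).mono (Set.empty_subset _)
  have h0 : PartialIso C C' {p | p.2 = e p.1} := by
    rintro ⟨a, a'⟩ ha ⟨b, b'⟩ hb
    obtain rfl : a' = e a := ha
    obtain rfl : b' = e b := hb
    exact ⟨by simp, h₁ _ _, fun c => h₂ c a⟩
  intro r
  induction r with
  | zero => exact h0
  | succ r ih =>
    refine ⟨h0, fun v => ⟨e v, ?_⟩, fun v' => ⟨e.symm v', ?_⟩⟩ <;>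
    · rwa [Set.insert_eq_of_mem (by simp)]

end Game

section Hintikka
variable {K : ℕ} {V V' : Type}

/-- A valid formula. -/
def CForm.top {n : ℕ} : CForm K n := .fa (.eq (Fin.last n) (Fin.last n))

/-- The conjunction of a list of formulas. -/
def CForm.all {n : ℕ} (L : List (CForm K n)) : CForm K n := L.foldr .conj .top

/-- The disjunction of a list of formulas. -/
def CForm.any {n : ℕ} (L : List (CForm K n)) : CForm K n := L.foldr .disj (.neg .top)

theorem CForm.realize_all {n : ℕ} (C : CGraph K V) (L : List (CForm K n)) (f : Fin n → V) :
    (CForm.all L).Realize C f ↔ ∀ φ ∈ L, φ.Realize C f := by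
  induction L with
  | nil => simp [CForm.all, CForm.top, CForm.Realize]
  | cons φ L ih =>
    rw [List.forall_mem_cons, ← ih]
    rfl

theorem CForm.realize_any {n : ℕ} (C : CGraph K V) (L : List (CForm K n)) (f : Fin n → V) :
    (CForm.any L).Realize C f ↔ ∃ φ ∈ L, φ.Realize C f := by
  induction L with
  | nil => simp [CForm.any, CForm.top, CForm.Realize]
  | cons φ L ih =>
    rw [List.exists_mem_cons_iff, ← ih]
    rfl

theorem CForm.depth_all_le {n r : ℕ} {L : List (CForm K n)} (h : ∀ φ ∈ L, φ.depth ≤ r + 1) :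
    (CForm.all L).depth ≤ r + 1 := by
  induction L with
  | nil => simp [CForm.all, CForm.top, CForm.depth]
  | cons φ L ih =>
    rw [List.forall_mem_cons] at h
    exact max_le h.1 (ih h.2)

theorem CForm.depth_any_le {n r : ℕ} {L : List (CForm K n)} (h : ∀ φ ∈ L, φ.depth ≤ r + 1) :
    (CForm.any L).depth ≤ r + 1 := by
  induction L with
  | nil => simp [CForm.any, CForm.top, CForm.depth]
  | cons φ L ih =>
    rw [List.forall_mem_cons] at h
    exact max_le h.1 (ih h.2)

open Classical in
/-- Negate a formula unless `p` holds. -/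
noncomputable def CForm.lit {n : ℕ} (p : Prop) (φ : CForm K n) : CForm K n :=
  if p then φ else .neg φ

theorem CForm.realize_lit {n : ℕ} (C : CGraph K V) (p : Prop) (φ : CForm K n) (f : Fin n → V) :
    (CForm.lit p φ).Realize C f ↔ (p ↔ φ.Realize C f) := by
  by_cases hp : p <;> simp [CForm.lit, hp, CForm.Realize]

theorem CForm.depth_lit {n : ℕ} (p : Prop) (φ : CForm K n) :
    (CForm.lit p φ).depth = φ.depth := by
  by_cases hp : p <;> simp [CForm.lit, hp, CForm.depth]

/-- The atomic type of a tuple of vertices. -/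
noncomputable def atomicType (C : CGraph K V) {n : ℕ} (f : Fin n → V) : CForm K n :=
  .all ((List.finRange n).flatMap fun i => (List.finRange n).flatMap fun j =>
    CForm.lit (f i = f j) (.eq i j) :: CForm.lit (C.graph.Adj (f i) (f j)) (.adj i j) ::
      (List.finRange K).map fun c => CForm.lit (C.color c (f i)) (.col c i))

theorem depth_atomicType_le (C : CGraph K V) {n : ℕ} (f : Fin n → V) :
    (atomicType C f).depth ≤ 1 := by
  refine CForm.depth_all_le (r := 0) fun φ hφ => ?_
  simp only [List.mem_flatMap, List.mem_finRange, true_and, List.mem_cons, List.mem_map] at hφ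
  obtain ⟨i, j, rfl | rfl | ⟨c, rfl⟩⟩ := hφ <;> simp [CForm.depth_lit, CForm.depth]

theorem realize_atomicType (C : CGraph K V) (C' : CGraph K V') {n : ℕ} (f : Fin n → V)
    (g : Fin n → V') :
    (atomicType C f).Realize C' g ↔ PartialIso C C' (Set.range fun i => (f i, g i)) := by
  unfold atomicType PartialIso
  simp only [CForm.realize_all, List.mem_flatMap, List.mem_finRange, true_and, List.mem_cons,
    List.mem_map, Set.forall_mem_range]
  constructor
  · intro h i j
    exact ⟨(CForm.realize_lit _ _ _ _).1 (h _ ⟨i, j, Or.inl rfl⟩),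
      (CForm.realize_lit _ _ _ _).1 (h _ ⟨i, j, Or.inr (Or.inl rfl)⟩),
      fun c => (CForm.realize_lit _ _ _ _).1 (h _ ⟨i, j, Or.inr (Or.inr ⟨c, rfl⟩)⟩)⟩
  · rintro h φ ⟨i, j, rfl | rfl | ⟨c, rfl⟩⟩ <;> rw [CForm.realize_lit]
    · exact (h i j).1
    · exact (h i j).2.1
    · exact (h i j).2.2 c

/-- The Hintikka formula describing the `r`-round game type of a tuple in a finite graph. -/
noncomputable def hintikka [Fintype V] (C : CGraph K V) :
    ℕ → ∀ {n : ℕ}, (Fin n → V) → CForm K n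
  | 0, _, f => atomicType C f
  | r + 1, _, f => .conj (atomicType C f) (.conj
      (.all (Finset.univ.toList.map fun v : V => .ex (hintikka C r (Fin.snoc f v))))
      (.fa (.any (Finset.univ.toList.map fun v : V => hintikka C r (Fin.snoc f v)))))

theorem depth_hintikka_le [Fintype V] (C : CGraph K V) (r : ℕ) :
    ∀ {n : ℕ} (f : Fin n → V), (hintikka C r f).depth ≤ r + 1 := by
  induction r with
  | zero => exact fun f => depth_atomicType_le C f
  | succ r ih =>
    intro n f
    refine max_le ((depth_atomicType_le C f).trans (by omega)) (max_le ?_ ?_)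
    · refine CForm.depth_all_le fun φ hφ => ?_
      obtain ⟨v, -, rfl⟩ := List.mem_map.1 hφ
      exact Nat.succ_le_succ (ih _)
    · refine Nat.succ_le_succ (CForm.depth_any_le fun φ hφ => ?_)
      obtain ⟨v, -, rfl⟩ := List.mem_map.1 hφ
      exact ih _

theorem realize_hintikka [Fintype V] (C : CGraph K V) (C' : CGraph K V') (r : ℕ) :
    ∀ {n : ℕ} (f : Fin n → V) (g : Fin n → V'),
    (hintikka C r f).Realize C' g ↔ Eqv C C' r (Set.range fun i => (f i, g i)) := by
  induction r with
  | zero => exact fun f g => realize_atomicType C C' f g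
  | succ r ih =>
    intro n f g
    simp only [hintikka, CForm.Realize, Eqv, realize_atomicType, CForm.realize_all,
      CForm.realize_any, List.mem_map, Finset.mem_toList, Finset.mem_univ, true_and,
      exists_exists_eq_and, ← range_snoc]
    simp only [forall_exists_index, forall_apply_eq_imp_iff, CForm.Realize, ih]

theorem Dcol_le_of_eqv {m : ℕ} {C : CGraph K (Fin m)} {r : ℕ}
    (h : ∀ (m' : ℕ) (C' : CGraph K (Fin m')), Eqv C C' r ∅ → CIso C C') :
    (∃ φ : CForm K 0, CDefines C φ) ∧ Dcol C ≤ r + 1 := by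
  have key : CDefines C (hintikka C r ![]) := by
    refine ⟨(realize_hintikka C C r ![] ![]).2 ?_, fun m' C' hC' => h m' C' ?_⟩
    · have : CIso C C := ⟨Equiv.refl _, fun _ _ => Iff.rfl, fun _ _ => Iff.rfl⟩
      exact (this.eqv r).mono (Set.range_eq_empty _).subset
    · exact ((realize_hintikka C C' r ![] ![]).1 hC').mono (Set.empty_subset _)
  exact ⟨⟨_, key⟩, le_trans (Nat.sInf_le ⟨hintikka C r ![], rfl, key⟩)
    (depth_hintikka_le C r ![])⟩

theorem lt_Dcol_of_eqv {C : CGraph K V} {C' : CGraph K V'} {m m' : ℕ} {D : CGraph K (Fin m)}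
    {D' : CGraph K (Fin m')} {r : ℕ} (hD : CIso C D) (hD' : CIso C' D')
    (hdef : ∃ φ : CForm K 0, CDefines D φ) (h : Eqv C C' r ∅) (hiso : ¬ CIso C C') :
    r < Dcol D := by
  obtain ⟨φ, hφ⟩ := hdef
  obtain ⟨ψ, hψ, hd⟩ : Dcol D ∈ {d | ∃ φ : CForm K 0, φ.depth = d ∧ CDefines D φ} :=
    Nat.sInf_mem ⟨_, φ, rfl, hφ⟩
  by_contra! hr
  have h₁ := ((hD.eqv _).csat_iff le_rfl).2 hd.1
  have h₂ := (h.csat_iff (hψ ▸ hr)).1 h₁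
  exact hiso (hD.trans ((hd.2 _ _ (((hD'.eqv _).csat_iff le_rfl).1 h₂)).trans hD'.symm))

end Hintikka

section Deletion
variable {V : Type}

/-- The graph obtained by isolating the vertices of `S`. -/
def del (G : SimpleGraph V) (S : Set V) : SimpleGraph V where
  Adj a b := G.Adj a b ∧ a ∉ S ∧ b ∉ S
  symm := ⟨fun _ _ h => ⟨h.1.symm, h.2.2, h.2.1⟩⟩
  loopless := ⟨fun _ h => h.1.ne rfl⟩

theorem del_le (G : SimpleGraph V) (S : Set V) : del G S ≤ G := fun _ _ h => h.1

theorem del_insert (G : SimpleGraph V) (S : Set V) (v : V) :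
    del G (insert v S) = del (del G S) {v} := by
  ext a b
  simp only [del, Set.mem_insert_iff, Set.mem_singleton_iff]
  tauto

theorem del_empty (G : SimpleGraph V) : del G ∅ = G := by
  ext a b
  simp [del]

theorem reachable_induction {G : SimpleGraph V} {x y : V} (h : G.Reachable x y) {p : V → Prop}
    (hx : p x) (hp : ∀ a b, G.Reachable x a → G.Adj a b → p a → p b) : p y := by
  rw [SimpleGraph.reachable_iff_reflTransGen] at h
  induction h with
  | refl => exact hx
  | tail hab hbc ih => exact hp _ _ ((SimpleGraph.reachable_iff_reflTransGen _ _).2 hab) hbc ih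

theorem not_mem_of_reachable_del {G : SimpleGraph V} {S : Set V} {x y : V}
    (h : (del G S).Reachable x y) (hx : x ∉ S) : y ∉ S :=
  reachable_induction h hx fun _ _ _ hab _ => hab.2.2

theorem not_reachable_delete_edge {G : SimpleGraph V} (hG : G.IsAcyclic) {v y : V}
    (h : G.Adj v y) : ¬ (G.deleteEdges {s(v, y)}).Reachable v y :=
  (SimpleGraph.isBridge_iff.1 (SimpleGraph.isAcyclic_iff_forall_adj_isBridge.1 hG h))

theorem del_le_deleteEdges_left (G : SimpleGraph V) (v y : V) :
    del G {v} ≤ G.deleteEdges {s(v, y)} := by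
  intro a b hab
  simp only [del, Set.mem_singleton_iff, SimpleGraph.deleteEdges_adj] at *
  refine ⟨hab.1, fun h => ?_⟩
  rw [Sym2.eq_iff] at h
  tauto

/-- Distinct neighbors of a vertex of a forest are separated by this vertex. -/
theorem eq_of_reachable_del {G : SimpleGraph V} (hG : G.IsAcyclic) {v y z : V}
    (hy : G.Adj v y) (hz : G.Adj v z) (h : (del G {v}).Reachable y z) : y = z := by
  by_contra hne
  refine not_reachable_delete_edge hG hy ?_
  have h1 : (G.deleteEdges {s(v, y)}).Adj v z := by
    rw [SimpleGraph.deleteEdges_adj]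
    refine ⟨hz, fun h => ?_⟩
    simp only [Set.mem_singleton_iff, Sym2.eq_iff] at h
    rcases h with h | h
    · exact hne h.2.symm
    · exact hz.ne h.2.symm
  exact h1.reachable.trans (h.mono (del_le_deleteEdges_left G v y)).symm

theorem eq_or_exists_adj_of_reachable {G : SimpleGraph V} {v z : V} (h : G.Reachable v z) :
    z = v ∨ ∃ y, G.Adj v y ∧ (del G {v}).Reachable y z := by
  refine reachable_induction (p := fun z => z = v ∨ ∃ y, G.Adj v y ∧ (del G {v}).Reachable y z)
    h (Or.inl rfl) fun a b _ hab ih => ?_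
  by_cases hb : b = v
  · exact Or.inl hb
  rcases ih with rfl | ⟨y, hy, hya⟩
  · exact Or.inr ⟨b, hab, SimpleGraph.Reachable.refl _⟩
  · have ha : a ∉ ({v} : Set V) := not_mem_of_reachable_del hya hy.ne'
    exact Or.inr ⟨y, hy, hya.trans (SimpleGraph.Adj.reachable ⟨hab, ha, hb⟩)⟩

/-- The connected component of a vertex, as a set. -/
def comp (G : SimpleGraph V) (x : V) : Set V := {y | G.Reachable x y}

theorem mem_comp_self (G : SimpleGraph V) (x : V) : x ∈ comp G x := SimpleGraph.Reachable.refl _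

/-- Every finite tree has a centroid. -/
theorem exists_centroid [Finite V] {G : SimpleGraph V} (hG : G.IsAcyclic) (x : V) :
    ∃ v ∈ comp G x, ∀ y, G.Adj v y → 2 * (comp (del G {v}) y).ncard ≤ (comp G x).ncard := by
  by_contra! hbad
  let B : V × V → ℕ := fun p => (comp (del G {p.1}) p.2).ncard
  let s : Set (V × V) := {p | p.1 ∈ comp G x ∧ G.Adj p.1 p.2 ∧ (comp G x).ncard < 2 * B p}
  have hs : s.Nonempty := by
    obtain ⟨y, hy, hB⟩ := hbad x (mem_comp_self G x)
    exact ⟨(x, y), mem_comp_self G x, hy, hB⟩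
  obtain ⟨⟨v, y⟩, ⟨hv, hvy, hB⟩, hmin⟩ := Set.exists_min_image s B s.toFinite hs
  have hy : y ∈ comp G x := SimpleGraph.Reachable.trans hv hvy.reachable
  obtain ⟨z, hyz, hBz⟩ := hbad y hy
  have hle := hmin (y, z) ⟨hy, hyz, hBz⟩
  simp only [B] at hle hB
  by_cases hzv : z = v
  · subst hzv
    have hdisj : Disjoint (comp (del G {z}) y) (comp (del G {y}) z) := by
      rw [Set.disjoint_left]
      intro w hw hw'
      refine not_reachable_delete_edge hG hvy ?_
      have h1 := SimpleGraph.Reachable.mono (del_le_deleteEdges_left G z y) hw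
      have h2 := SimpleGraph.Reachable.mono (del_le_deleteEdges_left G y z) hw'
      rw [Sym2.eq_swap] at h2
      exact h2.trans h1.symm
    have hsub : comp (del G {z}) y ∪ comp (del G {y}) z ⊆ comp G x := by
      rintro w (hw | hw)
      · exact SimpleGraph.Reachable.trans hy (SimpleGraph.Reachable.mono (del_le _ _) hw)
      · exact SimpleGraph.Reachable.trans hv (SimpleGraph.Reachable.mono (del_le _ _) hw)
    have := Set.ncard_le_ncard hsub (Set.toFinite _)
    rw [Set.ncard_union_eq hdisj (Set.toFinite _) (Set.toFinite _)] at this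
    omega
  · have hsub : comp (del G {y}) z ⊆ comp (del G {v}) y := by
      intro w hw
      refine reachable_induction (p := fun w => (del G {v}).Reachable y w) hw
        (SimpleGraph.Adj.reachable ⟨hyz, hvy.ne', hzv⟩) fun a b hza hab ih => ?_
      have key : ∀ a, (del G {y}).Reachable z a → a ≠ v := by
        rintro a ha rfl
        exact hzv (eq_of_reachable_del hG hyz hvy.symm ha)
      exact ih.trans (SimpleGraph.Adj.reachable
        ⟨hab.1, key a hza, key b (hza.trans hab.reachable)⟩)
    have hlt : comp (del G {y}) z ⊂ comp (del G {v}) y := by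
      refine ⟨hsub, fun h => ?_⟩
      exact not_mem_of_reachable_del (h (mem_comp_self _ y)) hyz.ne' rfl
    exact absurd (Set.ncard_lt_ncard hlt (Set.toFinite _)) (not_lt.2 hle)

/-- A relation expressing with quantifier depth `k` that there is a walk of length at most `2 ^ k`. -/
def ShortWalk (G : SimpleGraph V) : ℕ → V → V → Prop
  | 0, a, b => a = b ∨ G.Adj a b
  | k + 1, a, b => ∃ c, ShortWalk G k a c ∧ ShortWalk G k c b

theorem ShortWalk.reachable {G : SimpleGraph V} {k : ℕ} :
    ∀ {a b : V}, ShortWalk G k a b → G.Reachable a b := by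
  induction k with
  | zero =>
    rintro a b (rfl | h)
    · exact SimpleGraph.Reachable.refl _
    · exact h.reachable
  | succ k ih =>
    rintro a b ⟨c, h₁, h₂⟩
    exact (ih h₁).trans (ih h₂)

theorem shortWalk_of_walk {G : SimpleGraph V} {k : ℕ} :
    ∀ {a b : V} (w : G.Walk a b), w.length ≤ 2 ^ k → ShortWalk G k a b := by
  induction k with
  | zero =>
    intro a b w hw
    cases w with
    | nil => exact Or.inl rfl
    | cons h w =>
      cases w with
      | nil => exact Or.inr h
      | cons h' w => simp at hw
  | succ k ih =>
    intro a b w hw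
    refine ⟨w.getVert (2 ^ k), ih (w.take (2 ^ k)) ?_, ih (w.drop (2 ^ k)) ?_⟩
    · rw [SimpleGraph.Walk.take_length]
      exact min_le_left _ _
    · rw [SimpleGraph.Walk.drop_length]
      rw [pow_succ] at hw
      omega

theorem shortWalk_of_reachable [Finite V] {G : SimpleGraph V} {k : ℕ} (hk : Nat.card V ≤ 2 ^ k)
    {a b : V} (h : G.Reachable a b) : ShortWalk G k a b := by
  classical
  have := Fintype.ofFinite V
  obtain ⟨w, hw⟩ := h.exists_isPath
  refine shortWalk_of_walk w (hw.length_lt.le.trans ?_)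
  rwa [← Nat.card_eq_fintype_card]

theorem Eqv.shortWalk {K : ℕ} {V' : Type} {C : CGraph K V} {C' : CGraph K V'} {ι : Type}
    {f : ι → V} {g : ι → V'} {k : ℕ} : ∀ {P : Set (V × V')} {a b : V} {a' b' : V'},
    Eqv C C' k P → (Set.range fun i => (f i, g i)) ⊆ P → (a, a') ∈ P → (b, b') ∈ P →
    ShortWalk (del C.graph (Set.range f)) k a b →
    ShortWalk (del C'.graph (Set.range g)) k a' b' := by
  induction k with
  | zero =>
    rintro P a b a' b' h hP ha hb (hab | ⟨hab, haf, hbf⟩)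
    · exact Or.inl ((h _ ha _ hb).1.1 hab)
    · refine Or.inr ⟨(h _ ha _ hb).2.1.1 hab, ?_, ?_⟩
      · rintro ⟨i, hi⟩
        exact haf ⟨i, (h _ (hP ⟨i, rfl⟩) _ ha).1.2 hi⟩
      · rintro ⟨i, hi⟩
        exact hbf ⟨i, (h _ (hP ⟨i, rfl⟩) _ hb).1.2 hi⟩
  | succ k ih =>
    rintro P a b a' b' h hP ha hb ⟨c, hac, hcb⟩
    obtain ⟨c', hc⟩ := h.2.1 c
    have hP' := hP.trans (Set.subset_insert (c, c') P)
    exact ⟨c', ih hc hP' (Or.inr ha) (Or.inl rfl) hac, ih hc hP' (Or.inl rfl) (Or.inr hb) hcb⟩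

end Deletion

section Components
variable {K : ℕ} {V V' V'' ι : Type}

/-- The component of `x` left after the removal of the vertices `f i`. -/
def restComp (C : CGraph K V) (f : ι → V) (x : V) : Set V :=
  comp (del C.graph (Set.range f)) x

/-- `e` is an isomorphism between the components of `x` and `x'` left after the removal of
the vertices `f i` and `g i`, preserving the adjacency to these vertices. -/
def IsCompIso (C : CGraph K V) (C' : CGraph K V') (f : ι → V) (g : ι → V') (x : V) (x' : V')
    (e : V → V') : Prop :=
  Set.BijOn e (restComp C f x) (restComp C' g x') ∧
    ∀ a ∈ restComp C f x,
      (∀ b ∈ restComp C f x, C.graph.Adj a b ↔ C'.graph.Adj (e a) (e b)) ∧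
      (∀ c, C.color c a ↔ C'.color c (e a)) ∧
      ∀ i, C.graph.Adj a (f i) ↔ C'.graph.Adj (e a) (g i)

/-- The components of `x` and `x'` are isomorphic. -/
def CompIso (C : CGraph K V) (C' : CGraph K V') (f : ι → V) (g : ι → V') (x : V) (x' : V') :
    Prop :=
  ∃ e, IsCompIso C C' f g x x' e

variable {C : CGraph K V} {C' : CGraph K V'} {C'' : CGraph K V''}
  {f : ι → V} {g : ι → V'} {g' : ι → V''} {x : V} {x' : V'} {x'' : V''}

theorem CompIso.refl (C : CGraph K V) (f : ι → V) (x : V) : CompIso C C f f x x :=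
  ⟨id, Set.bijOn_id _, fun _ _ => ⟨fun _ _ => Iff.rfl, fun _ => Iff.rfl, fun _ => Iff.rfl⟩⟩

theorem CompIso.symm (h : CompIso C C' f g x x') : CompIso C' C g f x' x := by
  obtain ⟨e, he, h⟩ := h
  have : Nonempty V := ⟨x⟩
  have hinv := he.invOn_invFunOn
  have hb := he.symm hinv.symm
  refine ⟨Function.invFunOn e (restComp C f x), hb, fun a ha => ⟨fun b hb' => ?_, fun c => ?_,
    fun i => ?_⟩⟩
  · rw [(h _ (hb.mapsTo ha)).1 _ (hb.mapsTo hb'), hinv.2 ha, hinv.2 hb']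
  · rw [(h _ (hb.mapsTo ha)).2.1 c, hinv.2 ha]
  · rw [(h _ (hb.mapsTo ha)).2.2 i, hinv.2 ha]

theorem CompIso.trans (h : CompIso C C' f g x x') (h' : CompIso C' C'' g g' x' x'') :
    CompIso C C'' f g' x x'' := by
  obtain ⟨e, he, h⟩ := h
  obtain ⟨e', he', h'⟩ := h'
  refine ⟨e' ∘ e, he'.comp he, fun a ha => ⟨fun b hb => ?_, fun c => ?_, fun i => ?_⟩⟩
  · rw [(h _ ha).1 _ hb, (h' _ (he.mapsTo ha)).1 _ (he.mapsTo hb)]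
    rfl
  · rw [(h _ ha).2.1 c, (h' _ (he.mapsTo ha)).2.1 c]
    rfl
  · rw [(h _ ha).2.2 i, (h' _ (he.mapsTo ha)).2.2 i]
    rfl

theorem CompIso.ncard_eq (h : CompIso C C' f g x x') :
    (restComp C f x).ncard = (restComp C' g x').ncard := by
  obtain ⟨e, he, -⟩ := h
  rw [← he.image_eq, he.injOn.ncard_image]

/-- Extend a family of vertices by one vertex. -/
def extend (f : ι → V) (v : V) : Option ι → V := fun o => o.elim v f

theorem range_extend (f : ι → V) (v : V) : Set.range (extend f v) = insert v (Set.range f) := by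
  ext z
  constructor
  · rintro ⟨_ | i, rfl⟩
    · exact Or.inl rfl
    · exact Or.inr ⟨i, rfl⟩
  · rintro (rfl | ⟨i, rfl⟩)
    · exact ⟨none, rfl⟩
    · exact ⟨some i, rfl⟩

theorem range_extend_pair (f : ι → V) (g : ι → V') (v : V) (v' : V') :
    (Set.range fun i => (extend f v i, extend g v' i)) =
      insert (v, v') (Set.range fun i => (f i, g i)) := by
  rw [← range_extend]
  congr 1
  ext (_ | i) <;> rfl

theorem restComp_extend (C : CGraph K V) (f : ι → V) (v y : V) :
    restComp C (extend f v) y = comp (del (del C.graph (Set.range f)) {v}) y := by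
  rw [restComp, range_extend, del_insert]

theorem restComp_eq_of_mem {C : CGraph K V} {f : ι → V} {y z : V} (h : z ∈ restComp C f y) :
    restComp C f z = restComp C f y := by
  ext w
  exact ⟨fun hw => SimpleGraph.Reachable.trans h hw,
    fun hw => (SimpleGraph.Reachable.symm h).trans hw⟩

theorem isAcyclic_del {G : SimpleGraph V} (hG : G.IsAcyclic) (S : Set V) :
    (del G S).IsAcyclic :=
  hG.anti (del_le G S)

/-- The neighbors of `v` outside the vertices `f i`. -/
def nbrs (C : CGraph K V) (f : ι → V) (v : V) : Set V :=
  {y | (del C.graph (Set.range f)).Adj v y}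

theorem mem_restComp_cases {v z : V} (h : z ∈ restComp C f v) :
    z = v ∨ ∃ y ∈ nbrs C f v, z ∈ restComp C (extend f v) y := by
  rcases eq_or_exists_adj_of_reachable h with h | ⟨y, hy, h⟩
  · exact Or.inl h
  · refine Or.inr ⟨y, hy, ?_⟩
    rw [restComp_extend]
    exact h

theorem restComp_extend_subset {v y : V} (hy : y ∈ nbrs C f v) :
    restComp C (extend f v) y ⊆ restComp C f v := by
  rw [restComp_extend]
  exact fun z hz => hy.reachable.trans (SimpleGraph.Reachable.mono (del_le _ _) hz)

theorem ne_of_mem_restComp_extend {v y z : V} (hy : y ∈ nbrs C f v)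
    (hz : z ∈ restComp C (extend f v) y) : z ≠ v := by
  rw [restComp_extend] at hz
  exact not_mem_of_reachable_del (G := del C.graph (Set.range f)) (S := {v}) hz
    hy.1.ne'

theorem eq_of_mem_restComp_extend (hG : C.graph.IsAcyclic) {v y₁ y₂ z : V}
    (h₁ : y₁ ∈ nbrs C f v) (h₂ : y₂ ∈ nbrs C f v) (hz₁ : z ∈ restComp C (extend f v) y₁)
    (hz₂ : z ∈ restComp C (extend f v) y₂) : y₁ = y₂ := by
  rw [restComp_extend] at hz₁ hz₂
  exact eq_of_reachable_del (isAcyclic_del hG _) h₁ h₂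
    (SimpleGraph.Reachable.trans hz₁ (SimpleGraph.Reachable.symm hz₂))

theorem mem_nbrs_of_adj {v y z : V} (hy : y ∈ nbrs C f v)
    (hz : z ∈ restComp C (extend f v) y) (h : C.graph.Adj v z) : z ∈ nbrs C f v := by
  refine ⟨h, hy.2.1, ?_⟩
  have := not_mem_of_reachable_del hz (by
    rw [range_extend]
    rintro (h | h)
    · exact hy.1.ne' h
    · exact hy.2.2 h)
  rw [range_extend] at this
  exact fun h => this (Or.inr h)

theorem mem_restComp_of_adj {v y₁ a b : V} (h₁ : y₁ ∈ nbrs C f v)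
    (ha : a ∈ restComp C (extend f v) y₁) (hb : b ∈ restComp C f v) (hbv : b ≠ v)
    (hv : v ∉ Set.range f)
    (hab : C.graph.Adj a b) : b ∈ restComp C (extend f v) y₁ := by
  have hav := ne_of_mem_restComp_extend h₁ ha
  have h1 : a ∉ Set.range f :=
    not_mem_of_reachable_del (restComp_extend_subset h₁ ha) hv
  have h2 : b ∉ Set.range f := not_mem_of_reachable_del hb hv
  rw [restComp_extend] at *
  exact SimpleGraph.Reachable.trans ha (SimpleGraph.Adj.reachable ⟨⟨hab, h1, h2⟩, hav, hbv⟩)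

/-- Isomorphisms between the components left after the removal of one further vertex can be
glued together. -/
theorem CompIso.glue (hG : C.graph.IsAcyclic) {v : V} {v' : V'}
    (hv : v ∉ Set.range f) (hv' : v' ∉ Set.range g)
    (hcol : ∀ c, C.color c v ↔ C'.color c v')
    (hadj : ∀ i, C.graph.Adj v (f i) ↔ C'.graph.Adj v' (g i))
    (σ : nbrs C f v ≃ nbrs C' g v')
    (hσ : ∀ y : nbrs C f v, CompIso C C' (extend f v) (extend g v') y (σ y)) :
    CompIso C C' f g v v' := by
  classical
  choose e he hiso using hσ
  let E : V → V' := fun z =>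
    if h : ∃ y : nbrs C f v, z ∈ restComp C (extend f v) y then e h.choose z else v'
  have hEv : E v = v' := by
    refine dif_neg ?_
    rintro ⟨y, hy⟩
    exact ne_of_mem_restComp_extend y.2 hy rfl
  have hE : ∀ (y : nbrs C f v) z, z ∈ restComp C (extend f v) y → E z = e y z := by
    intro y z hz
    have h : ∃ y : nbrs C f v, z ∈ restComp C (extend f v) y := ⟨y, hz⟩
    have : h.choose = y :=
      Subtype.ext (eq_of_mem_restComp_extend hG h.choose.2 y.2 h.choose_spec hz)
    simp only [E, dif_pos h, this]
  have hroot : ∀ (y : nbrs C f v) u, u ∈ restComp C (extend f v) y →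
      C'.graph.Adj (e y u) v' → u = y := by
    intro y u hu h
    have h1 : C.graph.Adj u v := ((hiso y u hu).2.2 none).2 h
    exact eq_of_mem_restComp_extend hG (mem_nbrs_of_adj y.2 hu h1.symm) y.2
      (mem_comp_self _ _) hu
  have huniq : ∀ (y₁ y₂ : nbrs C f v) w, w ∈ restComp C' (extend g v') (σ y₁) →
      w ∈ restComp C' (extend g v') (σ y₂) → y₁ = y₂ := by
    intro y₁ y₂ w h₁ h₂
    have h₃ : (σ y₂ : V') ∈ restComp C' (extend g v') (σ y₁) := by
      rw [← restComp_eq_of_mem h₁, restComp_eq_of_mem h₂]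
      exact mem_comp_self _ _
    obtain ⟨u₁, hu₁, hu₁'⟩ := (he y₁).surjOn (mem_comp_self _ _)
    obtain ⟨u₂, hu₂, hu₂'⟩ := (he y₁).surjOn h₃
    have e₁ := hroot y₁ u₁ hu₁ (by rw [hu₁']; exact (σ y₁).2.1.symm)
    have e₂ := hroot y₁ u₂ hu₂ (by rw [hu₂']; exact (σ y₂).2.1.symm)
    refine σ.injective (Subtype.ext ?_)
    rw [← hu₁', ← hu₂', e₁, e₂]
  have hmem : ∀ (y : nbrs C f v) z, z ∈ restComp C (extend f v) y →
      E z ∈ restComp C' (extend g v') (σ y) := by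
    intro y z hz
    rw [hE y z hz]
    exact (he y).mapsTo hz
  refine ⟨E, ⟨?_, ?_, ?_⟩, ?_⟩
  · intro z hz
    rcases mem_restComp_cases hz with rfl | ⟨y, hy, hzy⟩
    · rw [hEv]
      exact mem_comp_self _ _
    · exact restComp_extend_subset (σ ⟨y, hy⟩).2 (hmem ⟨y, hy⟩ z hzy)
  · intro a ha b hb hab
    rcases mem_restComp_cases ha with rfl | ⟨y₁, hy₁, ha'⟩
    · rcases mem_restComp_cases hb with rfl | ⟨y₂, hy₂, hb'⟩
      · rfl
      · rw [hEv] at hab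
        exact absurd hab.symm
          (ne_of_mem_restComp_extend (σ ⟨y₂, hy₂⟩).2 (hmem ⟨y₂, hy₂⟩ b hb'))
    · rcases mem_restComp_cases hb with rfl | ⟨y₂, hy₂, hb'⟩
      · rw [hEv] at hab
        exact absurd hab (ne_of_mem_restComp_extend (σ ⟨y₁, hy₁⟩).2 (hmem ⟨y₁, hy₁⟩ a ha'))
      · have h12 := huniq ⟨y₁, hy₁⟩ ⟨y₂, hy₂⟩ (E a) (hmem _ a ha') (hab ▸ hmem _ b hb')
        obtain rfl : y₁ = y₂ := congrArg Subtype.val h12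
        rw [hE ⟨y₁, hy₁⟩ a ha', hE ⟨y₁, hy₁⟩ b hb'] at hab
        exact (he ⟨y₁, hy₁⟩).injOn ha' hb' hab
  · intro w hw
    rcases mem_restComp_cases hw with rfl | ⟨y', hy', hw'⟩
    · exact ⟨v, mem_comp_self _ _, hEv⟩
    · obtain ⟨y, hy⟩ := σ.surjective ⟨y', hy'⟩
      have hw'' : w ∈ restComp C' (extend g v') (σ y) := by rwa [hy]
      obtain ⟨z, hz, rfl⟩ := (he y).surjOn hw''
      exact ⟨z, restComp_extend_subset y.2 hz, hE y z hz⟩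
  · have hvy : ∀ (y : nbrs C f v) b, b ∈ restComp C (extend f v) y →
        (C.graph.Adj b v ↔ C'.graph.Adj (E b) v') := by
      intro y b hb
      rw [hE y b hb]
      exact (hiso y b hb).2.2 none
    intro a ha
    rcases mem_restComp_cases ha with rfl | ⟨y₁, hy₁, ha'⟩
    · rw [hEv]
      refine ⟨fun b hb => ?_, hcol, hadj⟩
      rcases mem_restComp_cases hb with rfl | ⟨y₂, hy₂, hb'⟩
      · rw [hEv]
        simp
      · rw [C.graph.adj_comm, C'.graph.adj_comm]
        exact hvy ⟨y₂, hy₂⟩ b hb'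
    · have hEa := hE ⟨y₁, hy₁⟩ a ha'
      refine ⟨fun b hb => ?_, ?_, ?_⟩
      · rcases mem_restComp_cases hb with rfl | ⟨y₂, hy₂, hb'⟩
        · rw [hEv]
          exact hvy ⟨y₁, hy₁⟩ a ha'
        · by_cases h12 : y₁ = y₂
          · subst h12
            rw [hEa, hE ⟨y₁, hy₁⟩ b hb']
            exact (hiso ⟨y₁, hy₁⟩ a ha').1 b hb'
          · constructor
            · intro hab
              exact absurd (eq_of_mem_restComp_extend hG hy₁ hy₂
                (mem_restComp_of_adj hy₁ ha' hb (ne_of_mem_restComp_extend hy₂ hb') hv hab)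
                hb') h12
            · intro hab
              have hb'' := hmem ⟨y₂, hy₂⟩ b hb'
              have h := mem_restComp_of_adj (σ ⟨y₁, hy₁⟩).2 (hmem ⟨y₁, hy₁⟩ a ha')
                (restComp_extend_subset (σ ⟨y₂, hy₂⟩).2 hb'')
                (ne_of_mem_restComp_extend (σ ⟨y₂, hy₂⟩).2 hb'') hv' hab
              exact absurd (congrArg Subtype.val (huniq _ _ _ h hb'')) h12
      · rw [hEa]
        exact (hiso ⟨y₁, hy₁⟩ a ha').2.1
      · intro i
        rw [hEa]
        exact (hiso ⟨y₁, hy₁⟩ a ha').2.2 (some i)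

/-- A vertex of a colored graph together with a family of vertices. -/
structure PointedCGraph (K : ℕ) (ι : Type) where
  V : Type
  C : CGraph K V
  f : ι → V
  x : V

/-- Isomorphism of components, as a setoid. -/
def compSetoid (K : ℕ) (ι : Type) : Setoid (PointedCGraph K ι) where
  r p q := CompIso p.C q.C p.f q.f p.x q.x
  iseqv := ⟨fun p => CompIso.refl p.C p.f p.x, CompIso.symm, CompIso.trans⟩

/-- The isomorphism class of the component of `x`. -/
def compClass (C : CGraph K V) (f : ι → V) (x : V) : Quotient (compSetoid K ι) :=
  Quotient.mk _ ⟨V, C, f, x⟩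

theorem compClass_eq_iff : compClass C f x = compClass C' g x' ↔ CompIso C C' f g x x' :=
  Quotient.eq (r := compSetoid K ι)

end Components

/-- Two functions on finite sets of equal size either have the same fiber sizes, so that they
agree up to a bijection, or some fiber of the first one is larger. -/
theorem exists_equiv_or_fiber_lt {α β κ : Type*} [Finite α] [Finite β] (c : α → κ) (c' : β → κ)
    (hcard : Nat.card α = Nat.card β) :
    (∃ σ : α ≃ β, ∀ y, c y = c' (σ y)) ∨
      ∃ k, Nat.card {y // c' y = k} < Nat.card {y // c y = k} := by
  classical
  have := Fintype.ofFinite α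
  have := Fintype.ofFinite β
  by_cases h : ∃ k, Nat.card {y // c' y = k} < Nat.card {y // c y = k}
  · exact Or.inr h
  refine Or.inl ?_
  push Not at h
  have heq : ∀ k, Nat.card {y // c y = k} = Nat.card {y // c' y = k} := by
    intro k
    simp only [Nat.card_eq_fintype_card, Fintype.card_subtype] at h hcard ⊢
    let T := insert k (Finset.univ.image c ∪ Finset.univ.image c')
    have h1 : Fintype.card α = ∑ k ∈ T, (Finset.univ.filter fun y => c y = k).card :=
      Finset.card_eq_sum_card_fiberwise fun y _ => by simp [T]
    have h2 : Fintype.card β = ∑ k ∈ T, (Finset.univ.filter fun y => c' y = k).card :=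
      Finset.card_eq_sum_card_fiberwise fun y _ => by simp [T]
    exact (Finset.sum_eq_sum_iff_of_le fun i _ => h i).1 (h1.symm.trans (hcard.trans h2)) k
      (Finset.mem_insert_self _ _)
  let e : ∀ k, {y // c y = k} ≃ {y // c' y = k} := fun k => (Finite.card_eq.1 (heq k)).some
  refine ⟨(Equiv.sigmaFiberEquiv c).symm.trans
    ((Equiv.sigmaCongrRight e).trans (Equiv.sigmaFiberEquiv c')), fun y => ?_⟩
  exact (e (c y) ⟨y, rfl⟩).2.symm

section Spoiler
variable {K : ℕ} {V V' ι : Type} {C : CGraph K V} {C' : CGraph K V'} {f : ι → V} {g : ι → V'}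

theorem PartialIso.mem_nbrs_iff {P : Set (V × V')} (hP : PartialIso C C' P) {v y : V} {v' y' : V'}
    (hfg : (Set.range fun i => (extend f v i, extend g v' i)) ⊆ P) (hy : (y, y') ∈ P) :
    y ∈ nbrs C f v ↔ y' ∈ nbrs C' g v' := by
  have hv : (v, v') ∈ P := hfg ⟨none, rfl⟩
  have hmem : ∀ {z z'}, (z, z') ∈ P → (z ∈ Set.range f ↔ z' ∈ Set.range g) := fun hz =>
    exists_congr fun i => (hP _ (hfg ⟨some i, rfl⟩) _ hz).1
  simp only [nbrs, del, Set.mem_ofPred_eq, hmem hv, hmem hy, (hP _ hv _ hy).2.1]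

theorem card_mul_ncard_le [Finite V] (hG : C.graph.IsAcyclic) {v : V} {M : ℕ}
    (S : Finset V) (hS : ∀ y ∈ S, y ∈ nbrs C f v ∧ (restComp C (extend f v) y).ncard = M) :
    S.card * M ≤ (restComp C f v).ncard := by
  classical
  have := Fintype.ofFinite V
  have h1 : (S.biUnion fun y => (restComp C (extend f v) y).toFinset).card = S.card * M := by
    rw [Finset.card_biUnion]
    · rw [Finset.sum_const_nat fun y hy => ?_]
      rw [← Set.ncard_eq_toFinset_card', (hS y hy).2]
    · intro y hy z hz hne
      simp only [Function.onFun, Finset.disjoint_left, Set.mem_toFinset]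
      exact fun w hw hw' => hne (eq_of_mem_restComp_extend hG (hS y hy).1 (hS z hz).1 hw hw')
  rw [← h1, Set.ncard_eq_toFinset_card']
  refine Finset.card_le_card fun w hw => ?_
  simp only [Finset.mem_biUnion, Set.mem_toFinset] at hw ⊢
  obtain ⟨y, hy, hw⟩ := hw
  exact restComp_extend_subset (hS y hy).1 hw

/-- If Spoiler pebbles a finite set `Y` of neighbors of `v`, Duplicator answers injectively
with neighbors of `v'`. -/
theorem Eqv.exists_nbrs {v : V} {v' : V'} {s : ℕ} (Y : Finset V) (hY : ↑Y ⊆ nbrs C f v)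
    (h : Eqv C C' (Y.card + s) (Set.range fun i => (extend f v i, extend g v' i))) :
    ∃ φ : V → V', Set.InjOn φ Y ∧ ∀ y ∈ Y, φ y ∈ nbrs C' g v' ∧
      Eqv C C' s (insert (y, φ y) (Set.range fun i => (extend f v i, extend g v' i))) := by
  have : Nonempty V' := ⟨v'⟩
  obtain ⟨φ, hφ⟩ := h.exists_image Y
  refine ⟨φ, fun y hy z hz hyz => ?_, fun y hy => ⟨?_, ?_⟩⟩
  · exact (hφ.partialIso _ (Or.inr ⟨y, hy, rfl⟩) _ (Or.inr ⟨z, hz, rfl⟩)).1.2 hyz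
  · exact (hφ.partialIso.mem_nbrs_iff Set.subset_union_left (Or.inr ⟨y, hy, rfl⟩)).1 (hY hy)
  · exact hφ.mono (Set.insert_subset (Or.inr ⟨y, hy, rfl⟩) Set.subset_union_left)

theorem swap_preimage_range (f : ι → V) (g : ι → V') :
    Prod.swap ⁻¹' (Set.range fun i => (f i, g i)) = Set.range fun i => (g i, f i) := by
  ext ⟨a, b⟩
  simp [and_comm]

theorem swap_preimage_insert (P : Set (V × V')) (v : V) (v' : V') :
    Prod.swap ⁻¹' (insert (v, v') P) = insert (v', v) (Prod.swap ⁻¹' P) := by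
  ext ⟨a, b⟩
  simp [and_comm]

/-- The same with Spoiler playing on the other side. -/
theorem Eqv.exists_nbrs_symm {v : V} {v' : V'} {s : ℕ} (Y : Finset V')
    (hY : ↑Y ⊆ nbrs C' g v')
    (h : Eqv C C' (Y.card + s) (Set.range fun i => (extend f v i, extend g v' i))) :
    ∃ φ : V' → V, Set.InjOn φ Y ∧ ∀ y ∈ Y, φ y ∈ nbrs C f v ∧
      Eqv C C' s (insert (φ y, y) (Set.range fun i => (extend f v i, extend g v' i))) := by
  have h' := h.swap
  rw [swap_preimage_range] at h'
  obtain ⟨φ, h₁, h₂⟩ := h'.exists_nbrs Y hY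
  refine ⟨φ, h₁, fun y hy => ⟨(h₂ y hy).1, ?_⟩⟩
  have := (h₂ y hy).2.swap
  rwa [swap_preimage_insert, swap_preimage_range] at this

/-- Spoiler's strategy: a component with a nonisomorphic counterpart is recognized in `r + L`
rounds, whenever `r` is a sufficient budget for components of that size. -/
theorem compIso_of_eqv [Finite V] [Finite V'] (hG : C.graph.IsAcyclic) {l L : ℕ}
    (hdeg : ∀ v, deg C.graph v ≤ l) (hL : Nat.card V ≤ 2 ^ L) {Good : ℕ → ℕ → Prop}
    (hfin : ∀ N r d, Good N r → d ≤ l → d + 1 ≤ N → d + 2 ≤ r)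
    (hstep : ∀ N r p M, Good N r → 1 ≤ p → 2 * p ≤ l + 1 → 1 ≤ M → p * M ≤ N → 2 * M ≤ N →
      ∃ s, Good M s ∧ 1 + p + s ≤ r) (N : ℕ) :
    ∀ {ι : Type} {f : ι → V} {g : ι → V'} {x : V} {x' : V'} {r : ℕ}, Good N r →
      x ∉ Set.range f → (restComp C f x).ncard = N →
      Eqv C C' (r + L) (insert (x, x') (Set.range fun i => (f i, g i))) →
      CompIso C C' f g x x' := by
  classical
  have := Fintype.ofFinite V
  have := Fintype.ofFinite V'
  induction N using Nat.strong_induction_on with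
  | _ N ih =>
  intro ι f g x x' r hr hx hN h
  obtain ⟨v, hv, hcent⟩ := exists_centroid (isAcyclic_del hG (Set.range f)) x
  change v ∈ restComp C f x at hv
  have hvx : restComp C f v = restComp C f x := restComp_eq_of_mem hv
  have hNv : (restComp C f v).ncard = N := hvx ▸ hN
  have hvf : v ∉ Set.range f := not_mem_of_reachable_del hv hx
  set A := nbrs C f v with hA
  have hdl : A.ncard ≤ l := by
    refine le_trans ?_ (hdeg v)
    exact Set.ncard_le_ncard (t := {w | C.graph.Adj v w}) (fun y hy => hy.1) (Set.toFinite _)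
  have hdN : A.ncard + 1 ≤ N := by
    rw [← Set.ncard_insert_of_notMem (a := v) (fun hv => hv.1.ne rfl), ← hNv]
    refine Set.ncard_le_ncard (Set.insert_subset (mem_comp_self _ _) fun y hy => ?_)
    exact SimpleGraph.Adj.reachable hy
  have hdr := hfin N r A.ncard hr hdl hdN
  obtain ⟨r, rfl⟩ : ∃ s, r = s + 1 := ⟨r - 1, by omega⟩
  rw [Nat.add_right_comm] at h
  obtain ⟨v', hv'⟩ := h.2.1 v
  have hiso := hv'.partialIso
  have hmem_v : (v, v') ∈ insert (v, v') (insert (x, x') (Set.range fun i => (f i, g i))) :=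
    Or.inl rfl
  have hmem_f : ∀ i, (f i, g i) ∈
      insert (v, v') (insert (x, x') (Set.range fun i => (f i, g i))) :=
    fun i => Or.inr (Or.inr ⟨i, rfl⟩)
  have hvg : v' ∉ Set.range g := by
    rintro ⟨i, hi⟩
    exact hvf ⟨i, (hiso _ (hmem_f i) _ hmem_v).1.2 hi⟩
  have hvx' : v' ∈ restComp C' g x' := by
    have h1 := shortWalk_of_reachable hL hv
    exact ((hv'.of_le (by omega : L ≤ r + L)).shortWalk
      (fun _ hp => Or.inr (Or.inr hp)) (Or.inr (Or.inl rfl)) hmem_v h1).reachable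
  suffices hvv : CompIso C C' f g v v' by
    obtain ⟨e, he⟩ := hvv
    refine ⟨e, ?_⟩
    unfold IsCompIso at he ⊢
    rwa [restComp_eq_of_mem hv, restComp_eq_of_mem hvx'] at he
  have h0 : Eqv C C' (r + L) (Set.range fun i => (extend f v i, extend g v' i)) := by
    refine hv'.mono ?_
    rw [range_extend_pair]
    exact Set.insert_subset_insert (Set.subset_insert _ _)
  set A' := nbrs C' g v' with hA'
  have hcard : A.ncard = A'.ncard := by
    refine le_antisymm ?_ ?_
    · obtain ⟨φ, hφ, hφ'⟩ := (h0.of_le (by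
        rw [← Set.ncard_eq_toFinset_card']; omega : A.toFinset.card + 0 ≤ r + L)).exists_nbrs
        A.toFinset (by simp [hA])
      refine Set.ncard_le_ncard_of_injOn φ (fun y hy => (hφ' y (by simpa using hy)).1) ?_
      simpa using hφ
    · by_contra! hlt
      obtain ⟨Y, hYA, hY⟩ := Finset.exists_subset_card_eq (s := A'.toFinset) (n := A.ncard + 1)
        (by rw [← Set.ncard_eq_toFinset_card']; omega)
      obtain ⟨φ, hφ, hφ'⟩ := (h0.of_le (by omega : Y.card + 0 ≤ r + L)).exists_nbrs_symm Y
        (fun y hy => by simpa using hYA hy)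
      have := Set.ncard_le_ncard_of_injOn φ (s := ↑Y) (t := A) (fun y hy => (hφ' y hy).1) hφ
      rw [Set.ncard_coe_finset] at this
      omega
  have hbound : ∀ y ∈ A, 1 ≤ (restComp C (extend f v) y).ncard ∧
      2 * (restComp C (extend f v) y).ncard ≤ N := by
    intro y hy
    refine ⟨(Set.ncard_pos (Set.toFinite _)).2 ⟨y, mem_comp_self _ _⟩, ?_⟩
    rw [restComp_extend, ← hN]
    exact hcent y hy
  rcases exists_equiv_or_fiber_lt (fun y : A => compClass C (extend f v) (y : V))
    (fun y : A' => compClass C' (extend g v') (y : V')) hcard with ⟨σ, hσ⟩ | ⟨κ, hκ⟩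
  · refine CompIso.glue hG hvf hvg (hiso _ hmem_v _ hmem_v).2.2
      (fun i => (hiso _ hmem_v _ (hmem_f i)).2.1) σ fun y => compClass_eq_iff.1 (hσ y)
  exfalso
  let S : Finset V := A.toFinset.filter fun y => compClass C (extend f v) y = κ
  let S' : Finset V' := A'.toFinset.filter fun y => compClass C' (extend g v') y = κ
  have hS : Nat.card {y : A // compClass C (extend f v) (y : V) = κ} = S.card := by
    rw [Nat.card_congr (Equiv.subtypeSubtypeEquivSubtypeInter (· ∈ A)
      (fun y => compClass C (extend f v) y = κ)), Nat.card_eq_fintype_card, Fintype.card_subtype]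
    congr 1
    ext y
    simp [S]
  have hS' : Nat.card {y : A' // compClass C' (extend g v') (y : V') = κ} = S'.card := by
    rw [Nat.card_congr (Equiv.subtypeSubtypeEquivSubtypeInter (· ∈ A')
      (fun y => compClass C' (extend g v') y = κ)), Nat.card_eq_fintype_card,
      Fintype.card_subtype]
    congr 1
    ext y
    simp [S']
  rw [hS, hS'] at hκ
  have hSA : S.card ≤ A.ncard := by
    rw [Set.ncard_eq_toFinset_card']
    exact Finset.card_filter_le _ _
  have hSmem : ∀ {y}, y ∈ S ↔ y ∈ A ∧ compClass C (extend f v) y = κ := by simp [S]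
  have hSmem' : ∀ {y}, y ∈ S' ↔ y ∈ A' ∧ compClass C' (extend g v') y = κ := by simp [S']
  have hfinish : ∀ p y y', 1 ≤ p → 2 * p ≤ l + 1 → p ≤ S.card → y ∈ S →
      compClass C' (extend g v') y' ≠ κ →
      Eqv C C' (r - p + L) (insert (y, y') (Set.range fun i => (extend f v i, extend g v' i))) →
      False := by
    intro p y y' hp hpl hpS hy hy' hE
    obtain ⟨hyA, hyκ⟩ := hSmem.1 hy
    obtain ⟨hM, h2M⟩ := hbound y hyA
    have hmul := card_mul_ncard_le hG S (M := (restComp C (extend f v) y).ncard) fun z hz =>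
      ⟨(hSmem.1 hz).1, (compClass_eq_iff.1 ((hSmem.1 hz).2.trans hyκ.symm)).ncard_eq⟩
    rw [hNv] at hmul
    obtain ⟨s, hs, hsr⟩ := hstep N (r + 1) p _ hr hp hpl hM
      ((Nat.mul_le_mul_right _ hpS).trans hmul) h2M
    have hcomp := ih _ (by omega) hs (g := extend g v') (x' := y') (by
      rw [range_extend]
      rintro (h | h)
      · exact hyA.1.ne' h
      · exact hyA.2.2 h) rfl (hE.of_le (by omega))
    exact hy' ((compClass_eq_iff.2 hcomp).symm.trans hyκ)
  rcases le_total (S'.card + 1) (A.ncard - S.card + 1) with hle | hle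
  · obtain ⟨Y, hYS, hY⟩ := Finset.exists_subset_card_eq (s := S) (n := S'.card + 1) hκ
    obtain ⟨φ, hφ, hφ'⟩ := (h0.of_le (by omega :
      Y.card + (r - (S'.card + 1) + L) ≤ r + L)).exists_nbrs Y
      (fun y hy => (hSmem.1 (hYS hy)).1)
    obtain ⟨y, hy, hyκ⟩ : ∃ y ∈ Y, compClass C' (extend g v') (φ y) ≠ κ := by
      by_contra! hall
      have := Finset.card_le_card_of_injOn (t := S') φ
        (fun y hy => hSmem'.2 ⟨(hφ' y hy).1, hall y hy⟩) hφ
      omega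
    exact hfinish (S'.card + 1) y (φ y) (by omega) (by omega) hκ (hYS hy) hyκ (hφ' y hy).2
  · have hsub : S' ⊆ A'.toFinset := Finset.filter_subset _ _
    obtain ⟨Y, hYS, hY⟩ := Finset.exists_subset_card_eq (s := A'.toFinset \ S')
      (n := A.ncard - S.card + 1) (by
        rw [Finset.card_sdiff_of_subset hsub, ← Set.ncard_eq_toFinset_card', ← hcard]; omega)
    obtain ⟨φ, hφ, hφ'⟩ := (h0.of_le (by omega :
      Y.card + (r - (A.ncard - S.card + 1) + L) ≤ r + L)).exists_nbrs_symm Y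
      (fun y hy => by simpa using (Finset.mem_sdiff.1 (hYS hy)).1)
    obtain ⟨y, hy, hyκ⟩ : ∃ y ∈ Y, φ y ∈ S := by
      by_contra! hall
      have := Finset.card_le_card_of_injOn (s := Y) (t := A.toFinset \ S) φ
        (fun y hy => by simpa using ⟨(hφ' y hy).1, hall y hy⟩) hφ
      rw [Finset.card_sdiff_of_subset (Finset.filter_subset _ _),
        ← Set.ncard_eq_toFinset_card'] at this
      change Y.card ≤ A.ncard - S.card at this
      omega
    have hy' := Finset.mem_sdiff.1 (hYS hy)
    refine hfinish (A.ncard - S.card + 1) (φ y) y (by omega) (by omega) (by omega) hyκ ?_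
      (hφ' y hy).2
    exact fun h => hy'.2 (hSmem'.2 ⟨by simpa using hy'.1, h⟩)

end Spoiler

section UpperBound
variable {K : ℕ} {V V' : Type} {C : CGraph K V} {C' : CGraph K V'}

theorem restComp_eq_univ (hC : C.graph.Connected) (f : Empty → V) (x : V) :
    restComp C f x = Set.univ := by
  refine Set.eq_univ_of_forall fun y => ?_
  rw [restComp, Set.range_eq_empty, del_empty]
  exact hC.preconnected x y

theorem cIso_of_eqv [Finite V] [Finite V'] (hC : IsColTree C) {l L : ℕ}
    (hdeg : ∀ v, deg C.graph v ≤ l) (hL : Nat.card V ≤ 2 ^ L) {Good : ℕ → ℕ → Prop}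
    (hfin : ∀ N r d, Good N r → d ≤ l → d + 1 ≤ N → d + 2 ≤ r)
    (hstep : ∀ N r p M, Good N r → 1 ≤ p → 2 * p ≤ l + 1 → 1 ≤ M → p * M ≤ N → 2 * M ≤ N →
      ∃ s, Good M s ∧ 1 + p + s ≤ r) {r : ℕ} (hr : Good (Nat.card V) r)
    (h : Eqv C C' (r + L + 1) ∅) : CIso C C' := by
  obtain ⟨x⟩ := hC.1.nonempty
  obtain ⟨x', hx⟩ := h.2.1 x
  have hempty : insert (x, x') (Set.range fun i : Empty => (i.elim, i.elim)) =
      insert (x, x') (∅ : Set (V × V')) := by rw [Set.range_eq_empty]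
  have huniv := restComp_eq_univ hC.1 Empty.elim x
  have h2r := hfin _ r 0 hr (Nat.zero_le _)
    (by have : Nonempty V := ⟨x⟩; exact Nat.card_pos)
  obtain ⟨e, he, hadj⟩ := compIso_of_eqv (f := Empty.elim) (g := Empty.elim) hC.2 hdeg hL hfin hstep
    (Nat.card V) hr (by simp) (by rw [huniv, Set.ncard_univ]) (hempty ▸ hx)
  have huniv' : restComp C' Empty.elim x' = Set.univ := by
    refine Set.eq_univ_of_forall fun y' => ?_
    obtain ⟨y, hy⟩ := (hx.of_le (by omega : L + 1 ≤ r + L)).2.2 y'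
    refine (hy.shortWalk (f := Empty.elim) (g := Empty.elim)
      (by rw [Set.range_eq_empty]; exact Set.empty_subset _) (Or.inr (Or.inl rfl))
      (Or.inl rfl) (shortWalk_of_reachable hL ?_)).reachable
    rw [Set.range_eq_empty, del_empty]
    exact hC.1.preconnected x y
  rw [huniv, huniv', Set.bijOn_univ] at he
  refine ⟨Equiv.ofBijective e he, fun v w => ?_, fun c v => ?_⟩
  · exact (hadj v (huniv ▸ Set.mem_univ v)).1 w (huniv ▸ Set.mem_univ w)
  · exact (hadj v (huniv ▸ Set.mem_univ v)).2.1 c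

theorem Dcol_le {m : ℕ} {C : CGraph K (Fin m)} (hC : IsColTree C) {n l t α β J k : ℕ}
    (hm : m ≤ n) (hdeg : ∀ v, deg C.graph v ≤ l) (hα : n < α ^ (t + 1)) (hβ : n < β ^ (J + 1))
    (hk : n < 2 ^ (k + 1)) :
    (∃ φ : CForm K 0, CDefines C φ) ∧
      Dcol C ≤ t * ((l + 3) / 2) + (l / 2 + 1 + α) + J * (α + 1) + k * (β + 1) + k + 3 := by
  let Good : ℕ → ℕ → Prop := fun N r => ∃ i j s, α ^ i * β ^ j * 2 ^ s * N ≤ n ∧ 1 ≤ N ∧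
    (t - i) * ((l + 3) / 2) + (l / 2 + 1 + α) + (J - j) * (α + 1) + (k - s) * (β + 1) ≤ r
  have hα0 : 0 < α := Nat.pos_of_ne_zero fun h => by simp [h] at hα
  have hβ0 : 0 < β := Nat.pos_of_ne_zero fun h => by simp [h] at hβ
  have hpow : ∀ {a b i : ℕ}, a ^ i ≤ n → n < a ^ (b + 1) → 0 < a → i ≤ b := by
    intro a b i h1 h2 h3
    by_contra! h
    exact absurd (Nat.pow_le_pow_right h3 (Nat.succ_le_of_lt h)) (not_le.2 (h1.trans_lt h2))
  have hsub : ∀ {a b c : ℕ}, b + 1 ≤ a → (a - b) * c = (a - (b + 1)) * c + c := by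
    intro a b c h
    rw [← Nat.succ_mul]
    congr 1
    omega
  have hpos : ∀ i j s : ℕ, 0 < α ^ i ∧ 0 < β ^ j ∧ 0 < 2 ^ s := fun i j s =>
    ⟨pow_pos hα0 _, pow_pos hβ0 _, pow_pos two_pos _⟩
  have hfin : ∀ N r d, Good N r → d ≤ l → d + 1 ≤ N → d + 2 ≤ r := by
    rintro N r d ⟨i, j, s, hn, hN, hr⟩ hd hdN
    by_cases hdα : α ≤ d + 1
    · obtain ⟨h1, h2, h3⟩ := hpos i j s
      have : α ^ (i + 1) ≤ n := by
        refine le_trans ?_ hn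
        calc α ^ (i + 1) = α ^ i * 1 * 1 * α := by ring
          _ ≤ _ := by gcongr <;> omega
      have := hsub (c := (l + 3) / 2) (hpow this hα hα0)
      omega
    · omega
  have hstep : ∀ N r p M, Good N r → 1 ≤ p → 2 * p ≤ l + 1 → 1 ≤ M → p * M ≤ N → 2 * M ≤ N →
      ∃ s, Good M s ∧ 1 + p + s ≤ r := by
    rintro N r p M ⟨i, j, s, hn, hN, hr⟩ hp hpl hM hpM h2M
    by_cases hpα : α ≤ p
    · have h : α ^ (i + 1) * β ^ j * 2 ^ s * M ≤ n := by
        refine le_trans ?_ hn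
        calc α ^ (i + 1) * β ^ j * 2 ^ s * M = α ^ i * β ^ j * 2 ^ s * (α * M) := by ring
          _ ≤ _ := by gcongr; exact (Nat.mul_le_mul_right M hpα).trans hpM
      have hi : α ^ (i + 1) ≤ n := by
        obtain ⟨h1, h2, h3⟩ := hpos (i + 1) j s
        refine le_trans ?_ h
        calc α ^ (i + 1) = α ^ (i + 1) * 1 * 1 * 1 := by ring
          _ ≤ _ := by gcongr <;> omega
      have := hsub (c := (l + 3) / 2) (hpow hi hα hα0)
      exact ⟨_, ⟨i + 1, j, s, h, hM, le_rfl⟩, by omega⟩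
    · by_cases hpβ : β ≤ p
      · have h : α ^ i * β ^ (j + 1) * 2 ^ s * M ≤ n := by
          refine le_trans ?_ hn
          calc α ^ i * β ^ (j + 1) * 2 ^ s * M = α ^ i * β ^ j * 2 ^ s * (β * M) := by ring
            _ ≤ _ := by gcongr; exact (Nat.mul_le_mul_right M hpβ).trans hpM
        have hi : β ^ (j + 1) ≤ n := by
          obtain ⟨h1, h2, h3⟩ := hpos i (j + 1) s
          refine le_trans ?_ h
          calc β ^ (j + 1) = 1 * β ^ (j + 1) * 1 * 1 := by ring
            _ ≤ _ := by gcongr <;> omega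
        have := hsub (c := α + 1) (hpow hi hβ hβ0)
        exact ⟨_, ⟨i, j + 1, s, h, hM, le_rfl⟩, by omega⟩
      · have h : α ^ i * β ^ j * 2 ^ (s + 1) * M ≤ n := by
          refine le_trans ?_ hn
          calc α ^ i * β ^ j * 2 ^ (s + 1) * M = α ^ i * β ^ j * 2 ^ s * (2 * M) := by ring
            _ ≤ _ := by gcongr
        have hi : 2 ^ (s + 1) ≤ n := by
          obtain ⟨h1, h2, h3⟩ := hpos i j (s + 1)
          refine le_trans ?_ h
          calc 2 ^ (s + 1) = 1 * 1 * 2 ^ (s + 1) * 1 := by ring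
            _ ≤ _ := by gcongr <;> omega
        have := hsub (c := β + 1) (hpow hi hk two_pos)
        exact ⟨_, ⟨i, j, s + 1, h, hM, le_rfl⟩, by omega⟩
  obtain ⟨x⟩ := hC.1.nonempty
  have hm0 : 1 ≤ m := by have := x.2; omega
  have := Dcol_le_of_eqv (C := C)
    (r := t * ((l + 3) / 2) + (l / 2 + 1 + α) + J * (α + 1) + k * (β + 1) + (k + 1) + 1)
    fun m' C' h => cIso_of_eqv hC hdeg (by simpa using by omega) hfin hstep
      ⟨0, 0, 0, by simpa using hm, by simpa using hm0, by simp⟩ h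
  exact ⟨this.1, this.2.trans (by omega)⟩

theorem exists_cDefines {m : ℕ} {C : CGraph K (Fin m)} (hC : IsColTree C) :
    ∃ φ : CForm K 0, CDefines C φ := by
  refine (Dcol_le (n := m) (l := m) (t := 0) (α := m + 1) (β := m + 1) (J := 0) (k := m) hC le_rfl
    (fun v => ?_) (by simp) (by simp) 
    (Nat.lt_two_pow_self.trans (Nat.pow_lt_pow_right one_lt_two (Nat.lt_succ_self m)))).1
  simpa [deg] using Finite.card_subtype_le fun w => C.graph.Adj v w

end UpperBound

section ListTree
variable {α : Type}

/-- The tree on lists in which the children of `u` are the lists `u ++ [a]`. -/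
def listTree (α : Type) : SimpleGraph (List α) where
  Adj u v := (∃ a, v = u ++ [a]) ∨ ∃ a, u = v ++ [a]
  symm := ⟨fun _ _ h => h.symm⟩
  loopless := ⟨fun u h => by rcases h with ⟨a, h⟩ | ⟨a, h⟩ <;> simp at h⟩

theorem listTree_adj {u v : List α} :
    (listTree α).Adj u v ↔ (∃ a, v = u ++ [a]) ∨ ∃ a, u = v ++ [a] := Iff.rfl

theorem listTree_adj_nil_cons {a : α} {u : List α} :
    (listTree α).Adj [] (a :: u) ↔ u = [] := by
  cases u <;> simp [listTree_adj]

theorem listTree_adj_cons_cons {a b : α} {u v : List α} :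
    (listTree α).Adj (a :: u) (b :: v) ↔ a = b ∧ (listTree α).Adj u v := by
  simp only [listTree_adj, List.cons_append, List.cons.injEq]
  constructor
  · rintro (⟨c, rfl, h⟩ | ⟨c, rfl, h⟩)
    exacts [⟨rfl, Or.inl ⟨c, h⟩⟩, ⟨rfl, Or.inr ⟨c, h⟩⟩]
  · rintro ⟨rfl, ⟨c, h⟩ | ⟨c, h⟩⟩
    exacts [Or.inl ⟨c, rfl, h⟩, Or.inr ⟨c, rfl, h⟩]

theorem isBridge_listTree (u : List α) (a : α) : (listTree α).IsBridge s(u, u ++ [a]) := by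
  rw [SimpleGraph.isBridge_iff]
  intro h
  refine reachable_induction (p := fun w => ¬ (u ++ [a]) <+: w) h
    (fun h => by simpa using h.length_le) (fun v w _ hvw hv hw => hv ?_) (List.prefix_refl _)
  rw [SimpleGraph.deleteEdges_adj] at hvw
  obtain ⟨⟨c, rfl⟩ | ⟨c, rfl⟩, hne⟩ := hvw
  · refine (List.prefix_concat_iff.1 hw).resolve_left fun h => hne ?_
    obtain ⟨rfl, h⟩ := List.append_inj' h rfl
    rw [h]
    rfl
  · exact hw.trans (List.prefix_append _ _)

theorem isAcyclic_listTree : (listTree α).IsAcyclic := by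
  rw [SimpleGraph.isAcyclic_iff_forall_adj_isBridge]
  rintro u v (⟨a, rfl⟩ | ⟨a, rfl⟩)
  · exact isBridge_listTree u a
  · rw [Sym2.eq_swap]
    exact isBridge_listTree v a

theorem connected_induce_listTree {S : Set (List α)} (h0 : [] ∈ S)
    (hS : ∀ u a, u ++ [a] ∈ S → u ∈ S) : ((listTree α).induce S).Connected := by
  have key : ∀ u (hu : u ∈ S), ((listTree α).induce S).Reachable ⟨[], h0⟩ ⟨u, hu⟩ := by
    intro u
    induction u using List.reverseRecOn with
    | nil => exact fun _ => SimpleGraph.Reachable.refl _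
    | append_singleton u a ih =>
      exact fun hu => (ih (hS u a hu)).trans (SimpleGraph.Adj.reachable (Or.inl ⟨a, rfl⟩))
  have : Nonempty S := ⟨⟨[], h0⟩⟩
  exact ⟨fun u v => (key u u.2).symm.trans (key v v.2)⟩

theorem deg_induce_listTree_le [Finite α] (S : Set (List α)) (v : S) :
    deg ((listTree α).induce S) v ≤ Nat.card α + 1 := by
  rw [← Finite.card_option, deg]
  refine Nat.card_le_card_of_injective
    (fun w => if w.1.1.length < v.1.length then none else w.1.1.getLast?) ?_
  rintro ⟨⟨x, hx⟩, hvx⟩ ⟨⟨y, hy⟩, hvy⟩ hxy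
  obtain ⟨v, hv⟩ := v
  simp only [Subtype.mk.injEq]
  change (listTree α).Adj v x at hvx
  change (listTree α).Adj v y at hvy
  rcases hvx with ⟨a, rfl⟩ | ⟨a, rfl⟩ <;> rcases hvy with ⟨b, hb⟩ | ⟨b, hb⟩
  · subst hb
    simpa using hxy
  · subst hb
    simp at hxy
  · subst hb
    simp at hxy
  · exact (List.append_inj' hb rfl).1

/-- The tree obtained by attaching the trees `F a` to a new root. -/
def join (F : α → Set (List α)) : Set (List α)
  | [] => True
  | a :: u => u ∈ F a

theorem cons_mem_join {F : α → Set (List α)} {a : α} {u : List α} :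
    a :: u ∈ join F ↔ u ∈ F a := Iff.rfl

/-- The vertices of `join F` other than the root are the vertices of the trees `F a`. -/
def joinEquiv (F : α → Set (List α)) : join F ≃ Option (Σ a, F a) where
  toFun
    | ⟨[], _⟩ => none
    | ⟨a :: u, h⟩ => some ⟨a, u, h⟩
  invFun
    | none => ⟨[], trivial⟩
    | some ⟨a, u, h⟩ => ⟨a :: u, h⟩
  left_inv := by rintro ⟨_ | ⟨a, u⟩, h⟩ <;> rfl
  right_inv := by rintro (_ | ⟨a, u, h⟩) <;> rfl

theorem finite_join [Finite α] {F : α → Set (List α)} (hF : ∀ a, Finite (F a)) :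
    Finite (join F) :=
  Finite.of_equiv _ (joinEquiv F).symm

theorem card_join [Fintype α] {F : α → Set (List α)} (hF : ∀ a, Finite (F a)) :
    Nat.card (join F) = ∑ a, Nat.card (F a) + 1 := by
  rw [Nat.card_congr (joinEquiv F), Finite.card_option, Nat.card_sigma]

theorem mem_join_of_append {F : α → Set (List α)}
    (hF : ∀ a u b, u ++ [b] ∈ F a → u ∈ F a) (u : List α) (b : α) (h : u ++ [b] ∈ join F) :
    u ∈ join F := by
  cases u with
  | nil => trivial
  | cons a u => exact hF a u b h

/-- The Ehrenfeucht game on the subtrees of the list tree induced by `S` and `S'`. -/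
def EqvOn (S S' : Set (List α)) (r : ℕ) (P : Set (List α × List α)) : Prop :=
  Eqv (plain ((listTree α).induce S)) (plain ((listTree α).induce S')) r
    {p | (p.1.1, p.2.1) ∈ P}

/-- `P` is an isomorphism between subtrees of `S` and `S'`. -/
def PartialIsoOn (S S' : Set (List α)) (P : Set (List α × List α)) : Prop :=
  ∀ u ∈ S, ∀ u' ∈ S', (u, u') ∈ P → ∀ v ∈ S, ∀ v' ∈ S', (v, v') ∈ P →
    (u = v ↔ u' = v') ∧ ((listTree α).Adj u v ↔ (listTree α).Adj u' v')

variable {S S' : Set (List α)} {r : ℕ} {P : Set (List α × List α)}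

theorem EqvOn.mono {Q : Set (List α × List α)} (h : EqvOn S S' r P) (hQ : Q ⊆ P) :
    EqvOn S S' r Q := Eqv.mono h fun _ hp => hQ hp

theorem EqvOn.partialIsoOn (h : EqvOn S S' r P) : PartialIsoOn S S' P := by
  intro u hu u' hu' huu v hv v' hv' hvv
  have := Eqv.partialIso h (⟨u, hu⟩, ⟨u', hu'⟩) huu (⟨v, hv⟩, ⟨v', hv'⟩) hvv
  exact ⟨by simpa using this.1, this.2.1⟩

theorem PartialIsoOn.eqvOn_zero (h : PartialIsoOn S S' P) : EqvOn S S' 0 P := by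
  rintro ⟨⟨u, hu⟩, ⟨u', hu'⟩⟩ huu ⟨⟨v, hv⟩, ⟨v', hv'⟩⟩ hvv
  have := h u hu u' hu' huu v hv v' hv' hvv
  exact ⟨by simpa using this.1, this.2, fun c => c.elim0⟩

theorem setOf_insert_mem {v v' : List α} (hv : v ∈ S) (hv' : v' ∈ S') :
    {p : S × S' | (p.1.1, p.2.1) ∈ insert (v, v') P} =
      insert (⟨v, hv⟩, ⟨v', hv'⟩) {p : S × S' | (p.1.1, p.2.1) ∈ P} := by
  ext ⟨⟨u, hu⟩, ⟨u', hu'⟩⟩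
  simp

theorem eqvOn_succ_iff : EqvOn S S' (r + 1) P ↔ PartialIsoOn S S' P ∧
    (∀ v ∈ S, ∃ v' ∈ S', EqvOn S S' r (insert (v, v') P)) ∧
    ∀ v' ∈ S', ∃ v ∈ S, EqvOn S S' r (insert (v, v') P) := by
  constructor
  · refine fun h => ⟨h.partialIsoOn, fun v hv => ?_, fun v' hv' => ?_⟩
    · obtain ⟨⟨v', hv'⟩, h⟩ := h.2.1 ⟨v, hv⟩
      exact ⟨v', hv', by rwa [EqvOn, setOf_insert_mem hv hv']⟩
    · obtain ⟨⟨v, hv⟩, h⟩ := h.2.2 ⟨v', hv'⟩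
      exact ⟨v, hv, by rwa [EqvOn, setOf_insert_mem hv hv']⟩
  · rintro ⟨h0, h1, h2⟩
    refine ⟨Eqv.partialIso h0.eqvOn_zero, ?_, ?_⟩
    · rintro ⟨v, hv⟩
      obtain ⟨v', hv', h⟩ := h1 v hv
      exact ⟨⟨v', hv'⟩, by rwa [EqvOn, setOf_insert_mem hv hv'] at h⟩
    · rintro ⟨v', hv'⟩
      obtain ⟨v, hv, h⟩ := h2 v' hv'
      exact ⟨⟨v, hv⟩, by rwa [EqvOn, setOf_insert_mem hv hv'] at h⟩

theorem EqvOn.of_succ (h : EqvOn S S' (r + 1) P) : EqvOn S S' r P := Eqv.of_succ h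

theorem eqvOn_diagonal (S : Set (List α)) : EqvOn S S r {p | p.1 = p.2} := by
  induction r with
  | zero =>
    refine PartialIsoOn.eqvOn_zero ?_
    rintro u _ u' _ (rfl : u = u') v _ v' _ (rfl : v = v')
    simp
  | succ r ih =>
    rw [eqvOn_succ_iff]
    refine ⟨ih.partialIsoOn, fun v hv => ⟨v, hv, ?_⟩, fun v hv => ⟨v, hv, ?_⟩⟩ <;>
    rwa [Set.insert_eq_of_mem (show (v, v) ∈ {p : List α × List α | p.1 = p.2} from rfl)]

/-- The position in the game on two joins which is composed of the positions `Q a` in the games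
on the branches `a` and `σ a`. -/
def joinPos (σ : Equiv.Perm α) (Q : α → Set (List α × List α)) : Set (List α × List α) :=
  insert ([], []) {p | ∃ a, ∃ q ∈ Q a, p = (a :: q.1, σ a :: q.2)}

theorem nil_mem_joinPos (σ : Equiv.Perm α) (Q : α → Set (List α × List α)) :
    ([], []) ∈ joinPos σ Q := Set.mem_insert _ _

theorem insert_joinPos_subset [DecidableEq α] {σ : Equiv.Perm α}
    {Q : α → Set (List α × List α)} {a : α} {u u' : List α} :
    insert (a :: u, σ a :: u') (joinPos σ Q) ⊆
      joinPos σ (Function.update Q a (insert (u, u') (Q a))) := by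
  rintro p (rfl | rfl | ⟨b, q, hq, rfl⟩)
  · exact Or.inr ⟨a, (u, u'), by simp, rfl⟩
  · exact Or.inl rfl
  · refine Or.inr ⟨b, q, ?_, rfl⟩
    by_cases hb : b = a
    · subst hb
      simpa using Or.inr hq
    · simpa [hb] using hq

variable {F F' : α → Set (List α)}

theorem partialIsoOn_joinPos {σ : Equiv.Perm α} {Q : α → Set (List α × List α)}
    (hnil : ∀ a, ∀ q ∈ Q a, q.1 ∈ F a → q.2 ∈ F' (σ a) → (q.1 = [] ↔ q.2 = []))
    (hQ : ∀ a, PartialIsoOn (F a) (F' (σ a)) (Q a)) :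
    PartialIsoOn (join F) (join F') (joinPos σ Q) := by
  rintro u hu u' hu' (huu | ⟨a, ⟨x, x'⟩, hx, huu⟩) v hv v' hv'
    (hvv | ⟨b, ⟨y, y'⟩, hy, hvv⟩) <;>
  obtain ⟨rfl, rfl⟩ := Prod.mk.inj huu <;> obtain ⟨rfl, rfl⟩ := Prod.mk.inj hvv
  · simp
  · simp [listTree_adj_nil_cons, hnil b _ hy hv hv']
  · simp [SimpleGraph.adj_comm _ _ [], listTree_adj_nil_cons, hnil a _ hx hu hu']
  · by_cases hab : a = b
    · subst hab
      have := hQ a x hu x' hu' hx y hv y' hv' hy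
      simpa [listTree_adj_cons_cons] using this
    · simp [listTree_adj_cons_cons, hab]

theorem eqvOn_join_of_forall {σ : Equiv.Perm α} (hF : ∀ a, [] ∈ F a) (hF' : ∀ a, [] ∈ F' a) :
    ∀ {r : ℕ} {Q : α → Set (List α × List α)}, (∀ a, ([], []) ∈ Q a) →
      (∀ a, EqvOn (F a) (F' (σ a)) r (Q a)) → EqvOn (join F) (join F') r (joinPos σ Q) := by
  classical
  have h0 : ∀ {r : ℕ} {Q : α → Set (List α × List α)}, (∀ a, ([], []) ∈ Q a) →
      (∀ a, EqvOn (F a) (F' (σ a)) r (Q a)) →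
      PartialIsoOn (join F) (join F') (joinPos σ Q) := by
    intro r Q hnil hQ
    refine partialIsoOn_joinPos (fun a q hq h h' => ?_) fun a => (hQ a).partialIsoOn
    exact ((hQ a).partialIsoOn _ h _ h' hq _ (hF a) _ (hF' _) (hnil a)).1
  have hins : ∀ {r : ℕ} {Q : α → Set (List α × List α)}, (∀ a, ([], []) ∈ Q a) →
      (∀ a, EqvOn (F a) (F' (σ a)) (r + 1) (Q a)) → ∀ {a u u'},
      EqvOn (F a) (F' (σ a)) r (insert (u, u') (Q a)) → ∀ b,
      ([], []) ∈ Function.update Q a (insert (u, u') (Q a)) b ∧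
      EqvOn (F b) (F' (σ b)) r (Function.update Q a (insert (u, u') (Q a)) b) := by
    intro r Q hnil hQ a u u' h b
    by_cases hb : b = a
    · subst hb
      simpa [hnil] using h
    · simpa [hb, hnil] using (hQ b).of_succ
  intro r
  induction r with
  | zero => exact fun hnil hQ => (h0 hnil hQ).eqvOn_zero
  | succ r ih =>
    intro Q hnil hQ
    rw [eqvOn_succ_iff]
    refine ⟨h0 hnil hQ, fun v hv => ?_, fun v' hv' => ?_⟩
    · cases v with
      | nil =>
        refine ⟨[], trivial, ?_⟩
        rw [Set.insert_eq_of_mem (nil_mem_joinPos σ Q)]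
        exact ih hnil fun a => (hQ a).of_succ
      | cons a u =>
        obtain ⟨u', hu', h⟩ := (eqvOn_succ_iff.1 (hQ a)).2.1 u hv
        exact ⟨σ a :: u', hu', (ih (fun b => (hins hnil hQ h b).1)
          fun b => (hins hnil hQ h b).2).mono insert_joinPos_subset⟩
    · cases v' with
      | nil =>
        refine ⟨[], trivial, ?_⟩
        rw [Set.insert_eq_of_mem (nil_mem_joinPos σ Q)]
        exact ih hnil fun a => (hQ a).of_succ
      | cons a' u' =>
        obtain ⟨a, rfl⟩ := σ.surjective a'
        obtain ⟨u, hu, h⟩ := (eqvOn_succ_iff.1 (hQ a)).2.2 u' hv'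
        exact ⟨a :: u, hu, (ih (fun b => (hins hnil hQ h b).1)
          fun b => (hins hnil hQ h b).2).mono insert_joinPos_subset⟩

/-- The position in the game on two joins in which the isomorphic branches `a` and `σ a`
are matched for all `a ∈ T`. -/
def matchPos (σ : Equiv.Perm α) (T : Finset α) : Set (List α × List α) :=
  insert ([], []) {p | ∃ a ∈ T, ∃ u, p = (a :: u, σ a :: u)}

theorem nil_mem_matchPos (σ : Equiv.Perm α) (T : Finset α) : ([], []) ∈ matchPos σ T :=
  Set.mem_insert _ _

theorem swap_preimage_matchPos [DecidableEq α] (σ : Equiv.Perm α) (T : Finset α) :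
    Prod.swap ⁻¹' matchPos σ T = matchPos σ.symm (T.map σ.toEmbedding) := by
  ext ⟨u, v⟩
  simp only [matchPos, Set.mem_preimage, Prod.swap_prod_mk, Set.mem_insert_iff, Prod.mk.injEq,
    Set.mem_ofPred_eq, Finset.mem_map_equiv]
  refine or_congr and_comm ⟨?_, ?_⟩
  · rintro ⟨a, ha, x, rfl, rfl⟩
    exact ⟨σ a, by simpa using ha, x, by simp⟩
  · rintro ⟨a, ha, x, rfl, rfl⟩
    exact ⟨σ.symm a, ha, x, by simp⟩

/-- Duplicator's answer in an unmatched branch. -/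
theorem exists_matchPos [DecidableEq α] [Fintype α] {m : ℕ}
    (hm : ∀ a u, u ∈ F a → ∃ A : Finset α, m ≤ A.card ∧ ∀ b ∈ A, F' b = F a)
    {σ : Equiv.Perm α} {T : Finset α} (hT : ∀ a ∈ T, F a = F' (σ a)) (hTm : T.card < m)
    {v : List α} (hv : v ∈ join F) :
    ∃ v' ∈ join F', ∃ (τ : Equiv.Perm α) (T' : Finset α), (∀ a ∈ T', F a = F' (τ a)) ∧
      T'.card ≤ T.card + 1 ∧ insert (v, v') (matchPos σ T) ⊆ matchPos τ T' := by
  cases v with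
  | nil =>
    exact ⟨[], trivial, σ, T, hT, Nat.le_succ _, (Set.insert_eq_of_mem (nil_mem_matchPos σ T)).subset⟩
  | cons a u =>
    by_cases ha : a ∈ T
    · refine ⟨σ a :: u, cons_mem_join.2 (hT a ha ▸ hv), σ, T, hT, Nat.le_succ _, ?_⟩
      have : (a :: u, σ a :: u) ∈ matchPos σ T := Or.inr ⟨a, ha, u, rfl⟩
      exact (Set.insert_eq_of_mem this).subset
    obtain ⟨A, hA, hA'⟩ := hm a u hv
    obtain ⟨b, hb, hbT⟩ : ∃ b ∈ A, b ∉ T.map σ.toEmbedding :=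
      Finset.exists_mem_notMem_of_card_lt_card (by simpa using hTm.trans_le hA)
    let τ := σ.trans (Equiv.swap (σ a) b)
    have hτa : τ a = b := by simp [τ]
    have hτ : ∀ c ∈ T, τ c = σ c := by
      intro c hc
      refine Equiv.swap_apply_of_ne_of_ne (fun h => ha (σ.injective h ▸ hc)) fun h => hbT ?_
      simpa [← h] using hc
    refine ⟨b :: u, cons_mem_join.2 (hA' b hb ▸ hv), τ, insert a T, ?_,
      Finset.card_insert_le _ _, ?_⟩
    · intro c hc
      rcases Finset.mem_insert.1 hc with rfl | hc
      · rw [hτa, hA' b hb]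
      · rw [hτ c hc, hT c hc]
    · rintro p (rfl | rfl | ⟨c, hc, x, rfl⟩)
      · exact Or.inr ⟨a, Finset.mem_insert_self _ _, u, by rw [hτa]⟩
      · exact Or.inl rfl
      · exact Or.inr ⟨c, Finset.mem_insert_of_mem hc, x, by rw [hτ c hc]⟩

theorem eqvOn_matchPos_add [Fintype α] {m : ℕ}
    (hm : ∀ a u, u ∈ F a → ∃ A : Finset α, m ≤ A.card ∧ ∀ b ∈ A, F' b = F a)
    (hm' : ∀ a u, u ∈ F' a → ∃ A : Finset α, m ≤ A.card ∧ ∀ b ∈ A, F b = F' a) {r : ℕ}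
    (h : ∀ (σ : Equiv.Perm α) (T : Finset α), (∀ a ∈ T, F a = F' (σ a)) → T.card ≤ m →
      EqvOn (join F) (join F') r (matchPos σ T)) (s : ℕ) :
    ∀ (σ : Equiv.Perm α) (T : Finset α), (∀ a ∈ T, F a = F' (σ a)) → T.card + s ≤ m →
      EqvOn (join F) (join F') (r + s) (matchPos σ T) := by
  classical
  induction s with
  | zero => exact h
  | succ s ih =>
    intro σ T hT hTm
    rw [← add_assoc, eqvOn_succ_iff]
    refine ⟨(h σ T hT (by omega)).partialIsoOn, fun v hv => ?_, fun v' hv' => ?_⟩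
    · obtain ⟨v', hv', τ, T', hT', hcard, hsub⟩ := exists_matchPos hm hT (by omega) hv
      exact ⟨v', hv', (ih τ T' hT' (by omega)).mono hsub⟩
    · obtain ⟨v, hv, τ, T', hT', hcard, hsub⟩ := exists_matchPos hm'
        (σ := σ.symm) (T := T.map σ.toEmbedding)
        (fun a ha => by
          rw [hT _ (Finset.mem_map_equiv.1 ha), Equiv.apply_symm_apply])
        (by rw [Finset.card_map]; omega) hv'
      refine ⟨v, hv, (ih τ.symm (T'.map τ.toEmbedding) (fun a ha => ?_) ?_).mono ?_⟩
      · rw [hT' _ (Finset.mem_map_equiv.1 ha), Equiv.apply_symm_apply]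
      · rw [Finset.card_map] at *
        omega
      · rw [← swap_preimage_matchPos] at hsub ⊢
        rintro ⟨x, x'⟩ hx
        refine hsub (a := (x', x)) ?_
        rcases hx with hx | hx
        · obtain ⟨rfl, rfl⟩ := Prod.mk.inj hx
          exact Or.inl rfl
        · exact Or.inr hx

end ListTree

section LowerBound
variable {q h : ℕ}

/-- A pair of trees of height `k + 1` which are hard to distinguish: stars with `q - 1` and `q`
leaves, and then two trees whose branches are `h` or `h + 1` copies of the larger of the previous
trees and `q - h` or `q - h - 1` copies of the smaller one. -/
def hardTree (q h : ℕ) : Bool → ℕ → Set (List (Fin q))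
  | b, 0 => join fun i => {u | u = [] ∧ (i : ℕ) < q - 1 + b.toNat}
  | b, k + 1 => join fun i => hardTree q h (decide ((i : ℕ) < h + b.toNat)) k

theorem nil_mem_hardTree (b : Bool) (k : ℕ) : [] ∈ hardTree q h b k := by
  cases k <;> trivial

theorem mem_hardTree_of_append (k : ℕ) : ∀ (b : Bool) (u : List (Fin q)) (i : Fin q),
    u ++ [i] ∈ hardTree q h b k → u ∈ hardTree q h b k := by
  induction k with
  | zero => exact fun b => mem_join_of_append fun a u i hu => absurd hu.1 (by simp)
  | succ k ih => exact fun b => mem_join_of_append fun a => ih _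

instance (b : Bool) (i : Fin q) :
    Finite {u : List (Fin q) | u = [] ∧ (i : ℕ) < q - 1 + b.toNat} :=
  Set.Finite.subset (Set.finite_singleton []) fun _ hu => hu.1

theorem finite_hardTree (k : ℕ) : ∀ b, Finite (hardTree q h b k) := by
  induction k with
  | zero => exact fun b => finite_join fun i => inferInstance
  | succ k ih => exact fun b => finite_join fun i => ih _

theorem card_leaf (b : Bool) (i : Fin q) :
    Nat.card {u : List (Fin q) | u = [] ∧ (i : ℕ) < q - 1 + b.toNat} =
      if (i : ℕ) < q - 1 + b.toNat then 1 else 0 := by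
  split_ifs with hi
  · rw [Nat.card_eq_one_iff_exists]
    exact ⟨⟨[], rfl, hi⟩, fun u => Subtype.ext u.2.1⟩
  · rw [Finite.card_eq_zero_iff]
    exact ⟨fun u => hi u.2.2⟩

theorem card_hardTree_le (k : ℕ) : ∀ b, Nat.card (hardTree q h b k) ≤ (q + 1) ^ (k + 1) := by
  have key : ∀ (f : Fin q → ℕ) c, 1 ≤ c → (∀ i, f i ≤ c) → ∑ i, f i + 1 ≤ c * (q + 1) := by
    intro f c hc hf
    have := Finset.sum_le_card_nsmul Finset.univ f c fun i _ => hf i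
    simp only [Finset.card_univ, Fintype.card_fin, smul_eq_mul] at this
    change ∑ i, f i ≤ q * c at this
    calc _ ≤ q * c + c := by omega
      _ = _ := by ring
  induction k with
  | zero =>
    intro b
    rw [hardTree, card_join fun i => inferInstance]
    simp only [card_leaf]
    refine (key _ 1 le_rfl fun i => ?_).trans (by simp)
    split_ifs <;> simp
  | succ k ih =>
    intro b
    rw [hardTree, card_join fun i => finite_hardTree k _, pow_succ]
    exact key _ _ (Nat.one_le_pow _ _ (Nat.succ_pos _)) fun i => ih _

theorem card_hardTree_true (hq : 1 ≤ q) (hh : h < q) (k : ℕ) :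
    Nat.card (hardTree q h true k) = Nat.card (hardTree q h false k) + 1 := by
  have key : ∀ (f g : Fin q → ℕ) (j : Fin q), (∀ i, f i = g i + if i = j then 1 else 0) →
      ∑ i, f i + 1 = ∑ i, g i + 1 + 1 := by
    intro f g j hfg
    simp [hfg, Finset.sum_add_distrib]
  induction k with
  | zero =>
    rw [hardTree, hardTree, card_join fun i => inferInstance, card_join fun i => inferInstance]
    refine key _ _ ⟨q - 1, by omega⟩ fun i => ?_
    simp only [card_leaf]
    simp only [Bool.toNat_true, Bool.toNat_false, Fin.ext_iff]
    split_ifs <;> omega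
  | succ k ih =>
    rw [hardTree, hardTree, card_join fun i => finite_hardTree k _,
      card_join fun i => finite_hardTree k _]
    refine key _ _ ⟨h, hh⟩ fun i => ?_
    simp only [Bool.toNat_true, Bool.toNat_false, Fin.ext_iff]
    rcases lt_trichotomy (i : ℕ) h with hi | hi | hi
    · simp [hi, hi.ne, hi.trans (Nat.lt_succ_self h)]
    · simp [hi, ih]
    · simp [hi.not_gt, hi.ne', Nat.not_lt.2 (Nat.succ_le_of_lt hi)]

theorem eqvOn_join [Fintype α] {F F' : α → Set (List α)} {m : ℕ}
    (hm : ∀ a u, u ∈ F a → ∃ A : Finset α, m ≤ A.card ∧ ∀ b ∈ A, F' b = F a)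
    (hm' : ∀ a u, u ∈ F' a → ∃ A : Finset α, m ≤ A.card ∧ ∀ b ∈ A, F b = F' a) {r : ℕ}
    (h : ∀ (σ : Equiv.Perm α) (T : Finset α), (∀ a ∈ T, F a = F' (σ a)) →
      EqvOn (join F) (join F') r (matchPos σ T)) :
    EqvOn (join F) (join F') (r + m) {([], [])} :=
  (eqvOn_matchPos_add hm hm' (fun σ T hT _ => h σ T hT) m (Equiv.refl α) ∅ (by simp)
    (by simp)).mono (Set.singleton_subset_iff.2 (nil_mem_matchPos _ _))

theorem matchPos_subset_joinPos [DecidableEq α] {σ : Equiv.Perm α} {T : Finset α} :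
    matchPos σ T ⊆ joinPos σ fun a => {p | p.1 = p.2 ∧ (a ∈ T ∨ p.1 = [])} := by
  rintro p (rfl | ⟨a, ha, u, rfl⟩)
  · exact nil_mem_joinPos _ _
  · exact Or.inr ⟨a, (u, u), ⟨rfl, Or.inl ha⟩, rfl⟩

theorem eqvOn_hardTree (hh : 2 * h + 1 ≤ q) (k : ℕ) : ∀ b b',
    EqvOn (hardTree q h b k) (hardTree q h b' k) (q - 1 + k * h) {([], [])} := by
  induction k with
  | zero =>
    have hm : ∀ (b b' : Bool) (i : Fin q) (u : List (Fin q)),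
        u ∈ {u : List (Fin q) | u = [] ∧ (i : ℕ) < q - 1 + b.toNat} →
        ∃ A : Finset (Fin q), q - 1 ≤ A.card ∧ ∀ j ∈ A,
          {u : List (Fin q) | u = [] ∧ (j : ℕ) < q - 1 + b'.toNat} =
            {u | u = [] ∧ (i : ℕ) < q - 1 + b.toNat} := by
      rintro b b' i u ⟨_, hi⟩
      refine ⟨Finset.univ.filter fun j : Fin q => (j : ℕ) < q - 1, ?_, fun j hj => ?_⟩
      · rw [Fin.card_filter_val_lt]
        omega
      · have hj := (Finset.mem_filter.1 hj).2
        ext u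
        simp [hi, Nat.lt_add_right b'.toNat hj]
    intro b b'
    suffices H : EqvOn (hardTree q h b 0) (hardTree q h b' 0) (0 + (q - 1)) {([], [])} by
      rw [zero_add] at H
      rwa [zero_mul, add_zero]
    rw [hardTree, hardTree]
    refine eqvOn_join (hm b b') (hm b' b) fun σ T hT => ?_
    refine (PartialIsoOn.eqvOn_zero (partialIsoOn_joinPos ?_ ?_)).mono matchPos_subset_joinPos
    · rintro i ⟨u, v⟩ ⟨huv, -⟩
      obtain rfl : u = v := huv
      simp
    · rintro i u - u' - ⟨huu, -⟩ v - v' - ⟨hvv, -⟩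
      obtain rfl : u = u' := huu
      obtain rfl : v = v' := hvv
      simp
  | succ k ih =>
    have hm : ∀ (b b' : Bool) (i : Fin q), ∃ A : Finset (Fin q), h ≤ A.card ∧ ∀ j ∈ A,
          hardTree q h (decide ((j : ℕ) < h + b'.toNat)) k =
            hardTree q h (decide ((i : ℕ) < h + b.toNat)) k := by
      intro b b' i
      have hb := b'.toNat_le
      have hc := Fin.card_filter_val_lt (n := q) (m := h + b'.toNat)
      by_cases hi : (i : ℕ) < h + b.toNat
      · refine ⟨Finset.univ.filter fun j : Fin q => (j : ℕ) < h + b'.toNat, ?_, fun j hj => ?_⟩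
        · omega
        · simp [hi, (Finset.mem_filter.1 hj).2]
      · refine ⟨Finset.univ.filter fun j : Fin q => ¬ (j : ℕ) < h + b'.toNat, ?_,
          fun j hj => ?_⟩
        · have := Finset.card_filter_add_card_filter_not (s := (Finset.univ : Finset (Fin q)))
            (p := fun j => (j : ℕ) < h + b'.toNat)
          rw [Finset.card_univ, Fintype.card_fin] at this
          omega
        · have hj := (Finset.mem_filter.1 hj).2
          rw [decide_eq_false hi, decide_eq_false hj]
    intro b b'
    rw [Nat.succ_mul, ← add_assoc, hardTree, hardTree]
    refine eqvOn_join (fun i _ _ => hm b b' i) (fun i _ _ => hm b' b i) fun σ T hT => ?_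
    have hnil : ∀ i, ([], []) ∈ {p : List (Fin q) × List (Fin q) | p.1 = p.2 ∧ (i ∈ T ∨ p.1 = [])} :=
      fun i => ⟨rfl, Or.inr rfl⟩
    refine (eqvOn_join_of_forall (fun i => nil_mem_hardTree _ _) (fun i => nil_mem_hardTree _ _)
      hnil fun i => ?_).mono matchPos_subset_joinPos
    by_cases hi : i ∈ T
    · rw [← hT i hi]
      exact (eqvOn_diagonal _).mono fun p hp => hp.1
    · refine (ih _ _).mono ?_
      rintro ⟨u, v⟩ ⟨huv, hu⟩
      obtain rfl : u = [] := hu.resolve_left hi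
      obtain rfl : [] = v := huv
      rfl

/-- A finite colored graph is isomorphic to one on `Fin m`. -/
theorem exists_cIso_fin {V : Type} [Finite V] (G : SimpleGraph V) :
    ∃ H : SimpleGraph (Fin (Nat.card V)), CIso (plain G) (plain H) ∧ Nonempty (G ≃g H) := by
  let e := Finite.equivFin V
  refine ⟨G.comap e.symm, ⟨e, fun v w => ?_, fun c => c.elim0⟩,
    ⟨(SimpleGraph.Iso.comap e.symm G).symm⟩⟩
  simp [plain]

theorem deg_iso {V W : Type} {G : SimpleGraph V} {H : SimpleGraph W} (e : G ≃g H) (w : W) :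
    deg H w = deg G (e.symm w) :=
  Nat.card_congr (e.symm.toEquiv.subtypeEquiv fun _ => (e.symm.map_adj_iff).symm)

theorem exists_hard_tree (hh : 2 * h + 1 ≤ q) (k : ℕ) :
    ∃ (m : ℕ) (T : SimpleGraph (Fin m)), m ≤ (q + 1) ^ (k + 1) ∧ T.Connected ∧ T.IsAcyclic ∧
      (∀ v, deg T v ≤ q + 1) ∧ q - 1 + k * h < Dcol (plain T) := by
  have := fun b => finite_hardTree (q := q) (h := h) k b
  obtain ⟨T, hT, ⟨e⟩⟩ := exists_cIso_fin ((listTree (Fin q)).induce (hardTree q h true k))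
  obtain ⟨T', hT', -⟩ := exists_cIso_fin ((listTree (Fin q)).induce (hardTree q h false k))
  have hconn := e.connected_iff.1
    (connected_induce_listTree (nil_mem_hardTree _ _) (mem_hardTree_of_append k _))
  have hacyc := e.isAcyclic_iff.1 (isAcyclic_listTree.induce (hardTree q h true k))
  refine ⟨_, T, card_hardTree_le k _, hconn, hacyc, fun v => ?_, ?_⟩
  · rw [deg_iso e]
    simpa using deg_induce_listTree_le _ (e.symm v)
  · refine lt_Dcol_of_eqv hT hT' (exists_cDefines ⟨hconn, hacyc⟩)
      (Eqv.mono (eqvOn_hardTree hh k true false) (Set.empty_subset _)) ?_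
    rintro ⟨e, -⟩
    have h1 := Nat.card_congr e
    have h2 := card_hardTree_true (q := q) (h := h) (by omega) (by omega) k
    omega

end LowerBound

section Asymptotics
open Asymptotics

theorem isLittleO_log_mul_sqrt (c d : ℕ) :
    (fun x : ℕ => ((c * (Nat.log 2 x + 1) * (Nat.sqrt x + d) : ℕ) : ℝ)) =o[atTop]
      fun x : ℕ => (x : ℝ) := by
  have hconst : ∀ a : ℝ, (fun _ : ℝ => a) =o[atTop] fun x : ℝ => √x := fun a =>
    isLittleO_const_left.2 (Or.inr (tendsto_norm_atTop_atTop.comp Real.tendsto_sqrt_atTop))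
  have hlog : (fun x : ℝ => Real.log x / Real.log 2 + 1) =o[atTop] fun x : ℝ => √x := by
    refine IsLittleO.add ?_ (hconst 1)
    simp only [div_eq_inv_mul]
    refine IsLittleO.const_mul_left ?_ _
    simpa only [Real.sqrt_eq_rpow] using isLittleO_log_rpow_atTop (r := 1 / 2) (by norm_num)
  have hsqrt : (fun x : ℝ => √x + d) =O[atTop] fun x : ℝ => √x :=
    (isBigO_refl _ _).add (hconst d).isBigO
  have h := ((hlog.mul_isBigO hsqrt).const_mul_left (c : ℝ)).comp_tendsto
    tendsto_natCast_atTop_atTop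
  refine (IsBigO.of_bound' (Eventually.of_forall fun x : ℕ => ?_)).trans_isLittleO
    (h.congr_right fun x : ℕ => Real.mul_self_sqrt x.cast_nonneg)
  have h1 : (Nat.log 2 x : ℝ) ≤ Real.log x / Real.log 2 := Real.natLog_le_logb x 2
  have h2 := Real.nat_sqrt_le_real_sqrt (a := x)
  rw [Real.norm_of_nonneg (Nat.cast_nonneg _)]
  refine le_trans ?_ (le_abs_self _)
  push_cast
  rw [mul_assoc]
  simp only [Function.comp_apply]
  gcongr

variable {t : ℕ} {l : ℕ → ℕ}

theorem eventually_Dcol_le (hl : Tendsto l atTop atTop)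
    (hlb : Tendsto (fun n : ℕ => (n : ℝ) / (l n : ℝ) ^ (t + 1)) atTop (nhds 0))
    {ε : ℝ} (hε : 0 < ε) :
    ∀ᶠ n in atTop, ∀ (K m : ℕ) (C : CGraph K (Fin m)), IsColTree C → m ≤ n →
      (∀ v, deg C.graph v ≤ l n) → (Dcol C : ℝ) ≤ ((t + 1) / 2 + ε) * l n := by
  set δ := ε / (2 * t + 4) with hδ
  have hδ0 : 0 < δ := by positivity
  have h1 := hlb.eventually (gt_mem_nhds (pow_pos hδ0 (t + 1)))
  have h2 := hlb.eventually (gt_mem_nhds one_pos)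
  have h3 := hl.eventually ((isLittleO_log_mul_sqrt (t + 1) 3).bound hδ0)
  have h4 := hl.eventually ((tendsto_natCast_atTop_atTop (R := ℝ)).eventually_ge_atTop
    ((6 * t + 7) / δ))
  filter_upwards [h1, h2, h3, h4, hl.eventually_ge_atTop 1] with n h1 h2 h3 h4 h5 K m C hC hm hdeg
  generalize l n = x at *
  have hx : (0 : ℝ) < x := by exact_mod_cast h5
  rw [div_lt_iff₀ (pow_pos hx _)] at h1 h2
  rw [← mul_pow] at h1
  rw [one_mul] at h2
  norm_cast at h2
  rw [Real.norm_of_nonneg (Nat.cast_nonneg _), Real.norm_of_nonneg hx.le] at h3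
  rw [div_le_iff₀ hδ0] at h4
  have hα : n < ⌈δ * x⌉₊ ^ (t + 1) := by
    have : (n : ℝ) < (⌈δ * x⌉₊ : ℝ) ^ (t + 1) := h1.trans_le (by gcongr; exact Nat.le_ceil _)
    exact_mod_cast this
  have hβ : n < (Nat.sqrt x + 1) ^ (2 * t + 1 + 1) := by
    refine h2.trans_le ?_
    rw [show 2 * t + 1 + 1 = 2 * (t + 1) by ring, pow_mul]
    exact Nat.pow_le_pow_left (Nat.lt_succ_sqrt' x).le _
  have hk : n < 2 ^ ((t + 1) * (Nat.log 2 x + 1) + 1) := by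
    refine h2.trans_le ((Nat.pow_le_pow_left (Nat.lt_pow_succ_log_self one_lt_two x).le _).trans ?_)
    rw [← pow_mul, mul_comm]
    exact Nat.pow_le_pow_right two_pos (Nat.le_succ _)
  have hD := (Dcol_le hC hm hdeg hα hβ hk).2
  have hD' : (Dcol C : ℝ) ≤ _ := Nat.cast_le.2 hD
  have hc := (Nat.ceil_lt_add_one (mul_pos hδ0 hx).le).le
  have hx2 : (((x + 3) / 2 : ℕ) : ℝ) ≤ (x + 3) / 2 := by
    simpa using Nat.cast_div_le (α := ℝ) (m := x + 3) (n := 2)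
  have hx3 : ((x / 2 : ℕ) : ℝ) ≤ x / 2 := by
    simpa using Nat.cast_div_le (α := ℝ) (m := x) (n := 2)
  push_cast at hD' h3
  have hε' : ε = δ * (2 * t + 4) := by rw [hδ]; field_simp
  calc (Dcol C : ℝ) ≤ _ := hD'
    _ ≤ t * ((x + 3) / 2) + (x / 2 + 1 + (δ * x + 1)) + (2 * t + 1) * (δ * x + 1 + 1) + δ * x + 3 := by
      have : (t : ℝ) * ((x + 3) / 2 : ℕ) ≤ t * ((x + 3) / 2) := by gcongr
      have : (2 * (t : ℝ) + 1) * (⌈δ * x⌉₊ + 1) ≤ (2 * t + 1) * (δ * x + 1 + 1) := by gcongr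
      linarith
    _ ≤ ((t + 1) / 2 + ε) * x := by
      rw [hε']
      nlinarith

theorem eventually_exists_le_Dcol (ht : 1 ≤ t) (hl : Tendsto l atTop atTop)
    (hub : ∀ᶠ n in atTop, (l n) ^ t ≤ n) {ε : ℝ} (hε : 0 < ε) :
    ∀ᶠ n in atTop, ∃ (m : ℕ) (T : SimpleGraph (Fin m)),
      m ≤ n ∧ T.Connected ∧ T.IsAcyclic ∧ (∀ v, deg T v ≤ l n) ∧
      ((t + 1) / 2 - ε) * (l n : ℝ) ≤ (Dcol (plain T) : ℝ) := by
  have h1 := hl.eventually ((tendsto_natCast_atTop_atTop (R := ℝ)).eventually_ge_atTop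
    ((2 * t + 2) / ε))
  filter_upwards [hub, h1, hl.eventually_ge_atTop 2] with n hn h1 h2
  generalize l n = x at *
  obtain ⟨k, rfl⟩ : ∃ k, t = k + 1 := ⟨t - 1, by omega⟩
  obtain ⟨q, rfl⟩ : ∃ q, x = q + 2 := ⟨x - 2, by omega⟩
  obtain ⟨m, T, hm, hconn, hacyc, hdeg, hD⟩ :=
    exists_hard_tree (q := q + 1) (h := q / 2) (by omega) k
  refine ⟨m, T, hm.trans hn, hconn, hacyc, hdeg, ?_⟩
  rw [div_le_iff₀ hε] at h1
  have hD' : ((q + 1 - 1 + k * (q / 2) : ℕ) : ℝ) ≤ Dcol (plain T) := Nat.cast_le.2 hD.le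
  have hq : (q : ℝ) ≤ 2 * (q / 2 : ℕ) + 1 := by
    exact_mod_cast (by omega : q ≤ 2 * (q / 2) + 1)
  have hkq := mul_le_mul_of_nonneg_left hq (Nat.cast_nonneg (α := ℝ) k)
  rw [Nat.add_sub_cancel] at hD'
  push_cast at hD' h1 ⊢
  nlinarith

end Asymptotics
end FODef

theorem statement1 (t : ℕ) (ht : 1 ≤ t) (l : ℕ → ℕ) (hpos : ∀ n, 1 ≤ l n)
    (hl : Tendsto l atTop atTop)
    (hub : ∀ᶠ n in atTop, (l n) ^ t ≤ n)
    (hlb : Tendsto (fun n : ℕ => (n : ℝ) / (l n : ℝ) ^ (t + 1)) atTop (nhds 0)) :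
    Tendsto (fun n : ℕ => (Dtree n (l n) : ℝ) / (l n : ℝ)) atTop (nhds ((t + 1) / 2)) ∧
    ∀ ε : ℝ, 0 < ε → ∀ᶠ n in atTop, ∃ (m : ℕ) (T : SimpleGraph (Fin m)),
      m ≤ n ∧ T.Connected ∧ T.IsAcyclic ∧ (∀ v, deg T v ≤ l n) ∧
      ((t + 1) / 2 - ε) * (l n : ℝ) ≤ (Dcol (plain T) : ℝ) := by
  refine ⟨?_, fun ε hε => eventually_exists_le_Dcol ht hl hub hε⟩
  rw [Metric.tendsto_nhds]
  intro ε hε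
  filter_upwards [eventually_Dcol_le hl hlb (half_pos hε),
    eventually_exists_le_Dcol ht hl hub (half_pos hε)] with n hle hge
  obtain ⟨m, T, hm, hconn, hacyc, hdeg, hD⟩ := hge
  have hx : (0 : ℝ) < l n := by exact_mod_cast hpos n
  have hmem : Dcol (plain T) ∈ {d | ∃ (K m : ℕ) (C : CGraph K (Fin m)), IsColTree C ∧ m ≤ n ∧
      (∀ v, deg C.graph v ≤ l n) ∧ d = Dcol C} :=
    ⟨0, m, plain T, ⟨hconn, hacyc⟩, hm, hdeg, rfl⟩
  have hB : ⌊(((t : ℝ) + 1) / 2 + ε / 2) * l n⌋₊ ∈ upperBounds {d | ∃ (K m : ℕ)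
      (C : CGraph K (Fin m)), IsColTree C ∧ m ≤ n ∧ (∀ v, deg C.graph v ≤ l n) ∧ d = Dcol C} := by
    rintro _ ⟨K, m, C, hC, hm, hdeg, rfl⟩
    exact Nat.le_floor (hle K m C hC hm hdeg)
  have h1 : (Dtree n (l n) : ℝ) ≤ (((t : ℝ) + 1) / 2 + ε / 2) * l n :=
    (Nat.cast_le.2 (csSup_le ⟨_, hmem⟩ hB)).trans (Nat.floor_le (by positivity))
  have h2 : (((t : ℝ) + 1) / 2 - ε / 2) * l n ≤ Dtree n (l n) :=
    hD.trans (Nat.cast_le.2 (le_csSup ⟨_, hB⟩ hmem))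
  rw [← div_le_iff₀ hx] at h1
  rw [← le_div_iff₀ hx] at h2
  rw [Real.dist_eq, abs_lt]
  constructor <;> linarith
end

section
/- Let T be a tree chosen uniformly at random from the n^{n−2} labeled trees on vertex set {1,…,n}. For every ε > 0, the probability that D(T) ≥ (1 − ε) · ln n / ln ln n tends to 1 as n → ∞. -/
namespace FODef

/-- First-order formulas in the language of graphs (equality and adjacency), with free
variables among `x_0, …, x_{n-1}`. -/
inductive GForm : ℕ → Type
  | adj {n : ℕ} (i j : Fin n) : GForm n
  | eq {n : ℕ} (i j : Fin n) : GForm n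
  | neg {n : ℕ} : GForm n → GForm n
  | conj {n : ℕ} : GForm n → GForm n → GForm n
  | disj {n : ℕ} : GForm n → GForm n → GForm n
  | ex {n : ℕ} : GForm (n + 1) → GForm n
  | fa {n : ℕ} : GForm (n + 1) → GForm n

/-- Realization of a formula in a graph under a valuation of the free variables. -/
def GForm.Realize {V : Type} (G : SimpleGraph V) : ∀ {n : ℕ}, GForm n → (Fin n → V) → Prop
  | _, .adj i j, f => G.Adj (f i) (f j)
  | _, .eq i j, f => f i = f j
  | _, .neg φ, f => ¬ GForm.Realize G φ f
  | _, .conj φ ψ, f => GForm.Realize G φ f ∧ GForm.Realize G ψ f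
  | _, .disj φ ψ, f => GForm.Realize G φ f ∨ GForm.Realize G ψ f
  | _, .ex φ, f => ∃ v : V, GForm.Realize G φ (Fin.snoc f v)
  | _, .fa φ, f => ∀ v : V, GForm.Realize G φ (Fin.snoc f v)

/-- Quantifier depth: the maximum number of nested quantifiers. -/
def GForm.depth : ∀ {n : ℕ}, GForm n → ℕ
  | _, .adj _ _ => 0
  | _, .eq _ _ => 0
  | _, .neg φ => φ.depth
  | _, .conj φ ψ => max φ.depth ψ.depth
  | _, .disj φ ψ => max φ.depth ψ.depth
  | _, .ex φ => φ.depth + 1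
  | _, .fa φ => φ.depth + 1

/-- A sentence (formula with no free variables) holds in a graph. -/
def Sat {V : Type} (G : SimpleGraph V) (φ : GForm 0) : Prop :=
  φ.Realize G ![]

/-- A sentence defines the graph `G` if `G` satisfies it and every finite graph
satisfying it is isomorphic to `G`. -/
def Defines {V : Type} (G : SimpleGraph V) (φ : GForm 0) : Prop :=
  Sat G φ ∧ ∀ (m : ℕ) (H : SimpleGraph (Fin m)), Sat H φ → Nonempty (G ≃g H)

/-- `D G`: the minimum quantifier depth of a first-order sentence defining `G`. -/
noncomputable def D {V : Type} (G : SimpleGraph V) : ℕ :=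
  sInf {d | ∃ φ : GForm 0, φ.depth = d ∧ Defines G φ}

end FODef

namespace FODef

open Classical in
/-- The probability of the event `E` for a tree chosen uniformly at random among all
labeled trees on the vertex set `Fin n`. -/
noncomputable def treeProb (n : ℕ) (E : Set (SimpleGraph (Fin n))) : ℝ :=
  ((Finset.univ.filter
      (fun T : SimpleGraph (Fin n) => T.Connected ∧ T.IsAcyclic ∧ T ∈ E)).card : ℝ) /
  ((Finset.univ.filter
      (fun T : SimpleGraph (Fin n) => T.Connected ∧ T.IsAcyclic)).card : ℝ)

/-- Maximum degree of a graph on a finite vertex set. -/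
noncomputable def maxDeg {V : Type} [Fintype V] (G : SimpleGraph V) : ℕ :=
  Finset.univ.sup fun v => deg G v

end FODef


namespace FODef

section Logic

variable {V W : Type}

theorem GForm.realize_iso {G : SimpleGraph V} {H : SimpleGraph W} (e : G ≃g H) {n : ℕ}
    (φ : GForm n) (f : Fin n → V) : φ.Realize G f ↔ φ.Realize H (e ∘ f) := by
  induction φ with
  | adj i j => exact e.map_adj_iff.symm
  | eq i j => simp [GForm.Realize]
  | neg φ ih => simp [GForm.Realize, ih]
  | conj φ ψ ih₁ ih₂ => simp [GForm.Realize, ih₁, ih₂]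
  | disj φ ψ ih₁ ih₂ => simp [GForm.Realize, ih₁, ih₂]
  | ex φ ih =>
    simp only [GForm.Realize, ih, Fin.comp_snoc]
    exact (e.surjective.exists (p := fun w => φ.Realize H (Fin.snoc (e ∘ f) w))).symm
  | fa φ ih =>
    simp only [GForm.Realize, ih, Fin.comp_snoc]
    exact (e.surjective.forall (p := fun w => φ.Realize H (Fin.snoc (e ∘ f) w))).symm

theorem sat_iso {G : SimpleGraph V} {H : SimpleGraph W} (e : G ≃g H) (φ : GForm 0) :
    Sat G φ ↔ Sat H φ := by
  unfold Sat
  rw [GForm.realize_iso e, Subsingleton.elim (e ∘ ![]) ![]]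

open Classical in
/-- Transposing two vertices with the same neighbours is an automorphism. -/
noncomputable def swapTwins (G : SimpleGraph V) (x y : V) (h : ∀ z, G.Adj x z ↔ G.Adj y z) :
    G ≃g G where
  toEquiv := Equiv.swap x y
  map_rel_iff' := by
    intro a b
    have h' : ∀ z, G.Adj z x ↔ G.Adj z y := fun z => by
      rw [G.adj_comm z x, G.adj_comm z y]; exact h z
    simp only [Equiv.swap_apply_def]
    split_ifs <;> simp_all

theorem GForm.realize_delete_twin (G : SimpleGraph V) (S : Finset V) (x : V) (hx : x ∈ S)
    (hS : ∀ s ∈ S, ∀ z, G.Adj x z ↔ G.Adj s z) {n : ℕ} (φ : GForm n)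
    (hn : n + φ.depth < S.card) (f : Fin n → {v // v ≠ x}) :
    φ.Realize G (fun i => (f i : V)) ↔
      φ.Realize (G.comap (Subtype.val : {v // v ≠ x} → V)) f := by
  classical
  have snoc_val : ∀ {n : ℕ} (f : Fin n → {v // v ≠ x}) (v : {v // v ≠ x}),
      (fun i => ((Fin.snoc f v : Fin (n + 1) → {v // v ≠ x}) i : V)) =
        Fin.snoc (fun i => (f i : V)) (v : V) := fun f v =>
    Fin.comp_snoc (α := {v // v ≠ x}) Subtype.val f v
  have move : ∀ {n : ℕ} (φ : GForm (n + 1)) (f : Fin n → {v // v ≠ x}), n + 1 < S.card →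
      ∃ s : {v // v ≠ x}, φ.Realize G (Fin.snoc (fun i => (f i : V)) x) ↔
        φ.Realize G (Fin.snoc (fun i => (f i : V)) (s : V)) := by
    intro n φ f hn
    obtain ⟨s, hsS, hs⟩ : ∃ s ∈ S, s ∉ insert x (Finset.univ.image fun i => (f i : V)) := by
      apply Finset.exists_mem_notMem_of_card_lt_card
      refine lt_of_le_of_lt (Finset.card_insert_le _ _) (lt_of_le_of_lt ?_ hn)
      simpa using Finset.card_image_le (s := Finset.univ) (f := fun i => (f i : V))
    simp only [Finset.mem_insert, Finset.mem_image, Finset.mem_univ, true_and, not_or,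
      not_exists] at hs
    refine ⟨⟨s, hs.1⟩, ?_⟩
    rw [GForm.realize_iso (swapTwins G x s (hS s hsS)), Fin.comp_snoc]
    have h1 : (swapTwins G x s (hS s hsS)) x = s := Equiv.swap_apply_left _ _
    have h2 : (⇑(swapTwins G x s (hS s hsS)) ∘ fun i => (f i : V)) = fun i => (f i : V) := by
      funext i
      exact Equiv.swap_apply_of_ne_of_ne (f i).2 (hs.2 i)
    rw [h1, h2]
  induction φ with
  | adj i j => simp [GForm.Realize]
  | eq i j => simp [GForm.Realize, Subtype.ext_iff]
  | neg φ ih => simp [GForm.Realize, ih hn]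
  | conj φ ψ ih₁ ih₂ =>
    simp only [GForm.depth] at hn
    exact and_congr (ih₁ (by omega) f) (ih₂ (by omega) f)
  | disj φ ψ ih₁ ih₂ =>
    simp only [GForm.depth] at hn
    exact or_congr (ih₁ (by omega) f) (ih₂ (by omega) f)
  | ex φ ih =>
    simp only [GForm.depth] at hn
    simp only [GForm.Realize, ← ih (by omega), snoc_val]
    refine ⟨fun ⟨v, hv⟩ => ?_, fun ⟨v, hv⟩ => ⟨v, hv⟩⟩
    by_cases h : v = x
    · obtain ⟨s, hs⟩ := move φ f (by omega)
      exact ⟨s, hs.1 (h ▸ hv)⟩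
    · exact ⟨⟨v, h⟩, hv⟩
  | fa φ ih =>
    simp only [GForm.depth] at hn
    simp only [GForm.Realize, ← ih (by omega), snoc_val]
    refine ⟨fun H v => H v, fun H v => ?_⟩
    by_cases h : v = x
    · obtain ⟨s, hs⟩ := move φ f (by omega)
      exact h ▸ hs.2 (H s)
    · exact H ⟨v, h⟩

/-- The conjunction of a list of formulas and `φ`. -/
def GForm.conjList {n : ℕ} (φ : GForm n) (l : List (GForm n)) : GForm n :=
  l.foldr GForm.conj φ

/-- The disjunction of a list of formulas and `φ`. -/
def GForm.disjList {n : ℕ} (φ : GForm n) (l : List (GForm n)) : GForm n :=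
  l.foldr GForm.disj φ

theorem GForm.realize_conjList (G : SimpleGraph V) {n : ℕ} (φ : GForm n) (l : List (GForm n))
    (f : Fin n → V) :
    (φ.conjList l).Realize G f ↔ φ.Realize G f ∧ ∀ ψ ∈ l, ψ.Realize G f := by
  induction l with
  | nil => simp [conjList]
  | cons a l ih =>
    simp only [conjList, List.foldr_cons, Realize, List.forall_mem_cons] at ih ⊢
    rw [ih]; tauto

theorem GForm.realize_disjList (G : SimpleGraph V) {n : ℕ} (φ : GForm n) (l : List (GForm n))
    (f : Fin n → V) :
    (φ.disjList l).Realize G f ↔ φ.Realize G f ∨ ∃ ψ ∈ l, ψ.Realize G f := by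
  induction l with
  | nil => simp [disjList]
  | cons a l ih =>
    simp only [disjList, List.foldr_cons, Realize, List.exists_mem_cons_iff] at ih ⊢
    rw [ih]; tauto

/-- Existential closure. -/
def GForm.exAll : ∀ {n : ℕ}, GForm n → GForm 0
  | 0, φ => φ
  | _ + 1, φ => GForm.exAll (GForm.ex φ)

theorem GForm.sat_exAll (G : SimpleGraph V) {n : ℕ} (φ : GForm n) :
    Sat G φ.exAll ↔ ∃ f : Fin n → V, φ.Realize G f := by
  induction n with
  | zero =>
    simp only [exAll, Sat]
    exact ⟨fun h => ⟨_, h⟩, fun ⟨f, h⟩ => Subsingleton.elim f ![] ▸ h⟩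
  | succ n ih =>
    simp only [exAll, ih, Realize]
    refine ⟨fun ⟨f, v, h⟩ => ⟨_, h⟩, fun ⟨f, h⟩ => ⟨Fin.init f, f (Fin.last n), ?_⟩⟩
    rwa [Fin.snoc_init_self]

open Classical in
theorem exists_defines {n : ℕ} (G : SimpleGraph (Fin (n + 1))) : ∃ φ, Defines G φ := by
  let cover : GForm (n + 1) := GForm.fa <| GForm.disjList (GForm.eq (Fin.last _) (Fin.last n).castSucc)
    ((List.finRange (n + 1)).map fun i => GForm.eq (Fin.last _) i.castSucc)
  let atom : Fin (n + 1) × Fin (n + 1) → GForm (n + 1) := fun q =>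
    GForm.conj (if G.Adj q.1 q.2 then GForm.adj q.1 q.2 else GForm.neg (GForm.adj q.1 q.2))
      (if q.1 = q.2 then GForm.eq q.1 q.2 else GForm.neg (GForm.eq q.1 q.2))
  let φ : GForm (n + 1) := GForm.conjList cover
    ((List.finRange (n + 1) ×ˢ List.finRange (n + 1)).map atom)
  have key : ∀ {V : Type} (H : SimpleGraph V) (f : Fin (n + 1) → V), φ.Realize H f ↔
      (∀ v, ∃ i, v = f i) ∧ ∀ i j, (G.Adj i j ↔ H.Adj (f i) (f j)) ∧ (i = j ↔ f i = f j) := by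
    intro V H f
    simp only [φ, GForm.realize_conjList]
    apply and_congr
    · simp only [cover, GForm.Realize, GForm.realize_disjList, List.mem_map, List.mem_finRange,
        true_and, exists_exists_eq_and, Fin.snoc_last, Fin.snoc_castSucc]
      exact forall_congr' fun v => ⟨fun h => h.elim (fun h => ⟨_, h⟩) id, Or.inr⟩
    · simp only [List.mem_map, Prod.exists, List.mem_product, List.mem_finRange, and_self,
        true_and, forall_exists_index]
      constructor
      · intro h i j
        have := h _ i j rfl
        simp only [atom] at this
        split_ifs at this <;> simp_all [GForm.Realize]
      · rintro h _ i j rfl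
        have := h i j
        simp only [atom]
        split_ifs <;> simp_all [GForm.Realize]
  refine ⟨φ.exAll, (GForm.sat_exAll _ _).2 ⟨id, (key G id).2 ⟨fun v => ⟨v, rfl⟩, by simp⟩⟩, ?_⟩
  intro m H hH
  obtain ⟨f, hf⟩ := (GForm.sat_exAll _ _).1 hH
  rw [key] at hf
  exact ⟨⟨Equiv.ofBijective f ⟨fun i j h => (hf.2 i j).2.2 h, fun v => (hf.1 v).imp fun _ => Eq.symm⟩,
    (hf.2 _ _).1.symm⟩⟩

/-- A set of vertices with the same neighbours forces large quantifier depth. -/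
theorem card_twins_le_D {n : ℕ} (G : SimpleGraph (Fin (n + 1))) (S : Finset (Fin (n + 1)))
    (hS : ∀ s ∈ S, ∀ t ∈ S, ∀ z, G.Adj s z ↔ G.Adj t z) : S.card ≤ D G := by
  obtain rfl | ⟨x, hx⟩ := S.eq_empty_or_nonempty
  · simp
  have hne : {d | ∃ φ : GForm 0, φ.depth = d ∧ Defines G φ}.Nonempty := by
    obtain ⟨φ, hφ⟩ := exists_defines G
    exact ⟨_, φ, rfl, hφ⟩
  obtain ⟨φ, hd, hφ⟩ := Nat.sInf_mem hne
  by_contra! hlt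
  have hsat := (GForm.realize_delete_twin G S x hx (fun s hs => hS x hx s hs) φ
    (by rw [hd, zero_add]; exact hlt) ![]).1 (by
      have := hφ.1
      unfold Sat at this
      rwa [Subsingleton.elim (fun i => ((![] : Fin 0 → {v // v ≠ x}) i : Fin (n + 1))) ![]])
  let e : {v // v ≠ x} ≃ Fin n := Fintype.equivFinOfCardEq (by simp)
  have hsat' := (sat_iso (SimpleGraph.Iso.map e _) φ).1 hsat
  obtain ⟨i⟩ := hφ.2 n _ hsat'
  simpa using Fintype.card_congr i.toEquiv

end Logic

end FODef

namespace FODef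

section Allocations

open Finset

open Classical in
/-- The number of maps all of whose fibres have fewer than `k` elements. -/
noncomputable def lowLoad (k : ℕ) (α β : Type) [Fintype α] [Fintype β] : ℕ :=
  (univ.filter fun g : α → β => ∀ v, (univ.filter fun x => g x = v).card < k).card

theorem lowLoad_congr (k : ℕ) {α β β' : Type} [Fintype α] [Fintype β] [Fintype β']
    (e : β ≃ β') : lowLoad k α β = lowLoad k α β' := by
  classical
  unfold lowLoad
  refine card_bij' (fun g _ => e ∘ g) (fun g _ => e.symm ∘ g) ?_ ?_ ?_ ?_
  · intro g hg
    simp only [mem_filter, mem_univ, true_and, Function.comp_apply] at hg ⊢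
    intro v
    simpa [Equiv.eq_symm_apply] using hg (e.symm v)
  · intro g hg
    simp only [mem_filter, mem_univ, true_and, Function.comp_apply] at hg ⊢
    intro v
    simpa [Equiv.symm_apply_eq] using hg (e v)
  · intro g _; funext x; simp
  · intro g _; funext x; simp

theorem lowLoad_option_le (k : ℕ) (α β : Type) [Fintype α] [Fintype β] [DecidableEq α] :
    lowLoad k α (Option β) ≤
      ∑ S ∈ (univ : Finset α).powerset, if S.card < k then lowLoad k {x // x ∉ S} β else 0 := by
  classical
  rw [← sum_filter]
  simp only [lowLoad]
  rw [← card_sigma]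
  have hex : ∀ (g : α → Option β) (x : {x // x ∉ univ.filter fun x => g x = none}),
      (g x).isSome := fun g x => by
    have := x.2
    simp only [mem_filter, mem_univ, true_and] at this
    exact Option.isSome_iff_ne_none.2 this
  refine card_le_card_of_injOn
    (fun g => ⟨univ.filter fun x => g x = none, fun x => (g x).get (hex g x)⟩) ?_ ?_
  · intro g hg
    simp only [coe_filter, mem_univ, true_and, Set.mem_ofPred_eq] at hg
    simp only [coe_sigma, Set.mem_sigma_iff, coe_filter, Set.mem_ofPred_eq, mem_univ, true_and,
      powerset_univ]
    refine ⟨by convert hg none, fun v => lt_of_le_of_lt ?_ (hg (some v))⟩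
    refine card_le_card_of_injOn Subtype.val ?_ Subtype.val_injective.injOn
    intro x hx
    simp only [coe_filter, mem_univ, true_and, Set.mem_ofPred_eq] at hx ⊢
    rw [← hx, Option.some_get]
  · intro g _ g' _ h
    simp only [Sigma.mk.injEq] at h
    obtain ⟨h1, h2⟩ := h
    have hn : ∀ x, g x = none ↔ g' x = none := fun x => by
      simpa using Finset.ext_iff.1 h1 x
    funext x
    by_cases hx : g x = none
    · rw [hx, (hn x).1 hx]
    · have hx' : g' x ≠ none := fun h => hx ((hn x).2 h)
      have key : ∀ (A B : Finset α) (hAB : A = B) (u : {x // x ∉ A} → β) (w : {x // x ∉ B} → β),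
          u ≍ w → ∀ (ha : x ∉ A) (hb : x ∉ B), u ⟨x, ha⟩ = w ⟨x, hb⟩ := by
        rintro A _ rfl u w huw ha hb
        rw [eq_of_heq huw]
      have := key _ _ h1 _ _ h2 (by simpa using hx) (by simpa using hx')
      simp only at this
      rw [← Option.some_get (Option.isSome_iff_ne_none.2 hx), this, Option.some_get]

theorem lowLoad_le (k : ℕ) {z : ℝ} (hz : 0 < z) (b : ℕ) (α : Type) [Fintype α] :
    (lowLoad k α (Fin b) : ℝ) ≤
      (Fintype.card α).factorial / z ^ Fintype.card α *
        (∑ j ∈ range k, z ^ j / j.factorial) ^ b := by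
  classical
  induction b generalizing α with
  | zero =>
    rcases isEmpty_or_nonempty α with h | h
    · simp only [Fintype.card_eq_zero, Nat.factorial_zero, pow_zero, Nat.cast_one, div_one, mul_one,
        Nat.cast_le_one]
      exact (card_le_univ _).trans (by simp)
    · have : lowLoad k α (Fin 0) = 0 := by
        apply Nat.le_zero.1
        exact (card_le_univ _).trans (by simp)
      rw [this]
      simp only [Nat.cast_zero]
      positivity
  | succ b ih =>
    set E := ∑ j ∈ range k, z ^ j / (j.factorial : ℝ)
    set m := Fintype.card α with hm
    have hE : 0 ≤ E := sum_nonneg fun _ _ => by positivity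
    rw [lowLoad_congr k (finSuccEquiv b)]
    have h1 : (lowLoad k α (Option (Fin b)) : ℝ) ≤
        ∑ S ∈ (univ : Finset α).powerset, if S.card < k then
          ((m - S.card).factorial / z ^ (m - S.card) * E ^ b : ℝ) else 0 := by
      refine (Nat.cast_le.2 (lowLoad_option_le k α (Fin b))).trans ?_
      push_cast
      refine sum_le_sum fun S _ => ?_
      split_ifs
      · refine (ih {x // x ∉ S}).trans (le_of_eq ?_)
        have : Fintype.card {x // x ∉ S} = m - S.card := by
          rw [Fintype.card_subtype_compl]; simp [hm]
        rw [this]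
      · simp
    refine h1.trans ?_
    rw [sum_powerset_apply_card (fun j => if j < k then
          ((m - j).factorial / z ^ (m - j) * E ^ b : ℝ) else 0)]
    have h2 : ∀ j ∈ range (#(univ : Finset α) + 1), (#(univ : Finset α)).choose j •
        (if j < k then ((m - j).factorial / z ^ (m - j) * E ^ b : ℝ) else 0) =
        if j < k then m.factorial / z ^ m * E ^ b * (z ^ j / j.factorial) else 0 := by
      intro j hj
      have hj' : j ≤ m := by simp [hm] at hj ⊢; omega
      split_ifs
      · rw [card_univ, ← hm, nsmul_eq_mul, Nat.cast_choose ℝ hj', ← Nat.sub_add_cancel hj',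
          Nat.add_sub_cancel, pow_add]
        field_simp
      · simp
    rw [sum_congr rfl h2, ← sum_filter, ← mul_sum, pow_succ, ← mul_assoc]
    refine mul_le_mul_of_nonneg_left ?_ (by positivity)
    refine sum_le_sum_of_subset_of_nonneg ?_ fun _ _ _ => by positivity
    intro j hj
    simp only [mem_filter] at hj
    exact mem_range.2 hj.2

theorem factorial_le_stirling {m : ℕ} (hm : 0 < m) :
    (m.factorial : ℝ) ≤ Real.exp 1 * √m * (m / Real.exp 1) ^ m := by
  obtain ⟨n, rfl⟩ := Nat.exists_eq_succ_of_ne_zero hm.ne'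
  have h : Stirling.stirlingSeq (n + 1) ≤ Stirling.stirlingSeq 1 :=
    Stirling.stirlingSeq'_antitone (Nat.zero_le n)
  rw [Stirling.stirlingSeq_one, Stirling.stirlingSeq, div_le_iff₀ (by positivity)] at h
  refine h.trans (le_of_eq ?_)
  rw [Real.sqrt_mul (by norm_num)]
  field_simp

theorem lowLoad_le_exp {k : ℕ} (hk : 0 < k) {c : ℝ} (hc : 0 < c) {n : ℕ} (hn : 0 < n)
    (α β : Type) [Fintype α] [Fintype β]
    (hα : c * n ≤ Fintype.card α) (hα' : Fintype.card α ≤ n) (hβ : Fintype.card β ≤ n) :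
    (lowLoad k α β : ℝ) ≤ (Fintype.card β : ℝ) ^ Fintype.card α *
      (Real.exp 1 * √n * Real.exp (-(c * n / k * (Real.exp (-k) * (c / k) ^ k)))) := by
  classical
  set m := Fintype.card α with hm
  set b := Fintype.card β with hb
  have hm0 : 0 < m := by
    have : (0 : ℝ) < m := lt_of_lt_of_le (by positivity) hα
    exact_mod_cast this
  by_cases hlarge : k * b ≤ m
  · have : lowLoad k α β = 0 := by
      rw [lowLoad, card_eq_zero, filter_eq_empty_iff]
      intro g _ hg
      rcases Nat.eq_zero_or_pos b with h0 | h0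
      · have : IsEmpty β := Fintype.card_eq_zero_iff.1 h0
        have : Nonempty α := Fintype.card_pos_iff.1 hm0
        exact this.elim fun x => IsEmpty.false (g x)
      · have h1 : m = ∑ v : β, (univ.filter fun x => g x = v).card := by
          rw [hm, ← card_univ]
          exact card_eq_sum_card_fiberwise fun _ _ => mem_univ _
        have : Nonempty β := Fintype.card_pos_iff.1 h0
        have h2 : ∑ v : β, (univ.filter fun x => g x = v).card < ∑ v : β, k :=
          sum_lt_sum_of_nonempty univ_nonempty fun v _ => hg v
        rw [sum_const, card_univ, smul_eq_mul, ← hb, mul_comm] at h2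
        omega
    rw [this, Nat.cast_zero]
    positivity
  · push Not at hlarge
    have hb0 : 0 < b := by
      rcases Nat.eq_zero_or_pos b with h | h
      · rw [h] at hlarge; omega
      · exact h
    have hmR : (0 : ℝ) < m := by exact_mod_cast hm0
    have hbR : (0 : ℝ) < b := by exact_mod_cast hb0
    have hkR : (0 : ℝ) < k := by exact_mod_cast hk
    have hnR : (0 : ℝ) < n := by exact_mod_cast hn
    have hlR : (m : ℝ) < k * b := by exact_mod_cast hlarge
    set z : ℝ := m / b with hz
    have hz0 : 0 < z := by positivity
    have hzk : z ≤ k := by rw [hz, div_le_iff₀ hbR]; exact hlR.le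
    have hcz : c ≤ z := by
      rw [hz, le_div_iff₀ hbR]
      refine le_trans ?_ hα
      gcongr
    set t := Real.exp (-z) * (z ^ k / k.factorial) with ht
    have hE : ∑ j ∈ range k, z ^ j / (j.factorial : ℝ) ≤ Real.exp (z - t) := by
      have h1 := Real.sum_le_exp_of_nonneg hz0.le (k + 1)
      rw [sum_range_succ] at h1
      have h2 : Real.exp z * t = z ^ k / k.factorial := by
        rw [ht, ← mul_assoc, ← Real.exp_add]; simp
      have h3 : 1 - t ≤ Real.exp (-t) := by linarith [Real.add_one_le_exp (-t)]
      calc _ ≤ Real.exp z - z ^ k / k.factorial := by linarith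
        _ = Real.exp z * (1 - t) := by rw [← h2]; ring
        _ ≤ Real.exp z * Real.exp (-t) := by gcongr
        _ = _ := by rw [← Real.exp_add]; rfl
    have hE0 : 0 ≤ ∑ j ∈ range k, z ^ j / (j.factorial : ℝ) := sum_nonneg fun _ _ => by positivity
    have hbt : c * n / k * (Real.exp (-k) * (c / k) ^ k) ≤ b * t := by
      have h1 : c * n / k ≤ b := by
        rw [div_le_iff₀ hkR]; nlinarith
      have h2 : (c / k) ^ k ≤ z ^ k / k.factorial := by
        rw [div_pow]
        have : (k.factorial : ℝ) ≤ (k : ℝ) ^ k := by exact_mod_cast Nat.factorial_le_pow k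
        gcongr
      rw [ht]
      gcongr
    rw [lowLoad_congr k (Fintype.equivFin β)]
    calc (lowLoad k α (Fin b) : ℝ)
        ≤ m.factorial / z ^ m * (∑ j ∈ range k, z ^ j / (j.factorial : ℝ)) ^ b :=
          lowLoad_le k hz0 b α
      _ ≤ (Real.exp 1 * √m * (m / Real.exp 1) ^ m) / z ^ m * (Real.exp (z - t)) ^ b := by
          gcongr
          exact factorial_le_stirling hm0
      _ = (b : ℝ) ^ m * (Real.exp 1 * √m * Real.exp (-(b * t))) := by
          have h1 : Real.exp (z - t) ^ b = Real.exp 1 ^ m * Real.exp (-(b * t)) := by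
            rw [← Real.exp_nat_mul, ← Real.exp_nat_mul, ← Real.exp_add]
            congr 1
            rw [hz]; field_simp; ring
          rw [h1, hz, div_pow, div_pow]
          field_simp
      _ ≤ _ := by
          gcongr

end Allocations

end FODef

namespace FODef

section Parents

variable {V : Type}

/-- `p` is the parent function of a tree on `V` rooted at `o`. -/
def IsParent (o : V) (p : V → V) : Prop :=
  p o = o ∧ ∀ x, ∃ k, p^[k] x = o

/-- Height of a vertex above the root. -/
noncomputable def height (o : V) (p : V → V) (x : V) : ℕ :=
  sInf {k | p^[k] x = o}

theorem height_root (o : V) (p : V → V) : height o p o = 0 :=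
  Nat.sInf_eq_zero.2 (Or.inl rfl)

theorem IsParent.height_eq {o : V} {p : V → V} (hp : IsParent o p) {x : V} (hx : x ≠ o) :
    height o p x = height o p (p x) + 1 := by
  apply le_antisymm
  · apply Nat.sInf_le
    have : p^[height o p (p x)] (p x) = o := Nat.sInf_mem (hp.2 (p x))
    simpa only [Set.mem_ofPred_eq, Function.iterate_succ_apply] using this
  · have h : p^[height o p x] x = o := Nat.sInf_mem (hp.2 x)
    rcases hn : height o p x with _ | j
    · rw [hn] at h; exact absurd h hx
    · rw [hn, Function.iterate_succ_apply] at h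
      exact Nat.succ_le_succ (Nat.sInf_le h)

theorem IsParent.height_lt {o : V} {p : V → V} (hp : IsParent o p) {x : V} (hx : x ≠ o) :
    height o p (p x) < height o p x := by
  rw [hp.height_eq hx]; exact Nat.lt_succ_self _

theorem IsParent.ne {o : V} {p : V → V} (hp : IsParent o p) {x : V} (hx : x ≠ o) : p x ≠ x :=
  fun h => absurd (hp.height_lt hx) (by rw [h]; exact lt_irrefl _)

/-- Pointwise criterion for a parent function: a strictly decreasing potential. -/
theorem isParent_of_potential {o : V} {p : V → V} (h0 : p o = o) (d : V → ℕ)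
    (hd : ∀ x, x ≠ o → d (p x) < d x) : IsParent o p := by
  refine ⟨h0, fun x => ?_⟩
  induction hx : d x using Nat.strong_induction_on generalizing x with
  | _ m ih =>
    by_cases h : x = o
    · exact ⟨0, h⟩
    · obtain ⟨k, hk⟩ := ih _ (hx ▸ hd x h) (p x) rfl
      exact ⟨k + 1, by rwa [Function.iterate_succ_apply]⟩

theorem iterate_eq_of_agree {L : Set V} {p q : V → V} (hpq : ∀ x, x ∉ L → q x = p x)
    (hp : ∀ x, p x ∉ L) {y : V} (hy : y ∉ L) (k : ℕ) : q^[k] y = p^[k] y := by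
  induction k generalizing y with
  | zero => rfl
  | succ k ih =>
    rw [Function.iterate_succ_apply, Function.iterate_succ_apply, hpq y hy, ih (hp y)]

theorem height_eq_of_agree {L : Set V} {p q : V → V} (hpq : ∀ x, x ∉ L → q x = p x)
    (hp : ∀ x, p x ∉ L) {y : V} (hy : y ∉ L) (o : V) : height o q y = height o p y := by
  unfold height
  simp only [iterate_eq_of_agree hpq hp hy]

variable [Fintype V]

open Classical in
/-- The vertices without children. -/
noncomputable def leaves (p : V → V) : Finset V :=
  Finset.univ.filter fun x => ∀ y, p y ≠ x

open Classical in
/-- The leaves whose height has parity `τ`. -/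
noncomputable def parityLeaves (o : V) (τ : ℕ) (p : V → V) : Finset V :=
  (leaves p).filter fun x => height o p x % 2 = τ

open Classical in
/-- The leaves whose parent is `v`. -/
noncomputable def leafChildren (p : V → V) (v : V) : Finset V :=
  (leaves p).filter fun x => p x = v

theorem mem_leaves {p : V → V} {x : V} : x ∈ leaves p ↔ ∀ y, p y ≠ x := by
  simp [leaves]

theorem mem_parityLeaves {o : V} {τ : ℕ} {p : V → V} {x : V} :
    x ∈ parityLeaves o τ p ↔ (∀ y, p y ≠ x) ∧ height o p x % 2 = τ := by
  simp [parityLeaves, mem_leaves]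

theorem mem_leafChildren {p : V → V} {v x : V} :
    x ∈ leafChildren p v ↔ (∀ y, p y ≠ x) ∧ p x = v := by
  simp [leafChildren, mem_leaves]

theorem IsParent.parity_parent {o : V} {τ : ℕ} {p : V → V} (hp : IsParent o p) {x : V}
    (hx : x ∈ parityLeaves o τ p) : height o p (p x) % 2 ≠ τ := by
  rw [mem_parityLeaves] at hx
  have hxo : x ≠ o := fun h => hx.1 o (hp.1.trans h.symm)
  have := hp.height_eq hxo
  omega

theorem parityLeaves_rewire {o : V} {τ : ℕ} {p q : V → V} (hp : IsParent o p)
    (hpq : ∀ x, x ∉ parityLeaves o τ p → q x = p x)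
    (hq : ∀ x ∈ parityLeaves o τ p, height o p (q x) % 2 ≠ τ) :
    IsParent o q ∧ parityLeaves o τ q = parityLeaves o τ p := by
  set L := parityLeaves o τ p with hL
  have hpL : ∀ x, p x ∉ (L : Set V) := fun x h => (mem_parityLeaves.1 h).1 x rfl
  have hqL : ∀ x, q x ∉ (L : Set V) := fun x h => by
    by_cases hx : x ∈ L
    · exact hq x hx (mem_parityLeaves.1 h).2
    · rw [hpq x hx] at h; exact hpL x h
  have hagree : ∀ x, x ∉ (L : Set V) → q x = p x := hpq
  have hoL : o ∉ (L : Set V) := fun h => hpL o (by rwa [hp.1])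
  have hqP : IsParent o q := by
    refine ⟨(hpq o hoL).trans hp.1, fun x => ?_⟩
    obtain ⟨k, hk⟩ := hp.2 (q x)
    refine ⟨k + 1, ?_⟩
    rw [Function.iterate_succ_apply, iterate_eq_of_agree hagree hpL (hqL x), hk]
  have hht : ∀ y, y ∉ L → height o q y = height o p y := fun y hy =>
    height_eq_of_agree hagree hpL hy o
  have hhtL : ∀ y ∈ L, height o q y % 2 = τ := fun y hy => by
    have hyo : y ≠ o := fun h => hoL (h ▸ hy)
    have h1 := hqP.height_eq hyo
    rw [hht _ (hqL y)] at h1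
    have h2 := hq y hy
    have h3 := (mem_parityLeaves.1 hy).2
    omega
  refine ⟨hqP, Finset.ext fun y => ?_⟩
  constructor
  · intro hy
    by_contra hyL
    rw [mem_parityLeaves, hht y hyL] at hy
    refine hyL (mem_parityLeaves.2 ⟨fun z hz => ?_, hy.2⟩)
    by_cases hzL : z ∈ L
    · by_cases hzo : z = o
      · exact hoL (hzo ▸ hzL)
      · have h1 := hp.height_eq hzo
        rw [hz] at h1
        have := (mem_parityLeaves.1 hzL).2
        omega
    · exact hy.1 z ((hpq z hzL).trans hz)
  · intro hy
    exact mem_parityLeaves.2 ⟨fun z hz => hqL z (by rwa [hz]), hhtL y hy⟩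

open Classical in
theorem card_lowLoad_parents_le (o : V) (τ : ℕ) {k : ℕ} (hk : 0 < k) {c : ℝ} (hc : 0 < c) :
    ((Finset.univ.filter fun p : V → V => IsParent o p ∧ (∀ v, (leafChildren p v).card < k) ∧
        c * Fintype.card V ≤ (parityLeaves o τ p).card).card : ℝ) ≤
      (Finset.univ.filter fun p : V → V => IsParent o p).card *
        (Real.exp 1 * √(Fintype.card V) *
          Real.exp (-(c * Fintype.card V / k * (Real.exp (-k) * (c / k) ^ k)))) := by
  set n := Fintype.card V
  set η := Real.exp 1 * √n * Real.exp (-(c * n / k * (Real.exp (-k) * (c / k) ^ k)))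
  have hn : 0 < n := Fintype.card_pos_iff.2 ⟨o⟩
  set bad := Finset.univ.filter fun p : V → V => IsParent o p ∧
    (∀ v, (leafChildren p v).card < k) ∧ c * n ≤ (parityLeaves o τ p).card
  set all := Finset.univ.filter fun p : V → V => IsParent o p
  let key : (V → V) → Finset V × (V → V) := fun p =>
    (parityLeaves o τ p, fun x => if x ∈ parityLeaves o τ p then o else p x)
  have hbad : bad.card = ∑ κ, (bad.filter fun p => key p = κ).card :=
    Finset.card_eq_sum_card_fiberwise fun _ _ => Finset.mem_univ _
  have hall : all.card = ∑ κ, (all.filter fun p => key p = κ).card :=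
    Finset.card_eq_sum_card_fiberwise fun _ _ => Finset.mem_univ _
  rw [hbad, hall]
  push_cast
  rw [Finset.sum_mul]
  refine Finset.sum_le_sum fun κ _ => ?_
  rcases (bad.filter fun p => key p = κ).eq_empty_or_nonempty with h0 | ⟨p₀, hp₀⟩
  · rw [h0, Finset.card_empty, Nat.cast_zero]
    positivity
  simp only [bad, Finset.mem_filter, Finset.mem_univ, true_and] at hp₀
  obtain ⟨⟨hP₀, -, hc₀⟩, rfl⟩ := hp₀
  set L := parityLeaves o τ p₀ with hL
  let B : Type := {y // height o p₀ y % 2 ≠ τ}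
  have hkey : ∀ p, key p = key p₀ → parityLeaves o τ p = L ∧ ∀ x, x ∉ L → p x = p₀ x := by
    intro p h
    have h1 : parityLeaves o τ p = L := congrArg Prod.fst h
    refine ⟨h1, fun x hx => ?_⟩
    have h2 := congrFun (congrArg Prod.snd h) x
    simp only [key, h1, ← hL] at h2
    simpa [hx] using h2
  have hfib : ∀ p, IsParent o p → key p = key p₀ → ∀ x ∈ L, height o p₀ (p x) % 2 ≠ τ := by
    intro p hp h x hx
    obtain ⟨h1, h2⟩ := hkey p h
    have h3 := hp.parity_parent (h1 ▸ hx : x ∈ parityLeaves o τ p)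
    rwa [← height_eq_of_agree (L := (L : Set V)) (p := p) (q := p₀)
      (fun x hx => (h2 x hx).symm) (fun y hy => (mem_parityLeaves.1 (h1 ▸ hy)).1 y rfl)
      (fun hy => (mem_parityLeaves.1 (h1 ▸ hy)).1 x rfl)] at h3
  have hLpos : 0 < L.card := by
    have : (0 : ℝ) < L.card := lt_of_lt_of_le (by positivity) hc₀
    exact_mod_cast this
  obtain ⟨x₀, hx₀⟩ := Finset.card_pos.1 hLpos
  have b₀ : B := ⟨p₀ x₀, hP₀.parity_parent hx₀⟩
  have hub : (bad.filter fun p => key p = key p₀).card ≤ lowLoad k L B := by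
    unfold lowLoad
    refine Finset.card_le_card_of_injOn
      (fun p x => if h : height o p₀ (p x) % 2 ≠ τ then ⟨p x, h⟩ else b₀) ?_ ?_
    · intro p hp
      simp only [bad, Finset.coe_filter, Finset.mem_filter, Finset.mem_univ, true_and,
        Set.mem_ofPred_eq] at hp ⊢
      obtain ⟨⟨hP, hlow, -⟩, hpk⟩ := hp
      intro v
      refine lt_of_le_of_lt ?_ (hlow v)
      refine Finset.card_le_card_of_injOn Subtype.val ?_ Subtype.val_injective.injOn
      intro x hx
      simp only [Finset.coe_filter, Finset.mem_univ, true_and, Set.mem_ofPred_eq] at hx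
      rw [dif_pos (hfib p hP hpk x x.2)] at hx
      have hx2 : (x : V) ∈ parityLeaves o τ p := by
        rw [(hkey p hpk).1]; exact x.2
      exact mem_leafChildren.2 ⟨(mem_parityLeaves.1 hx2).1, congrArg Subtype.val hx⟩
    · intro p hp q hq h
      simp only [bad, Finset.coe_filter, Finset.mem_filter, Finset.mem_univ, true_and,
        Set.mem_ofPred_eq] at hp hq
      funext x
      by_cases hx : x ∈ L
      · have h1 := congrFun h ⟨x, hx⟩
        simp only at h1
        rw [dif_pos (hfib p hp.1.1 hp.2 x hx), dif_pos (hfib q hq.1.1 hq.2 x hx)] at h1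
        exact congrArg Subtype.val h1
      · rw [(hkey p hp.2).2 x hx, (hkey q hq.2).2 x hx]
  have hlb : Fintype.card B ^ Fintype.card L ≤ (all.filter fun p => key p = key p₀).card := by
    rw [← Fintype.card_fun, ← Finset.card_univ]
    refine Finset.card_le_card_of_injOn
      (fun (g : L → B) x => if h : x ∈ L then (g ⟨x, h⟩ : V) else p₀ x) ?_ ?_
    · intro g _
      obtain ⟨h1, h2⟩ := parityLeaves_rewire (τ := τ) (p := p₀)
        (q := fun x => if h : x ∈ L then (g ⟨x, h⟩ : V) else p₀ x) hP₀
        (fun x hx => dif_neg hx) (fun x hx => by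
          rw [dif_pos hx]; exact (g ⟨x, hx⟩).2)
      simp only [all, Finset.coe_filter, Finset.mem_filter, Finset.mem_univ, true_and,
        Set.mem_ofPred_eq]
      refine ⟨h1, ?_⟩
      simp only [key, h2]
      refine Prod.ext rfl (funext fun x => ?_)
      by_cases hx : x ∈ L
      · simp only [← hL, if_pos hx]
      · simp only [← hL, if_neg hx, dif_neg hx]
    · intro g _ g' _ h
      funext x
      have hx := congrFun h x
      simp only at hx
      rw [dif_pos x.2, dif_pos x.2] at hx
      exact Subtype.ext hx
  have hbound := lowLoad_le_exp hk hc hn L B (by simpa using hc₀)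
    (by simpa using Finset.card_le_univ L) (Fintype.card_subtype_le _)
  calc _ ≤ (lowLoad k L B : ℝ) := by exact_mod_cast hub
    _ ≤ _ := hbound
    _ ≤ _ := by
      refine mul_le_mul_of_nonneg_right ?_ (by positivity)
      exact_mod_cast hlb

end Parents

end FODef

namespace FODef

section Switching

variable {V : Type}

open Classical in
/-- Detach `v`, handing its children over to its parent, and reattach it below `u`. -/
noncomputable def switch (p : V → V) (v u x : V) : V :=
  if x = v then u else if p x = v then p v else p x

theorem isParent_switch {o : V} {p : V → V} (hp : IsParent o p) {v u : V} (hv : v ≠ o)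
    (hu : u ≠ v) : IsParent o (switch p v u) := by
  classical
  have hpv := hp.ne hv
  refine isParent_of_potential ?_
    (fun x => if x = v then height o p u + 1 else height o p x) fun x hx => ?_
  · simp [switch, hv.symm, hp.1]
  · have h1 := hp.height_lt hx
    have h2 := hp.height_lt hv
    by_cases hxv : x = v
    · simp [switch, hxv, hu]
    · by_cases hpx : p x = v
      · simp only [switch, hxv, hpx, if_false, if_true, hpv]
        rw [hpx] at h1
        exact h2.trans h1
      · simpa only [switch, hxv, hpx, if_false] using h1

variable [Fintype V]

open Classical in
/-- The non-root vertices with exactly one child. -/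
noncomputable def unary (o : V) (p : V → V) : Finset V :=
  Finset.univ.filter fun v => v ≠ o ∧ ∃ w, ∀ y, p y = v ↔ y = w

open Classical in
theorem card_le_unary_add (o : V) (p : V → V) :
    Fintype.card V ≤ (unary o p).card + 2 * (leaves p).card + 1 := by
  have h1 : Fintype.card V = ∑ v : V, (Finset.univ.filter fun x => p x = v).card := by
    rw [← Finset.card_univ]
    exact Finset.card_eq_sum_card_fiberwise fun _ _ => Finset.mem_univ _
  have h2 : ∑ _v : V, 2 ≤ ∑ v : V, ((Finset.univ.filter fun x => p x = v).card +
      2 * (if v ∈ leaves p then 1 else 0) + (if v ∈ insert o (unary o p) then 1 else 0)) := by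
    refine Finset.sum_le_sum fun v _ => ?_
    rcases h : (Finset.univ.filter fun x => p x = v).card with _ | _ | j
    · have : v ∈ leaves p := mem_leaves.2 fun y hy => by
        have := Finset.filter_eq_empty_iff.1 (Finset.card_eq_zero.1 h) (Finset.mem_univ y)
        exact this hy
      simp [this]
    · have : v ∈ insert o (unary o p) := by
        obtain ⟨w, hw⟩ := Finset.card_eq_one.1 h
        by_cases hv : v = o
        · simp [hv]
        · refine Finset.mem_insert_of_mem ?_
          simp only [unary, Finset.mem_filter, Finset.mem_univ, true_and]
          refine ⟨hv, w, fun y => ?_⟩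
          simpa using Finset.ext_iff.1 hw y
      simp only [this, if_true]
      omega
    · omega
  rw [Finset.sum_add_distrib, Finset.sum_add_distrib, ← h1, ← Finset.mul_sum,
    Finset.sum_boole, Finset.sum_boole, Finset.sum_const, Finset.card_univ] at h2
  simp only [Finset.filter_univ_mem, smul_eq_mul, Nat.cast_id] at h2
  have h3 := Finset.card_insert_le o (unary o p)
  omega

theorem mem_leaves_switch {o : V} {p : V → V} (hp : IsParent o p) {v u : V} (hv : v ≠ o)
    (hu : u ≠ v) : v ∈ leaves (switch p v u) := by
  have hpv := hp.ne hv
  refine mem_leaves.2 fun y => ?_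
  unfold switch
  split_ifs <;> assumption

open Classical in
theorem leaves_switch_subset {o : V} {p : V → V} (hp : IsParent o p) {v u : V}
    (hv : v ∈ unary o p) : leaves (switch p v u) ⊆ insert v (leaves p) := by
  simp only [unary, Finset.mem_filter, Finset.mem_univ, true_and] at hv
  obtain ⟨hvo, w, hw⟩ := hv
  have hpw : p w = v := (hw w).2 rfl
  have hwv : w ≠ v := fun h => hp.ne hvo (h ▸ hpw)
  intro y hy
  rw [Finset.mem_insert, mem_leaves]
  rw [mem_leaves] at hy
  by_contra! h
  obtain ⟨hyv, x, hx⟩ := h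
  by_cases hxv : x = v
  · refine hy w ?_
    simp only [switch, hwv, hpw, if_false, if_true]
    rwa [← hxv]
  · refine hy x ?_
    simp [switch, hxv, hx, hyv]

open Classical in
theorem card_few_leaves_mul_le (o : V) (l : ℕ) :
    (Finset.univ.filter fun p : V → V => IsParent o p ∧ (leaves p).card ≤ l).card *
        ((Fintype.card V - (2 * l + 1)) * (Fintype.card V - 1)) ≤
      (Finset.univ.filter fun p : V → V => IsParent o p).card * ((l + 1) * Fintype.card V) := by
  set few := Finset.univ.filter fun p : V → V => IsParent o p ∧ (leaves p).card ≤ l with hfew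
  set X := few.sigma fun p => (unary o p).sigma fun v => Finset.univ.erase v with hX
  set Y := (Finset.univ.filter fun p : V → V => IsParent o p ∧ (leaves p).card ≤ l + 1).sigma
    fun p => leaves p ×ˢ (Finset.univ : Finset V) with hY
  have hXc : few.card * ((Fintype.card V - (2 * l + 1)) * (Fintype.card V - 1)) ≤ X.card := by
    rw [hX, Finset.card_sigma, ← smul_eq_mul]
    refine Finset.card_nsmul_le_sum _ _ _ fun p hp => ?_
    rw [Finset.card_sigma]
    simp only [Finset.card_erase_of_mem (Finset.mem_univ _), Finset.card_univ, Finset.sum_const,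
      smul_eq_mul]
    refine Nat.mul_le_mul_right _ ?_
    have h1 := card_le_unary_add o p
    have h2 := (Finset.mem_filter.1 hp).2.2
    omega
  have hYc : Y.card ≤ (Finset.univ.filter fun p : V → V => IsParent o p).card *
      ((l + 1) * Fintype.card V) := by
    rw [hY, Finset.card_sigma]
    refine (Finset.sum_le_card_nsmul _ _ ((l + 1) * Fintype.card V) fun p hp => ?_).trans ?_
    · rw [Finset.card_product, Finset.card_univ]
      exact Nat.mul_le_mul_right _ (Finset.mem_filter.1 hp).2.2
    · rw [smul_eq_mul]
      refine Nat.mul_le_mul_right _ (Finset.card_le_card fun p hp => ?_)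
      simp only [Finset.mem_filter, Finset.mem_univ, true_and] at hp ⊢
      exact hp.1
  refine hXc.trans (le_trans ?_ hYc)
  let child : (V → V) → V → V := fun p v => if h : ∃ w, p w = v then h.choose else v
  have hchild : ∀ {p v}, v ∈ unary o p → ∀ y, p y = v ↔ y = child p v := by
    intro p v hv
    simp only [unary, Finset.mem_filter, Finset.mem_univ, true_and] at hv
    obtain ⟨-, w, hw⟩ := hv
    have hex : ∃ w, p w = v := ⟨w, (hw w).2 rfl⟩
    have : child p v = w := by
      simp only [child, dif_pos hex]
      exact (hw _).1 hex.choose_spec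
    rwa [this]
  have hne : ∀ {p v}, v ∈ unary o p → v ≠ o := fun hv => (Finset.mem_filter.1 hv).2.1
  refine Finset.card_le_card_of_injOn
    (fun a => ⟨switch a.1 a.2.1 a.2.2, (a.2.1, child a.1 a.2.1)⟩) ?_ ?_
  · rintro ⟨p, v, u⟩ ha
    simp only [hX, hfew, Finset.coe_sigma, Set.mem_sigma_iff, Finset.coe_filter, Finset.mem_univ,
      true_and, Set.mem_ofPred_eq, Finset.mem_coe, Finset.mem_erase, and_true] at ha
    obtain ⟨⟨hp, hl⟩, hv, hu⟩ := ha
    simp only [hY, Finset.mem_coe, Finset.mem_sigma, Finset.mem_filter, Finset.mem_univ, true_and,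
      Finset.mem_product, and_true]
    refine ⟨⟨isParent_switch hp (hne hv) hu, ?_⟩, mem_leaves_switch hp (hne hv) hu⟩
    refine (Finset.card_le_card (leaves_switch_subset hp hv)).trans
      ((Finset.card_insert_le _ _).trans ?_)
    omega
  · rintro ⟨p, v, u⟩ ha ⟨p', v', u'⟩ hb h
    simp only [hX, hfew, Finset.coe_sigma, Set.mem_sigma_iff, Finset.coe_filter, Finset.mem_univ,
      true_and, Set.mem_ofPred_eq, Finset.mem_coe, Finset.mem_erase, and_true] at ha hb
    simp only [Sigma.mk.injEq, heq_eq_eq, Prod.mk.injEq] at h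
    obtain ⟨hs, rfl, hc⟩ := h
    obtain ⟨⟨hp, -⟩, hv, hu⟩ := ha
    obtain ⟨⟨hp', -⟩, hv', hu'⟩ := hb
    set w := child p v
    have hw := hchild hv
    have hw' := hchild hv'
    rw [← hc] at hw'
    have hpw : p w = v := (hw w).2 rfl
    have hpw' : p' w = v := (hw' w).2 rfl
    have hwv : w ≠ v := fun h => hp.ne (hne hv) (h ▸ hpw)
    have huu : u = u' := by simpa [switch] using congrFun hs v
    have hpp : p = p' := by
      funext x
      by_cases hxw : x = w
      · rw [hxw, hpw, hpw']
      by_cases hxv : x = v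
      · rw [hxv]
        simpa [switch, hwv, hpw, hpw'] using congrFun hs w
      · have h1 : p x ≠ v := fun h => hxw ((hw x).1 h)
        have h2 : p' x ≠ v := fun h => hxw ((hw' x).1 h)
        simpa [switch, hxv, h1, h2] using congrFun hs x
    rw [huu, hpp]

end Switching

section ParentGraph

variable {V : Type}

/-- The graph joining every vertex to its parent. -/
def parentGraph (p : V → V) : SimpleGraph V :=
  SimpleGraph.fromRel fun x y => p x = y

theorem parentGraph_adj {p : V → V} {x y : V} :
    (parentGraph p).Adj x y ↔ x ≠ y ∧ (p x = y ∨ p y = x) :=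
  SimpleGraph.fromRel_adj _ _ _

theorem IsParent.connected {o : V} {p : V → V} (hp : IsParent o p) :
    (parentGraph p).Connected := by
  have h : ∀ m x, height o p x = m → (parentGraph p).Reachable x o := by
    intro m
    induction m with
    | zero =>
      intro x hx
      by_cases hxo : x = o
      · rw [hxo]
      · rw [hp.height_eq hxo] at hx; omega
    | succ m ih =>
      intro x hx
      have hxo : x ≠ o := fun h => by rw [h, height_root] at hx; omega
      rw [hp.height_eq hxo] at hx
      have hadj : (parentGraph p).Adj x (p x) := parentGraph_adj.2 ⟨(hp.ne hxo).symm, Or.inl rfl⟩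
      exact hadj.reachable.trans (ih _ (by omega))
  have : Nonempty V := ⟨o⟩
  exact SimpleGraph.Connected.mk fun x y => (h _ x rfl).trans (h _ y rfl).symm

theorem IsParent.isTree [Fintype V] {o : V} {p : V → V} (hp : IsParent o p) :
    (parentGraph p).IsTree := by
  classical
  rw [SimpleGraph.isTree_iff_connected_and_card]
  refine ⟨hp.connected, le_antisymm ?_ hp.connected.card_vert_le_card_edgeSet_add_one⟩
  have hsub : (parentGraph p).edgeSet ⊆
      ((Finset.univ.erase o).image fun x => s(x, p x) : Finset (Sym2 V)) := by
    intro e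
    induction e using Sym2.ind with
    | _ x y =>
      intro h
      obtain ⟨hne, h | h⟩ := parentGraph_adj.1 h
      · refine Finset.mem_coe.2 (Finset.mem_image.2 ⟨x, ?_, by rw [h]⟩)
        simp only [Finset.mem_erase, Finset.mem_univ, and_true]
        rintro rfl
        exact hne (hp.1.symm.trans h)
      · refine Finset.mem_coe.2 (Finset.mem_image.2 ⟨y, ?_, by rw [h, Sym2.eq_swap]⟩)
        simp only [Finset.mem_erase, Finset.mem_univ, and_true]
        rintro rfl
        exact hne (h.symm.trans hp.1)
  have h1 : Nat.card (parentGraph p).edgeSet ≤ (Finset.univ.erase o).card := by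
    refine le_trans ?_ (Finset.card_image_le (f := fun x => s(x, p x)))
    rw [Nat.card_coe_set_eq, ← Set.ncard_coe_finset]
    exact Set.ncard_le_ncard hsub (Finset.finite_toSet _)
  rw [Finset.card_erase_of_mem (Finset.mem_univ _), Finset.card_univ] at h1
  have : 0 < Fintype.card V := Fintype.card_pos_iff.2 ⟨o⟩
  rw [Nat.card_eq_fintype_card (α := V)]
  omega

theorem parentGraph_inj {o : V} {p q : V → V} (hp : IsParent o p) (hq : IsParent o q)
    (h : parentGraph p = parentGraph q) : p = q := by
  funext x
  induction hm : height o p x using Nat.strong_induction_on generalizing x with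
  | _ m ih =>
    by_cases hx : x = o
    · rw [hx, hp.1, hq.1]
    have hlt := hp.height_lt hx
    have hadj : (parentGraph q).Adj x (p x) :=
      h ▸ parentGraph_adj.2 ⟨(hp.ne hx).symm, Or.inl rfl⟩
    obtain ⟨-, h1 | h1⟩ := parentGraph_adj.1 hadj
    · exact h1.symm
    · rw [← ih _ (hm ▸ hlt) _ rfl] at h1
      by_cases hy : p x = o
      · rw [hy, hp.1] at h1; exact absurd h1.symm hx
      · have := hp.height_lt hy
        rw [h1] at this
        omega

theorem exists_parent {T : SimpleGraph V} (hT : T.IsTree) (o : V) :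
    ∃ p, IsParent o p ∧ parentGraph p = T := by
  classical
  have hstep : ∀ x, x ≠ o → ∃ y, T.Adj x y ∧ T.dist y o < T.dist x o := by
    intro x hx
    obtain ⟨w, hw⟩ := hT.connected.exists_walk_length_eq_dist x o
    cases w with
    | nil => exact absurd rfl hx
    | @cons _ y _ h w =>
      refine ⟨y, h, ?_⟩
      rw [SimpleGraph.Walk.length_cons] at hw
      have := SimpleGraph.dist_le w
      omega
  choose! f hf using hstep
  have hp : IsParent o fun x => if x = o then o else f x :=
    isParent_of_potential (if_pos rfl) (fun x => T.dist x o) fun x hx => by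
      simpa only [if_neg hx] using (hf x hx).2
  have hstepAdj : ∀ a b, a ≠ b → (if a = o then o else f a) = b → T.Adj a b := by
    intro a b hab h
    by_cases ha : a = o
    · rw [if_pos ha] at h; exact absurd (ha.trans h) hab
    · rw [if_neg ha] at h; exact h ▸ (hf a ha).1
  have hle : parentGraph (fun x => if x = o then o else f x) ≤ T := by
    intro x y hxy
    obtain ⟨hne, h | h⟩ := parentGraph_adj.1 hxy
    · exact hstepAdj x y hne h
    · exact (hstepAdj y x hne.symm h).symm
  exact ⟨_, hp, le_antisymm hle
    ((SimpleGraph.isTree_iff_minimal_connected.1 hT).2 hp.connected hle)⟩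

open Classical in
theorem card_trees_eq {n : ℕ} (E : Set (SimpleGraph (Fin (n + 1)))) :
    (Finset.univ.filter fun T : SimpleGraph (Fin (n + 1)) =>
      T.Connected ∧ T.IsAcyclic ∧ T ∈ E).card =
    (Finset.univ.filter fun p : Fin (n + 1) → Fin (n + 1) =>
      IsParent 0 p ∧ parentGraph p ∈ E).card := by
  symm
  refine Finset.card_bij (fun p _ => parentGraph p) ?_ ?_ ?_
  · intro p hp
    simp only [Finset.mem_filter, Finset.mem_univ, true_and] at hp ⊢
    exact ⟨hp.1.connected, hp.1.isTree.isAcyclic, hp.2⟩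
  · intro p hp q hq h
    simp only [Finset.mem_filter, Finset.mem_univ, true_and] at hp hq
    exact parentGraph_inj hp.1 hq.1 h
  · intro T hT
    simp only [Finset.mem_filter, Finset.mem_univ, true_and] at hT
    obtain ⟨p, hp, rfl⟩ := exists_parent ⟨hT.1, hT.2.1⟩ 0
    exact ⟨p, by simp [hp, hT.2.2], rfl⟩

theorem card_leafChildren_le_D {n : ℕ} {p : Fin (n + 1) → Fin (n + 1)} (v : Fin (n + 1)) :
    (leafChildren p v).card ≤ D (parentGraph p) := by
  refine card_twins_le_D _ _ ?_
  have h : ∀ s ∈ leafChildren p v, ∀ z, (parentGraph p).Adj s z ↔ v = z := by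
    intro s hs z
    obtain ⟨h1, h2⟩ := mem_leafChildren.1 hs
    rw [parentGraph_adj, h2]
    constructor
    · rintro ⟨-, h | h⟩
      · exact h
      · exact absurd h (h1 z)
    · rintro rfl
      exact ⟨fun h => h1 s (h2.trans h.symm), Or.inl rfl⟩
  intro s hs t ht z
  rw [h s hs, h t ht]

end ParentGraph

end FODef

namespace FODef

section Asymptotics

open Filter Topology

/-- The load threshold. -/
noncomputable def threshold (ε : ℝ) (n : ℕ) : ℕ :=
  ⌈(1 - ε) * (Real.log n / Real.log (Real.log n))⌉₊ + 1

theorem tendsto_lowLoad_bound {ε : ℝ} (hε : 0 < ε) (hε1 : ε < 1) {c : ℝ} (hc : 0 < c)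
    (hc1 : c ≤ 1) :
    Tendsto (fun n : ℕ => Real.exp 1 * √n * Real.exp (-(c * n / threshold ε n *
      (Real.exp (-(threshold ε n : ℝ)) * (c / threshold ε n) ^ threshold ε n)))) atTop (𝓝 0) := by
  have hL : Tendsto (fun n : ℕ => Real.log n) atTop atTop :=
    Real.tendsto_log_atTop.comp tendsto_natCast_atTop_atTop
  have hl : Tendsto (fun n : ℕ => Real.log (Real.log n)) atTop atTop :=
    Real.tendsto_log_atTop.comp hL
  have hy : Tendsto (fun n : ℕ => Real.exp (ε / 2 * Real.log n)) atTop atTop :=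
    Real.tendsto_exp_atTop.comp (hL.const_mul_atTop (by positivity))
  have hmain := ((tendsto_rpow_mul_exp_neg_mul_atTop_nhds_zero (1 / ε) 1 one_pos).comp hy).const_mul
    (Real.exp 1)
  rw [mul_zero] at hmain
  refine squeeze_zero' (Eventually.of_forall fun n => by positivity) ?_ hmain
  set C := 1 - Real.log c with hC
  have hC1 : 1 ≤ C := by have := Real.log_nonpos hc.le hc1; linarith
  have hlL : ∀ᶠ n : ℕ in atTop, Real.log (Real.log n) ≤ ε / 24 * Real.log n := by
    have := (Real.isLittleO_log_id_atTop.comp_tendsto hL).def (show (0 : ℝ) < ε / 24 by positivity)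
    filter_upwards [this, hL.eventually_ge_atTop 0] with n hn h0
    simp only [Function.comp_apply, id, Real.norm_eq_abs, abs_of_nonneg h0] at hn
    exact (le_abs_self _).trans hn
  filter_upwards [hlL, hL.eventually_ge_atTop (24 * C / ε), hl.eventually_ge_atTop (8 * C / ε),
    hl.eventually_ge_atTop 1, eventually_gt_atTop 0] with n h1 h2 h3 h4 hn
  set L := Real.log n with hLdef
  set l := Real.log L with hldef
  set k := threshold ε n with hk
  have hnR : (0 : ℝ) < n := by exact_mod_cast hn
  rw [div_le_iff₀ hε] at h2 h3
  have hL0 : 0 < L := by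
    have : 0 < L * ε := by linarith
    exact pos_of_mul_pos_left this hε.le
  have hl0 : 0 < l := by linarith
  have hX0 : 0 ≤ (1 - ε) * (L / l) := mul_nonneg (by linarith) (by positivity)
  have hkX : (k : ℝ) ≤ (1 - ε) * (L / l) + 2 := by
    have := (Nat.ceil_lt_add_one hX0).le
    rw [hk, threshold]
    push_cast
    linarith
  have hk0 : (0 : ℝ) < k := by rw [hk, threshold]; positivity
  have hXL : L / l ≤ L := div_le_self hL0.le h4
  have hkL : (k : ℝ) ≤ L := by
    have : 2 ≤ ε * L := by nlinarith
    nlinarith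
  have hlogk : Real.log k ≤ l := Real.log_le_log hk0 hkL
  have hexp : Real.exp (ε / 2 * L) ≤ c * n / k * (Real.exp (-(k : ℝ)) * (c / k) ^ k) := by
    have e1 : c * n / k * (Real.exp (-(k : ℝ)) * (c / k) ^ k) =
        Real.exp (Real.log c + L - Real.log k + (-k + k * (Real.log c - Real.log k))) := by
      rw [Real.exp_add, Real.exp_sub, Real.exp_add, Real.exp_log hc, Real.exp_log hnR,
        Real.exp_log hk0, Real.exp_add, Real.exp_nat_mul, Real.exp_sub, Real.exp_log hc,
        Real.exp_log hk0]
    rw [e1, Real.exp_le_exp]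
    have e2 : (k + 1) * (Real.log k + C) ≤ ((1 - ε) * (L / l) + 3) * (l + C) := by
      have ha : (k + 1) * (Real.log k + C) ≤ (k + 1) * (l + C) := by gcongr
      have hb : (k + 1) * (l + C) ≤ ((1 - ε) * (L / l) + 3) * (l + C) := by
        refine mul_le_mul_of_nonneg_right (by linarith) (by linarith)
      exact ha.trans hb
    have e3 : ((1 - ε) * (L / l) + 3) * (l + C) =
        (1 - ε) * L + 3 * l + 3 * C + (1 - ε) * (C / l) * L := by
      field_simp
      ring
    have e4 : (1 - ε) * (C / l) * L ≤ ε / 8 * L := by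
      refine mul_le_mul_of_nonneg_right ?_ hL0.le
      have : C / l ≤ ε / 8 := by rw [div_le_iff₀ hl0]; linarith
      have : 0 ≤ C / l := by positivity
      nlinarith
    have e5 : Real.log c = 1 - C := by rw [hC]; ring
    rw [e5]
    nlinarith
  simp only [Function.comp_apply]
  have hsqrt : √(n : ℝ) = Real.exp (ε / 2 * L) ^ (1 / ε) := by
    rw [← Real.exp_mul, Real.sqrt_eq_rpow, Real.rpow_def_of_pos hnR]
    congr 1
    field_simp
    rfl
  rw [← hsqrt, mul_assoc]
  refine mul_le_mul_of_nonneg_left (mul_le_mul_of_nonneg_left ?_ (by positivity)) (by positivity)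
  rw [Real.exp_le_exp]
  linarith

end Asymptotics

section Trees

open Classical in
theorem card_lowLoad_total_le {n k : ℕ} (hk : 0 < k) {c : ℝ} (hc : 0 < c) (hc1 : c ≤ 1 / 8)
    (hn : 1 ≤ c * (n + 1 : ℕ)) :
    ((Finset.univ.filter fun p : Fin (n + 1) → Fin (n + 1) =>
        IsParent 0 p ∧ ∀ v, (leafChildren p v).card < k).card : ℝ) ≤
      (Finset.univ.filter fun p : Fin (n + 1) → Fin (n + 1) => IsParent 0 p).card *
        (8 * c + 2 * (Real.exp 1 * √(n + 1 : ℕ) * Real.exp (-(c / 2 * (n + 1 : ℕ) / k *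
          (Real.exp (-k) * (c / 2 / k) ^ k))))) := by
  set N := n + 1 with hN
  set η := Real.exp 1 * √N * Real.exp (-(c / 2 * N / k * (Real.exp (-k) * (c / 2 / k) ^ k)))
  set all := Finset.univ.filter fun p : Fin N → Fin N => IsParent 0 p
  set l := ⌊c * N⌋₊ with hl
  set few := Finset.univ.filter fun p : Fin N → Fin N => IsParent 0 p ∧ (leaves p).card ≤ l
    with hfewdef
  let bad : ℕ → Finset (Fin N → Fin N) := fun τ => Finset.univ.filter fun p => IsParent 0 p ∧
    (∀ v, (leafChildren p v).card < k) ∧ c / 2 * Fintype.card (Fin N) ≤ (parityLeaves 0 τ p).card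
  have hN8 : (8 : ℝ) ≤ N := by
    have : (0 : ℝ) ≤ N := Nat.cast_nonneg _
    nlinarith
  have hlc : (l : ℝ) ≤ c * N := Nat.floor_le (by positivity)
  have hbad : ∀ τ, ((bad τ).card : ℝ) ≤ all.card * η := fun τ => by
    have h := card_lowLoad_parents_le (V := Fin N) 0 τ hk (half_pos hc)
    simp only [Fintype.card_fin] at h
    simp only [bad, Fintype.card_fin]
    convert h
  have hfew : (few.card : ℝ) ≤ all.card * (8 * c) := by
    have h1 : few.card * ((N - (2 * l + 1)) * (N - 1)) ≤ all.card * ((l + 1) * N) := by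
      have h := card_few_leaves_mul_le (V := Fin N) 0 l
      rw [Fintype.card_fin] at h
      convert h
    have hle : 2 * l + 1 ≤ N := by
      have : (2 * l + 1 : ℝ) ≤ N := by nlinarith
      exact_mod_cast this
    have h2 : (few.card : ℝ) * ((N - (2 * l + 1)) * (N - 1)) ≤ all.card * ((l + 1) * N) := by
      have := (Nat.cast_le (α := ℝ)).2 h1
      rw [Nat.cast_mul, Nat.cast_mul, Nat.cast_mul, Nat.cast_mul, Nat.cast_sub hle,
        Nat.cast_sub (by omega)] at this
      push_cast at this ⊢
      exact this
    have h3 : (N : ℝ) / 2 * (N / 2) ≤ (N - (2 * l + 1)) * (N - 1) :=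
      mul_le_mul (by nlinarith) (by linarith) (by linarith) (by nlinarith)
    have h4 : (few.card : ℝ) * (N / 2 * (N / 2)) ≤ all.card * (2 * (c * N) * N) :=
      (mul_le_mul_of_nonneg_left h3 (Nat.cast_nonneg _)).trans (h2.trans
        (mul_le_mul_of_nonneg_left (mul_le_mul_of_nonneg_right (by linarith) (by linarith))
          (Nat.cast_nonneg _)))
    have h5 : (0 : ℝ) < N * N := by nlinarith
    refine le_of_mul_le_mul_right ?_ h5
    linarith
  have hsub : (Finset.univ.filter fun p : Fin N → Fin N =>
      IsParent 0 p ∧ ∀ v, (leafChildren p v).card < k) ⊆ few ∪ (bad 0 ∪ bad 1) := by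
    intro p hp
    simp only [Finset.mem_filter, Finset.mem_univ, true_and] at hp
    simp only [bad, hfewdef, Finset.mem_union, Finset.mem_filter, Finset.mem_univ, true_and, hp.1,
      hp.2, Fintype.card_fin, implies_true]
    by_contra! hcon
    obtain ⟨h1, h2, h3⟩ := hcon
    have h4 : (leaves p).card = (parityLeaves 0 0 p).card + (parityLeaves 0 1 p).card := by
      unfold parityLeaves
      rw [← Finset.card_filter_add_card_filter_not (s := leaves p)
        (fun x => height 0 p x % 2 = 0)]
      congr 2
      ext x
      simp
    have h5 : c * N < (leaves p).card := Nat.lt_of_floor_lt h1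
    rw [h4] at h5
    push_cast at h5
    linarith
  have h6 : ((Finset.univ.filter fun p : Fin N → Fin N =>
      IsParent 0 p ∧ ∀ v, (leafChildren p v).card < k).card : ℝ) ≤
      few.card + ((bad 0).card + (bad 1).card) := by
    exact_mod_cast (Finset.card_le_card hsub).trans ((Finset.card_union_le _ _).trans
      (Nat.add_le_add_left (Finset.card_union_le _ _) _))
  have := hbad 0
  have := hbad 1
  linarith

open Classical in
theorem treeProb_eq {n : ℕ} (E : Set (SimpleGraph (Fin (n + 1)))) :
    treeProb (n + 1) E = ((Finset.univ.filter fun p : Fin (n + 1) → Fin (n + 1) =>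
      IsParent 0 p ∧ parentGraph p ∈ E).card : ℝ) /
      (Finset.univ.filter fun p : Fin (n + 1) → Fin (n + 1) => IsParent 0 p).card := by
  unfold treeProb
  rw [card_trees_eq E]
  have h := card_trees_eq (n := n) Set.univ
  simp only [Set.mem_univ, and_true] at h
  rw [h]

theorem treeProb_D_bounds {n k : ℕ} (hk : 0 < k) {c : ℝ} (hc : 0 < c) (hc1 : c ≤ 1 / 8)
    (hn : 1 ≤ c * (n + 1 : ℕ)) {a : ℝ} (ha : a ≤ k) :
    1 - (8 * c + 2 * (Real.exp 1 * √(n + 1 : ℕ) * Real.exp (-(c / 2 * (n + 1 : ℕ) / k *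
          (Real.exp (-k) * (c / 2 / k) ^ k))))) ≤
      treeProb (n + 1) {T | a ≤ (D T : ℝ)} ∧ treeProb (n + 1) {T | a ≤ (D T : ℝ)} ≤ 1 := by
  classical
  rw [treeProb_eq]
  set all := Finset.univ.filter fun p : Fin (n + 1) → Fin (n + 1) => IsParent 0 p with hall
  set good := Finset.univ.filter fun p : Fin (n + 1) → Fin (n + 1) =>
    IsParent 0 p ∧ parentGraph p ∈ {T | a ≤ (D T : ℝ)} with hgood
  have hpos : (0 : ℝ) < all.card := by
    have : all.Nonempty := ⟨fun _ => 0, by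
      simp only [hall, Finset.mem_filter, Finset.mem_univ, true_and]
      exact ⟨rfl, fun x => ⟨1, rfl⟩⟩⟩
    exact_mod_cast this.card_pos
  have hbound := card_lowLoad_total_le hk hc hc1 hn
  have hcover : (all.card : ℝ) ≤ good.card + (Finset.univ.filter
      fun p : Fin (n + 1) → Fin (n + 1) =>
        IsParent 0 p ∧ ∀ v, (leafChildren p v).card < k).card := by
    have hsub : all ⊆ good ∪ Finset.univ.filter fun p : Fin (n + 1) → Fin (n + 1) =>
        IsParent 0 p ∧ ∀ v, (leafChildren p v).card < k := by
      intro p hp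
      simp only [hall, Finset.mem_filter, Finset.mem_univ, true_and] at hp
      simp only [hgood, Finset.mem_union, Finset.mem_filter, Finset.mem_univ, true_and, hp,
        Set.mem_ofPred_eq]
      by_contra! hcon
      obtain ⟨h1, v, hv⟩ := hcon
      have h2 : ((leafChildren p v).card : ℝ) ≤ D (parentGraph p) := by
        exact_mod_cast card_leafChildren_le_D v
      have h3 : (k : ℝ) ≤ (leafChildren p v).card := by exact_mod_cast hv
      linarith
    exact_mod_cast (Finset.card_le_card hsub).trans (Finset.card_union_le _ _)
  constructor
  · rw [le_div_iff₀ hpos]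
    linarith
  · rw [div_le_one hpos]
    exact_mod_cast Finset.card_le_card fun p hp => by
      simp only [hall, hgood, Finset.mem_filter, Finset.mem_univ, true_and] at hp ⊢
      exact hp.1

end Trees

end FODef

open Filter FODef

theorem statement4 (ε : ℝ) (hε : 0 < ε) :
    Tendsto (fun n : ℕ => treeProb n
        {T | (1 - ε) * (Real.log n / Real.log (Real.log n)) ≤ (D T : ℝ)})
      atTop (nhds 1) := by
  rw [Metric.tendsto_atTop']
  intro δ hδ
  have hε' : 0 < min ε (1 / 2) := lt_min hε (by norm_num)
  set c : ℝ := min (1 / 8) (δ / 32) with hc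
  have hc0 : 0 < c := lt_min (by norm_num) (by positivity)
  have hc8 : c ≤ 1 / 8 := min_le_left _ _
  have hcδ : c ≤ δ / 32 := min_le_right _ _
  have h1 := (tendsto_lowLoad_bound hε' ((min_le_right _ _).trans_lt (by norm_num))
    (half_pos hc0) (by linarith)).eventually_lt_const (show (0 : ℝ) < δ / 4 by positivity)
  have h2 : ∀ᶠ n : ℕ in atTop, 1 ≤ c * n :=
    (tendsto_natCast_atTop_atTop.const_mul_atTop hc0).eventually_ge_atTop 1
  have h3 : ∀ᶠ n : ℕ in atTop, 0 ≤ Real.log n / Real.log (Real.log n) := by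
    have hL : Tendsto (fun n : ℕ => Real.log n) atTop atTop :=
      Real.tendsto_log_atTop.comp tendsto_natCast_atTop_atTop
    filter_upwards [hL.eventually_ge_atTop 1] with n hn
    exact div_nonneg (by linarith) (Real.log_nonneg hn)
  obtain ⟨M, hM⟩ := eventually_atTop.1 (h1.and (h2.and (h3.and (eventually_gt_atTop 0))))
  refine ⟨M, fun n hn => ?_⟩
  obtain ⟨h1, h2, h3, h4⟩ := hM n hn.le
  obtain ⟨n, rfl⟩ := Nat.exists_eq_succ_of_ne_zero h4.ne'
  have ha : (1 - ε) * (Real.log (n + 1 : ℕ) / Real.log (Real.log (n + 1 : ℕ))) ≤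
      threshold (min ε (1 / 2)) (n + 1) := by
    refine le_trans (mul_le_mul_of_nonneg_right
      (sub_le_sub_left (min_le_left ε (1 / 2)) 1) h3) ?_
    unfold threshold
    push_cast
    exact (Nat.le_ceil _).trans (le_add_of_nonneg_right zero_le_one)
  obtain ⟨hlow, hup⟩ := treeProb_D_bounds (Nat.succ_pos _) hc0 hc8 h2 ha
  rw [Real.dist_eq, abs_sub_lt_iff]
  simp only [Nat.succ_eq_add_one, threshold] at h1 hlow hup ⊢
  constructor <;> linarith
end
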